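/- Suppose p > 2, (H1), and let (λ_n, μ_n, u_n) be a sequence of solutions of (q) with μ_n → ∞; let (ρ_{0,n}) be the sequence from the first-bubble theorem. Then for every k ∈ ℕ there exist sequences (r_{k,n}), (ρ_{k,n}), (ρ̄_{k,n}) ⊂ (0,1) such that: u_n(r_{k,n})/μ_n → δ_k; p·λ_n·r_{k,n}²·u_n(r_{k,n})^{p−1}·f(u_n(r_{k,n})) → a_k²/2; u_n(ρ_{k,n})/μ_n → δ_k; u_n(ρ̄_{k,n})/μ_n → δ_k; ρ_{k−1,n}/ρ̄_{k,n} → 0; ρ̄_{k,n}/r_{k,n} → 0; r_{k,n}/ρ_{k,n} → 0; and, defining γ_{k,n} > 0 by γ_{k,n}²·p·λ_n·u_n(r_{k,n})^{p−1}·f(u_n(r_{k,n})) = 1 and z_{k,n}(r) = p·u_n(r_{k,n})^{p−1}·(u_n(γ_{k,n}·r) − u_n(r_{k,n})), one has, up to a subsequence, γ_{k,n} → 0 and ‖z_{k,n} − z_k‖_{C²([ρ̄_{k,n}/γ_{k,n}, ρ_{k,n}/γ_{k,n}])} → 0, where z_k(r) = log(2·a_k²·b_k/(r^{2−a_k}·(1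 + b_k·r^{a_k})²)) with b_k = (√2/a_k)^{a_k}, which satisfies −z_k'' − z_k'/r = e^{z_k} on (0,∞), z_k(a_k/√2) = 0, −(a_k/√2)·z_k'(a_k/√2) = 2, and ∫₀^∞ e^{z_k}·r dr = 2·a_k. Moreover p·μ_n^{p−1}·∫_{ρ_{k−1,n}}^{ρ̄_{k,n}} λ_n f(u_n)·r dr → 0, p·μ_n^{p−1}·∫_{ρ̄_{k,n}}^{ρ_{k,n}} λ_n f(u_n)·r dr → 2·a_k/δ_k^{p−1}, p·∫_{ρ_{k−1,n}}^{ρ̄_{k,n}} λ_n u_n^{p−1} f(u_n)·r dr → 0, and p·∫_{ρ̄_{k,n}}^{ρ_{k,n}} λ_n u_n^{p−1} f(u_n)·r dr → 2·a_k as n → ∞. -/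

import Mathlib

open Filter

/-- The bubble sequences `(a_k)`, `(δ_k)` for `p > 2`. -/
def IsBubbleSeq (p : ℝ) (a δ : ℕ → ℝ) : Prop :=
  a 0 = 2 ∧ δ 0 = 1 ∧
  ∀ k : ℕ,
    δ (k + 1) ∈ Set.Ioo 0 (δ k) ∧
    2 * p / (2 + a k) * (1 - δ (k + 1) / δ k) - 1 + (δ (k + 1) / δ k) ^ p = 0 ∧
    a (k + 1) = 2 - (δ (k + 1) / δ k) ^ (p - 1) * (2 + a k) ∧
    a (k + 1) ∈ Set.Ioo (0:ℝ) 2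

/-- The singular limit profile `z_k(r) = log (2 α² b / (r^{2-α} (1 + b r^α)²))` with
`b = (√2/α)^α`. -/
noncomputable def bubbleProfile (α : ℝ) (r : ℝ) : ℝ :=
  Real.log (2 * α ^ 2 * (Real.sqrt 2 / α) ^ α /
    (r ^ (2 - α) * (1 + (Real.sqrt 2 / α) ^ α * r ^ α) ^ 2))

open Set Topology

/-- The logistic solution of `W' = (α² - (W - 2)²) / 2` with `W 0 = 2`. -/
noncomputable def liouvilleSlope (α τ : ℝ) : ℝ := 2 + α - 2 * α / (1 + Real.exp (α * τ))

/-- The derivative of `liouvilleSlope`. -/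
noncomputable def liouvilleMass (α τ : ℝ) : ℝ := (α ^ 2 - (liouvilleSlope α τ - 2) ^ 2) / 2

lemma liouvilleMass_eq (α τ : ℝ) :
    liouvilleMass α τ = 2 * α ^ 2 * Real.exp (α * τ) / (1 + Real.exp (α * τ)) ^ 2 := by
  have h : 0 < 1 + Real.exp (α * τ) := by positivity
  unfold liouvilleMass liouvilleSlope
  field_simp
  ring

lemma hasDerivAt_liouvilleSlope (α τ : ℝ) :
    HasDerivAt (liouvilleSlope α) (liouvilleMass α τ) τ := by
  have h : 0 < 1 + Real.exp (α * τ) := by positivity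
  have h1 : HasDerivAt (fun τ => 1 + Real.exp (α * τ)) (Real.exp (α * τ) * α) τ := by
    simpa using (((hasDerivAt_id τ).const_mul α).exp).const_add 1
  have h2 := ((h1.inv h.ne').const_mul (2 * α)).const_sub (2 + α)
  have h3 : liouvilleSlope α = fun τ => 2 + α - 2 * α * (1 + Real.exp (α * τ))⁻¹ := by
    funext τ
    simp [liouvilleSlope, div_eq_mul_inv]
  rw [h3, liouvilleMass_eq]
  refine h2.congr_deriv ?_
  field_simp

lemma liouvilleSlope_mem {α : ℝ} (hα : 0 ≤ α) (τ : ℝ) :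
    liouvilleSlope α τ ∈ Icc (2 - α) (2 + α) := by
  have h : 0 < Real.exp (α * τ) := Real.exp_pos _
  have h1 : 2 * α / (1 + Real.exp (α * τ)) ≤ 2 * α := div_le_self (by linarith) (by linarith)
  have h2 : 0 ≤ 2 * α / (1 + Real.exp (α * τ)) := by positivity
  constructor <;> unfold liouvilleSlope <;> linarith

lemma liouvilleMass_pos {α : ℝ} (hα : 0 < α) (τ : ℝ) : 0 < liouvilleMass α τ := by
  rw [liouvilleMass_eq]; positivity

lemma liouvilleMass_le (α τ : ℝ) : liouvilleMass α τ ≤ α ^ 2 / 2 := by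
  unfold liouvilleMass
  nlinarith [sq_nonneg (liouvilleSlope α τ - 2)]

lemma liouvilleSlope_zero (α : ℝ) : liouvilleSlope α 0 = 2 := by
  simp [liouvilleSlope]; ring

lemma tendsto_liouvilleSlope_atTop {α : ℝ} (hα : 0 < α) :
    Tendsto (liouvilleSlope α) atTop (𝓝 (2 + α)) := by
  have h1 : Tendsto (fun τ => 1 + Real.exp (α * τ)) atTop atTop :=
    tendsto_atTop_add_const_left _ _ (Real.tendsto_exp_atTop.comp (tendsto_id.const_mul_atTop hα))
  have h2 := (h1.const_div_atTop (2 * α)).const_sub (2 + α)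
  rwa [sub_zero] at h2

lemma tendsto_liouvilleSlope_atBot {α : ℝ} (hα : 0 < α) :
    Tendsto (liouvilleSlope α) atBot (𝓝 (2 - α)) := by
  have h1 : Tendsto (fun τ => 1 + Real.exp (α * τ)) atBot (𝓝 (1 + 0)) :=
    (Real.tendsto_exp_atBot.comp (tendsto_id.const_mul_atBot hα)).const_add 1
  have h2 := ((tendsto_const_nhds (x := 2 * α)).div h1 (by norm_num)).const_sub (2 + α)
  rwa [show 2 + α - 2 * α / (1 + 0) = 2 - α by ring] at h2

lemma tendsto_liouvilleMass_atTop {α : ℝ} (hα : 0 < α) :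
    Tendsto (liouvilleMass α) atTop (𝓝 0) := by
  have h := ((((tendsto_liouvilleSlope_atTop hα).sub_const 2).pow 2).const_sub (α ^ 2)).div_const 2
  rwa [show (α ^ 2 - (2 + α - 2) ^ 2) / 2 = 0 by ring] at h

/-- The logarithmic variable in which `bubbleProfile` becomes autonomous. -/
noncomputable def bubbleTime (α r : ℝ) : ℝ := Real.log (Real.sqrt 2 / α * r)

lemma exp_bubbleTime {α r : ℝ} (hα : 0 < α) (hr : 0 < r) :
    Real.exp (α * bubbleTime α r) = (Real.sqrt 2 / α) ^ α * r ^ α := by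
  rw [← Real.mul_rpow (by positivity) hr.le, Real.rpow_def_of_pos (by positivity), bubbleTime,
    mul_comm]

lemma hasDerivAt_bubbleTime {α r : ℝ} (hα : 0 < α) (hr : 0 < r) :
    HasDerivAt (bubbleTime α) (1 / r) r := by
  have h0 : (0:ℝ) < Real.sqrt 2 / α := by positivity
  have h := ((hasDerivAt_id r).const_mul (Real.sqrt 2 / α)).log (mul_pos h0 hr).ne'
  refine h.congr_deriv ?_
  rw [mul_one, id, div_mul_cancel_left₀ h0.ne', one_div]

lemma hasDerivAt_bubbleProfile {α r : ℝ} (hα : 0 < α) (hr : 0 < r) :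
    HasDerivAt (bubbleProfile α) (-liouvilleSlope α (bubbleTime α r) / r) r := by
  set b := (Real.sqrt 2 / α) ^ α with hb
  have hb0 : 0 < b := by positivity
  have hev : bubbleProfile α =ᶠ[𝓝 r] fun r => Real.log (2 * α ^ 2 * b) -
      ((2 - α) * Real.log r + 2 * Real.log (1 + b * r ^ α)) := by
    filter_upwards [lt_mem_nhds hr] with x hx
    have hx1 : 0 < x ^ (2 - α) := by positivity
    have hx2 : 0 < 1 + b * x ^ α := by positivity
    rw [bubbleProfile, ← hb, Real.log_div (by positivity) (by positivity),
      Real.log_mul hx1.ne' (by positivity), Real.log_rpow hx, Real.log_pow]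
    norm_num
  refine HasDerivAt.congr_of_eventuallyEq ?_ hev
  have hr2 : 0 < 1 + b * r ^ α := by positivity
  have h1 : HasDerivAt (fun r => 1 + b * r ^ α) (b * (α * r ^ (α - 1))) r :=
    ((Real.hasDerivAt_rpow_const (Or.inl hr.ne')).const_mul b).const_add 1
  have h2 := (((Real.hasDerivAt_log hr.ne').const_mul (2 - α)).add
    ((h1.log hr2.ne').const_mul 2)).const_sub (Real.log (2 * α ^ 2 * b))
  refine h2.congr_deriv ?_
  rw [liouvilleSlope, exp_bubbleTime hα hr, ← hb, Real.rpow_sub_one hr.ne']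
  field_simp
  ring

lemma hasDerivAt_deriv_bubbleProfile {α r : ℝ} (hα : 0 < α) (hr : 0 < r) :
    HasDerivAt (deriv (bubbleProfile α))
      (liouvilleSlope α (bubbleTime α r) / r ^ 2 - liouvilleMass α (bubbleTime α r) / r ^ 2) r := by
  have hev : deriv (bubbleProfile α) =ᶠ[𝓝 r] fun r => -liouvilleSlope α (bubbleTime α r) / r := by
    filter_upwards [lt_mem_nhds hr] with x hx
    exact (hasDerivAt_bubbleProfile hα hx).deriv
  refine HasDerivAt.congr_of_eventuallyEq ?_ hev
  have h1 := (hasDerivAt_liouvilleSlope α (bubbleTime α r)).comp r (hasDerivAt_bubbleTime hα hr)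
  refine (h1.neg.div (hasDerivAt_id r) hr.ne').congr_deriv ?_
  simp
  field_simp
  ring

lemma exp_bubbleProfile {α r : ℝ} (hα : 0 < α) (hr : 0 < r) :
    Real.exp (bubbleProfile α r) = liouvilleMass α (bubbleTime α r) / r ^ 2 := by
  have h1 : 0 < r ^ (2 - α) := by positivity
  rw [bubbleProfile, Real.exp_log (by positivity), liouvilleMass_eq, exp_bubbleTime hα hr,
    Real.rpow_sub hr, Real.rpow_two]
  field_simp

lemma bubbleProfile_ode {α s : ℝ} (hα : 0 < α) (hs : 0 < s) :
    -(deriv (deriv (bubbleProfile α)) s) - deriv (bubbleProfile α) s / s =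
      Real.exp (bubbleProfile α s) := by
  rw [(hasDerivAt_deriv_bubbleProfile hα hs).deriv, (hasDerivAt_bubbleProfile hα hs).deriv,
    exp_bubbleProfile hα hs]
  field_simp
  ring

lemma bubbleTime_center {α : ℝ} (hα : 0 < α) (c : ℝ) :
    bubbleTime α (α / Real.sqrt 2 * Real.exp c) = c := by
  have : (0:ℝ) < Real.sqrt 2 := by positivity
  rw [bubbleTime]
  rw [show Real.sqrt 2 / α * (α / Real.sqrt 2 * Real.exp c) = Real.exp c by field_simp,
    Real.log_exp]

lemma bubbleProfile_center {α : ℝ} (hα : 0 < α) : bubbleProfile α (α / Real.sqrt 2) = 0 := by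
  have h2 : (0:ℝ) < Real.sqrt 2 := by positivity
  have h := exp_bubbleProfile hα (r := α / Real.sqrt 2) (by positivity)
  have h1 := bubbleTime_center hα 0
  rw [Real.exp_zero, mul_one] at h1
  rw [h1, liouvilleMass, liouvilleSlope_zero] at h
  rw [← Real.exp_eq_one_iff, h, div_pow, Real.sq_sqrt (by norm_num)]
  field_simp
  norm_num

lemma deriv_bubbleProfile_center {α : ℝ} (hα : 0 < α) :
    -(α / Real.sqrt 2) * deriv (bubbleProfile α) (α / Real.sqrt 2) = 2 := by
  have h2 : (0:ℝ) < Real.sqrt 2 := by positivity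
  have h1 := bubbleTime_center hα 0
  rw [Real.exp_zero, mul_one] at h1
  rw [(hasDerivAt_bubbleProfile hα (by positivity)).deriv, h1, liouvilleSlope_zero]
  field_simp

lemma integral_exp_bubbleProfile {α : ℝ} (hα : 0 < α) :
    ∫ s in Ioi (0:ℝ), Real.exp (bubbleProfile α s) * s = 2 * α := by
  have hd : ∀ s ∈ Ioi (0:ℝ), HasDerivAt (fun s => liouvilleSlope α (bubbleTime α s))
      (Real.exp (bubbleProfile α s) * s) s := by
    intro s hs
    have hs' : (0:ℝ) < s := hs
    refine ((hasDerivAt_liouvilleSlope α (bubbleTime α s)).comp s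
      (hasDerivAt_bubbleTime hα hs)).congr_deriv ?_
    rw [exp_bubbleProfile hα hs]
    field_simp
  have h2 : 0 < Real.sqrt 2 / α := by positivity
  have htop : Tendsto (fun s => liouvilleSlope α (bubbleTime α s)) atTop (𝓝 (2 + α)) :=
    (tendsto_liouvilleSlope_atTop hα).comp
      (Real.tendsto_log_atTop.comp (tendsto_id.const_mul_atTop h2))
  have hbot : Tendsto (fun s => liouvilleSlope α (bubbleTime α s)) (𝓝[>] 0) (𝓝 (2 - α)) := by
    refine (tendsto_liouvilleSlope_atBot hα).comp (Real.tendsto_log_nhdsGT_zero.comp ?_)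
    refine tendsto_nhdsWithin_iff.2 ⟨?_, ?_⟩
    · have : Tendsto (fun s : ℝ => Real.sqrt 2 / α * s) (𝓝 0) (𝓝 (Real.sqrt 2 / α * 0)) :=
        tendsto_id.const_mul _
      rw [mul_zero] at this
      exact this.mono_left nhdsWithin_le_nhds
    · filter_upwards [self_mem_nhdsWithin] with s hs
      exact mul_pos h2 hs
  have hnn : ∀ s ∈ Ioi (0:ℝ), 0 ≤ Real.exp (bubbleProfile α s) * s :=
    fun s hs => mul_nonneg (Real.exp_pos _).le (le_of_lt hs)
  set g := Function.update (fun s => liouvilleSlope α (bubbleTime α s)) 0 (2 - α)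
  have hg : ∀ s, 0 < s → g =ᶠ[𝓝 s] fun s => liouvilleSlope α (bubbleTime α s) := by
    intro s hs
    filter_upwards [lt_mem_nhds hs] with x hx
    exact Function.update_of_ne hx.ne' _ _
  rw [MeasureTheory.integral_Ioi_of_hasDerivAt_of_nonneg (g := g) (l := 2 + α) ?_ ?_ hnn ?_]
  · simp only [g, Function.update_self]; ring
  · rw [← Ioi_insert, continuousWithinAt_insert_self, ContinuousWithinAt]
    simp only [g, Function.update_self]
    refine hbot.congr' ?_
    filter_upwards [self_mem_nhdsWithin] with x hx
    exact (hg x hx).eq_of_nhds.symm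
  · exact fun s hs => (hd s hs).congr_of_eventuallyEq (hg s hs)
  · refine htop.congr' ?_
    filter_upwards [eventually_gt_atTop 0] with x hx
    exact (hg x hx).eq_of_nhds.symm

lemma le_of_hasDerivAt_nonneg {F F' : ℝ → ℝ} {s₀ s₁ : ℝ} (hs : s₀ ≤ s₁)
    (hF : ∀ s ∈ Icc s₀ s₁, HasDerivAt F (F' s) s) (hF' : ∀ s ∈ Icc s₀ s₁, 0 ≤ F' s) :
    F s₀ ≤ F s₁ := by
  have hmono : MonotoneOn F (Icc s₀ s₁) := by
    refine monotoneOn_of_deriv_nonneg (convex_Icc _ _)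
      (fun s h => (hF s h).continuousAt.continuousWithinAt)
      (fun s h => (hF s (interior_subset h)).differentiableAt.differentiableWithinAt) ?_
    intro s h
    rw [(hF s (interior_subset h)).deriv]
    exact hF' s (interior_subset h)
  exact hmono (left_mem_Icc.2 hs) (right_mem_Icc.2 hs) hs

lemma le_of_hasDerivAt_nonpos {F F' : ℝ → ℝ} {s₀ s₁ : ℝ} (hs : s₀ ≤ s₁)
    (hF : ∀ s ∈ Icc s₀ s₁, HasDerivAt F (F' s) s) (hF' : ∀ s ∈ Icc s₀ s₁, F' s ≤ 0) :
    F s₁ ≤ F s₀ := by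
  have h := le_of_hasDerivAt_nonneg (F := fun s => -F s) hs (fun s h => (hF s h).neg)
    (fun s h => by linarith [hF' s h])
  linarith

/-- An approximate trajectory of the Emden–Fowler system on `I`: `v` is the solution in the
variable `s = log r`, `E = -v'`, and `q = p v^{p-1} E'` satisfies
`q' = q (2 - (1 + O(η)) p v^{p-1} E)`. -/
structure EmdenTraj (p η : ℝ) (v E q : ℝ → ℝ) (I : Set ℝ) : Prop where
  v_pos : ∀ s ∈ I, 0 < v s
  E_nonneg : ∀ s ∈ I, 0 ≤ E s
  q_pos : ∀ s ∈ I, 0 < q s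
  hasDerivAt_v : ∀ s ∈ I, HasDerivAt v (-E s) s
  hasDerivAt_E : ∀ s ∈ I, HasDerivAt E (q s / (p * v s ^ (p - 1))) s
  hasDerivAt_q : ∃ d : ℝ → ℝ, ∀ s ∈ I, HasDerivAt q (q s * (2 - d s)) s ∧
    |d s - p * v s ^ (p - 1) * E s| ≤ η * (p * v s ^ (p - 1) * E s)

namespace EmdenTraj

variable {p η s₀ s₁ : ℝ} {v E q : ℝ → ℝ} {I J : Set ℝ}

lemma mono (h : EmdenTraj p η v E q I) (hJ : J ⊆ I) : EmdenTraj p η v E q J :=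
  ⟨fun s hs => h.v_pos s (hJ hs), fun s hs => h.E_nonneg s (hJ hs), fun s hs => h.q_pos s (hJ hs),
    fun s hs => h.hasDerivAt_v s (hJ hs), fun s hs => h.hasDerivAt_E s (hJ hs),
    h.hasDerivAt_q.imp fun _ hd s hs => hd s (hJ hs)⟩

lemma hasDerivAt_slope (h : EmdenTraj p η v E q I) (hp : 0 < p) {s : ℝ} (hs : s ∈ I) :
    HasDerivAt (fun s => p * v s ^ (p - 1) * E s)
      (q s - (p - 1) * (p * v s ^ (p - 1) * E s) * (E s / v s)) s := by
  have hv := h.v_pos s hs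
  have h1 := (((h.hasDerivAt_v s hs).rpow_const (p := p - 1) (Or.inl hv.ne')).const_mul p).mul
    (h.hasDerivAt_E s hs)
  refine h1.congr_deriv ?_
  have h2 : 0 < v s ^ (p - 1) := by positivity
  rw [Real.rpow_sub_one hv.ne']
  field_simp
  ring

lemma hasDerivAt_rpow (h : EmdenTraj p η v E q I) {s : ℝ} (hs : s ∈ I) :
    HasDerivAt (fun s => v s ^ p) (-(p * v s ^ (p - 1) * E s)) s := by
  refine ((h.hasDerivAt_v s hs).rpow_const (p := p) (Or.inl (h.v_pos s hs).ne')).congr_deriv ?_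
  ring

lemma hasDerivAt_log_q (h : EmdenTraj p η v E q I) :
    ∃ d : ℝ → ℝ, ∀ s ∈ I, HasDerivAt (fun s => Real.log (q s)) (2 - d s) s ∧
      |d s - p * v s ^ (p - 1) * E s| ≤ η * (p * v s ^ (p - 1) * E s) :=
  h.hasDerivAt_q.imp fun _ hd s hs => ⟨((hd s hs).1.log (h.q_pos s hs).ne').congr_deriv
    (mul_div_cancel_left₀ _ (h.q_pos s hs).ne'), (hd s hs).2⟩

lemma slope_nonneg (h : EmdenTraj p η v E q I) (hp : 0 < p) {s : ℝ} (hs : s ∈ I) :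
    0 ≤ p * v s ^ (p - 1) * E s :=
  mul_nonneg (mul_nonneg hp.le (Real.rpow_nonneg (h.v_pos s hs).le _)) (h.E_nonneg s hs)

lemma antitone_v (h : EmdenTraj p η v E q (Icc s₀ s₁)) (hs : s₀ ≤ s₁) : v s₁ ≤ v s₀ :=
  le_of_hasDerivAt_nonpos hs h.hasDerivAt_v (fun s hs => by linarith [h.E_nonneg s hs])

lemma monotone_E (h : EmdenTraj p η v E q (Icc s₀ s₁)) (hp : 0 < p) (hs : s₀ ≤ s₁) :
    E s₀ ≤ E s₁ :=
  le_of_hasDerivAt_nonneg hs h.hasDerivAt_E (fun s hs => div_nonneg (h.q_pos s hs).le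
    (mul_nonneg hp.le (Real.rpow_nonneg (h.v_pos s hs).le _)))

/-- Near-conservation of `q - 2 w + w² / 2` with `w = p v^{p-1} E`. -/
lemma abs_energy_sub_le (h : EmdenTraj p η v E q (Icc s₀ s₁)) (hp : 1 < p) (hη : 0 ≤ η)
    (hη1 : η ≤ 1) {C : ℝ} (hs : s₀ ≤ s₁)
    (hC : ∀ s ∈ Icc s₀ s₁, p * v s ^ (p - 1) * E s ≤ C) :
    |(q s₁ - 2 * (p * v s₁ ^ (p - 1) * E s₁) + (p * v s₁ ^ (p - 1) * E s₁) ^ 2 / 2) -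
      (q s₀ - 2 * (p * v s₀ ^ (p - 1) * E s₀) + (p * v s₀ ^ (p - 1) * E s₀) ^ 2 / 2)| ≤
      η * C ^ 2 + (p - 1) * C * (2 + 2 * C) * (Real.log (v s₀) - Real.log (v s₁)) := by
  have hp0 : 0 < p := by linarith
  set w : ℝ → ℝ := fun s => p * v s ^ (p - 1) * E s with hw
  change |(q s₁ - 2 * w s₁ + w s₁ ^ 2 / 2) - (q s₀ - 2 * w s₀ + w s₀ ^ 2 / 2)| ≤ _
  have hw0 : ∀ s ∈ Icc s₀ s₁, 0 ≤ w s := fun s hs => h.slope_nonneg hp0 hs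
  have hC0 : 0 ≤ C := (hw0 s₀ (left_mem_Icc.2 hs)).trans (hC s₀ (left_mem_Icc.2 hs))
  set B := (p - 1) * C * (2 + 2 * C) with hB
  obtain ⟨d, hd⟩ := h.hasDerivAt_q
  have hH : ∀ s ∈ Icc s₀ s₁, HasDerivAt (fun s => q s - 2 * w s + w s ^ 2 / 2)
      (-(d s - w s) * q s + (2 - w s) * ((p - 1) * w s * (E s / v s))) s := by
    intro s hs
    have h1 := h.hasDerivAt_slope hp0 hs
    refine (((hd s hs).1.sub (h1.const_mul 2)).add ((h1.pow 2).div_const 2)).congr_deriv ?_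
    simp only [hw]
    ring
  have hG : ∀ s ∈ Icc s₀ s₁, HasDerivAt (fun s => η * C * w s - B * Real.log (v s))
      (η * C * (q s - (p - 1) * w s * (E s / v s)) + B * (E s / v s)) s := by
    intro s hs
    refine (((h.hasDerivAt_slope hp0 hs).const_mul (η * C)).sub
      (((h.hasDerivAt_v s hs).log (h.v_pos s hs).ne').const_mul B)).congr_deriv ?_
    ring
  have key : ∀ s ∈ Icc s₀ s₁, |-(d s - w s) * q s + (2 - w s) * ((p - 1) * w s * (E s / v s))| ≤
      η * C * (q s - (p - 1) * w s * (E s / v s)) + B * (E s / v s) := by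
    intro s hs
    have hq := h.q_pos s hs
    have hL : 0 ≤ E s / v s := div_nonneg (h.E_nonneg s hs) (h.v_pos s hs).le
    have hwC : w s ≤ C := hC s hs
    have hws := hw0 s hs
    have hdw : |d s - w s| ≤ η * w s := (hd s hs).2
    have h1 : |-(d s - w s) * q s| ≤ η * C * q s := by
      rw [abs_mul, abs_neg, abs_of_pos hq]
      gcongr
      exact hdw.trans (by gcongr)
    have h2 : |(2 - w s) * ((p - 1) * w s * (E s / v s))| ≤
        (2 + C) * ((p - 1) * C * (E s / v s)) := by
      have hp1 : 0 ≤ p - 1 := by linarith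
      rw [abs_mul, abs_of_nonneg (by positivity : 0 ≤ (p - 1) * w s * (E s / v s))]
      gcongr
      rw [abs_le]; constructor <;> linarith
    have h3 : η * C * ((p - 1) * w s * (E s / v s)) ≤ C * ((p - 1) * C * (E s / v s)) := by
      have hp1 : 0 ≤ p - 1 := by linarith
      have : η * C ≤ 1 * C := by gcongr
      rw [one_mul] at this
      gcongr
    refine (abs_add_le _ _).trans ?_
    rw [hB]
    nlinarith
  have e1 := le_of_hasDerivAt_nonneg hs (fun s hs => (hG s hs).add (hH s hs))
    (fun s hs => by linarith [neg_abs_le (-(d s - w s) * q s +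
      (2 - w s) * ((p - 1) * w s * (E s / v s))), key s hs])
  have e2 := le_of_hasDerivAt_nonneg hs (fun s hs => (hG s hs).sub (hH s hs))
    (fun s hs => by linarith [le_abs_self (-(d s - w s) * q s +
      (2 - w s) * ((p - 1) * w s * (E s / v s))), key s hs])
  simp only [Pi.add_apply, Pi.sub_apply] at e1 e2
  have e3 : η * C * (w s₁ - w s₀) ≤ η * C ^ 2 := by
    rw [pow_two, ← mul_assoc]
    have := hw0 s₀ (left_mem_Icc.2 hs)
    have := hC s₁ (right_mem_Icc.2 hs)
    gcongr
    linarith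
  rw [abs_le]
  constructor <;> nlinarith

/-- The elapsed time is controlled by the drop of `v`. -/
lemma mul_sub_le_of_le_E (h : EmdenTraj p η v E q (Icc s₀ s₁)) {e : ℝ} (hs : s₀ ≤ s₁)
    (he : ∀ s ∈ Icc s₀ s₁, e ≤ E s) : e * (s₁ - s₀) ≤ v s₀ - v s₁ := by
  have := le_of_hasDerivAt_nonpos hs
    (fun s hs => (h.hasDerivAt_v s hs).add ((hasDerivAt_id s).const_mul e))
    (fun s hs => by linarith [he s hs])
  simp only [Pi.add_apply, id] at this
  linarith

lemma le_mul_sub_of_E_le (h : EmdenTraj p η v E q (Icc s₀ s₁)) {e : ℝ} (hs : s₀ ≤ s₁)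
    (he : ∀ s ∈ Icc s₀ s₁, E s ≤ e) : v s₀ - v s₁ ≤ e * (s₁ - s₀) := by
  have := le_of_hasDerivAt_nonneg hs
    (fun s hs => (h.hasDerivAt_v s hs).add ((hasDerivAt_id s).const_mul e))
    (fun s hs => by linarith [he s hs])
  simp only [Pi.add_apply, id] at this
  linarith

lemma log_q_sub_le (h : EmdenTraj p η v E q (Icc s₀ s₁)) (hs : s₀ ≤ s₁) :
    Real.log (q s₁) - Real.log (q s₀) ≤ 2 * (s₁ - s₀) - (1 - η) * (v s₀ ^ p - v s₁ ^ p) := by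
  obtain ⟨d, hd⟩ := h.hasDerivAt_log_q
  have := le_of_hasDerivAt_nonpos hs (fun s hs => ((hd s hs).1.sub
    ((hasDerivAt_id s).const_mul 2)).sub ((h.hasDerivAt_rpow hs).const_mul (1 - η)))
    (fun s hs => by linarith [(abs_le.1 (hd s hs).2).1])
  simp only [Pi.sub_apply, id] at this
  linarith

lemma le_log_q_sub (h : EmdenTraj p η v E q (Icc s₀ s₁)) (hs : s₀ ≤ s₁) :
    2 * (s₁ - s₀) - (1 + η) * (v s₀ ^ p - v s₁ ^ p) ≤ Real.log (q s₁) - Real.log (q s₀) := by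
  obtain ⟨d, hd⟩ := h.hasDerivAt_log_q
  have := le_of_hasDerivAt_nonneg hs (fun s hs => ((hd s hs).1.sub
    ((hasDerivAt_id s).const_mul 2)).sub ((h.hasDerivAt_rpow hs).const_mul (1 + η)))
    (fun s hs => by linarith [(abs_le.1 (hd s hs).2).2])
  simp only [Pi.sub_apply, id] at this
  linarith

/-- Away from bubbles `log q` lies below a line in `v`. -/
lemma log_q_le_of_secant (h : EmdenTraj p η v E q (Icc s₀ s₁)) (hp : 1 < p) (hη1 : η ≤ 1)
    {κ : ℝ} (hE : 0 < E s₀) (hv : v s₁ < v s₀)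
    (hκ : 2 * (v s₀ - v s₁) / E s₀ - (1 - η) * (v s₀ ^ p - v s₁ ^ p) ≤ -κ * (v s₀ - v s₁))
    {s : ℝ} (hs : s ∈ Icc s₀ s₁) :
    Real.log (q s) ≤ Real.log (q s₀) - κ * (v s₀ - v s) := by
  have hp0 : 0 < p := by linarith
  have h01 : s₀ ≤ s₁ := hs.1.trans hs.2
  have hsub := h.mono (Icc_subset_Icc_right hs.2)
  have h1 := hsub.log_q_sub_le hs.1
  have h2 := hsub.mul_sub_le_of_le_E hs.1 (e := E s₀)
    (fun x hx => (hsub.mono (Icc_subset_Icc_right hx.2)).monotone_E hp0 hx.1)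
  have hv1 : v s₁ ≤ v s := (h.mono (Icc_subset_Icc_left hs.1)).antitone_v hs.2
  have hv0 : v s ≤ v s₀ := hsub.antitone_v hs.1
  have hd : 0 < v s₀ - v s₁ := by linarith
  set θ := (v s₀ - v s) / (v s₀ - v s₁) with hθ
  have hθ0 : 0 ≤ θ := div_nonneg (by linarith) hd.le
  have hθ1 : θ ≤ 1 := (div_le_one hd).2 (by linarith)
  have hθe : v s₀ - v s = θ * (v s₀ - v s₁) := by rw [hθ]; field_simp
  have hconv := (convexOn_rpow hp.le).2 (mem_Ici.2 (h.v_pos s₀ (left_mem_Icc.2 h01)).le)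
    (mem_Ici.2 (h.v_pos s₁ (right_mem_Icc.2 h01)).le) (sub_nonneg.2 hθ1) hθ0 (by ring)
  simp only [smul_eq_mul] at hconv
  rw [show (1 - θ) * v s₀ + θ * v s₁ = v s by linarith] at hconv
  have h3 : 2 * (s - s₀) ≤ θ * (2 * (v s₀ - v s₁) / E s₀) := by
    rw [mul_div_assoc', le_div_iff₀ hE]
    nlinarith
  have h4 : (1 - η) * (θ * (v s₀ ^ p - v s₁ ^ p)) ≤ (1 - η) * (v s₀ ^ p - v s ^ p) :=
    mul_le_mul_of_nonneg_left (by linarith) (by linarith)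
  have h5 := mul_le_mul_of_nonneg_left hκ hθ0
  rw [hθe]
  nlinarith

lemma E_sub_le_of_secant (h : EmdenTraj p η v E q (Icc s₀ s₁)) (hp : 1 < p) (hη1 : η ≤ 1)
    {κ : ℝ} (hκ0 : 0 < κ) (hE : 0 < E s₀) (h01 : s₀ ≤ s₁) (hv : v s₁ < v s₀)
    (hκ : 2 * (v s₀ - v s₁) / E s₀ - (1 - η) * (v s₀ ^ p - v s₁ ^ p) ≤ -κ * (v s₀ - v s₁)) :
    E s₁ - E s₀ ≤ q s₀ / (p * v s₁ ^ (p - 1)) / (κ * E s₀) := by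
  have hp0 : 0 < p := by linarith
  have hv1 := h.v_pos s₁ (right_mem_Icc.2 h01)
  have hq0 := h.q_pos s₀ (left_mem_Icc.2 h01)
  have hD : 0 < p * v s₁ ^ (p - 1) := by positivity
  set A := q s₀ / (p * v s₁ ^ (p - 1)) with hA
  have hA0 : 0 < A := by positivity
  have hd : ∀ s ∈ Icc s₀ s₁, HasDerivAt
      (fun s => E s + A / (κ * E s₀) * Real.exp (κ * (v s - v s₀)))
      (q s / (p * v s ^ (p - 1)) - A / E s₀ * E s * Real.exp (κ * (v s - v s₀))) s := by
    intro s hs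
    refine ((h.hasDerivAt_E s hs).add (((((h.hasDerivAt_v s hs).sub_const (v s₀)).const_mul
      κ).exp).const_mul (A / (κ * E s₀)))).congr_deriv ?_
    field_simp
    ring
  have := le_of_hasDerivAt_nonpos h01 hd (by
    intro s hs
    have hvs : v s₁ ≤ v s := (h.mono (Icc_subset_Icc_left hs.1)).antitone_v hs.2
    have hEs : E s₀ ≤ E s := (h.mono (Icc_subset_Icc_right hs.2)).monotone_E hp0 hs.1
    have h1 := h.log_q_le_of_secant hp hη1 hE hv hκ hs
    have h2 : q s ≤ q s₀ * Real.exp (κ * (v s - v s₀)) := by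
      rw [← Real.exp_log (h.q_pos s hs), ← Real.exp_log hq0, ← Real.exp_add]
      exact Real.exp_le_exp.2 (by linarith)
    have hp1 : 0 ≤ p - 1 := by linarith
    have h3 : q s / (p * v s ^ (p - 1)) ≤ A * Real.exp (κ * (v s - v s₀)) := by
      rw [hA, div_mul_eq_mul_div]
      gcongr
    have h4 : A * Real.exp (κ * (v s - v s₀)) ≤
        A / E s₀ * E s * Real.exp (κ * (v s - v s₀)) := by
      have : 1 ≤ E s / E s₀ := (one_le_div hE).2 hEs
      rw [show A / E s₀ * E s = A * (E s / E s₀) by ring]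
      gcongr
      nlinarith
    linarith)
  simp only [sub_self, mul_zero, Real.exp_zero, mul_one] at this
  have h5 : 0 ≤ A / (κ * E s₀) * Real.exp (κ * (v s₁ - v s₀)) := by positivity
  linarith

end EmdenTraj

/-- A sequence of solutions in Emden–Fowler variables, with `v n` decreasing from at most `μ n`
to `0` at `s = 0`. -/
structure EmdenSeq (p : ℝ) (μ : ℕ → ℝ) (v E q : ℕ → ℝ → ℝ) : Prop where
  one_lt : 1 < p
  μ_pos : ∀ n, 0 < μ n
  tendsto_μ : Tendsto μ atTop atTop
  hasDerivAt_v : ∀ n, ∀ s < 0, HasDerivAt (v n) (-E n s) s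
  v_pos : ∀ n, ∀ s < 0, 0 < v n s
  v_le : ∀ n, ∀ s < 0, v n s ≤ μ n
  tendsto_v : ∀ n, Tendsto (v n) (𝓝[<] 0) (𝓝 0)
  E_nonneg : ∀ n, ∀ s < 0, 0 ≤ E n s
  monotoneOn_E : ∀ n, MonotoneOn (E n) (Iio 0)
  traj : ∀ c > 0, ∀ η > 0,
    ∀ᶠ n in atTop, EmdenTraj p η (v n) (E n) (q n) {s | s < 0 ∧ c * μ n ≤ v n s}

/-- The state at the end of a bubble at height `δ` with total slope `2 + a`. -/
structure BubbleExit (p : ℝ) (μ : ℕ → ℝ) (v E q : ℕ → ℝ → ℝ) (δ a : ℝ) (s : ℕ → ℝ) : Prop where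
  neg : ∀ n, s n < 0
  height : Tendsto (fun n => v n (s n) / μ n) atTop (𝓝 δ)
  slope : Tendsto (fun n => p * v n (s n) ^ (p - 1) * E n (s n)) atTop (𝓝 (2 + a))
  mass : Tendsto (fun n => q n (s n)) atTop (𝓝 0)
  log_mass : Tendsto (fun n => Real.log (q n (s n)) / μ n ^ p) atTop (𝓝 0)

/-- The state at the center of a bubble at height `δ`, whose profile has exponent `α`. -/
structure BubbleCenter (p : ℝ) (μ : ℕ → ℝ) (v E q : ℕ → ℝ → ℝ) (δ α : ℝ) (t : ℕ → ℝ) : Prop where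
  neg : ∀ᶠ n in atTop, t n < 0
  height : Tendsto (fun n => v n (t n) / μ n) atTop (𝓝 δ)
  slope : Tendsto (fun n => p * v n (t n) ^ (p - 1) * E n (t n)) atTop (𝓝 2)
  mass : Tendsto (fun n => q n (t n)) atTop (𝓝 (α ^ 2 / 2))

namespace EmdenSeq

variable {p : ℝ} {μ : ℕ → ℝ} {v E q : ℕ → ℝ → ℝ}

lemma antitoneOn_v (h : EmdenSeq p μ v E q) (n : ℕ) : AntitoneOn (v n) (Iio 0) := by
  intro a _ b hb hab
  exact le_of_hasDerivAt_nonpos hab (fun s hs => h.hasDerivAt_v n s (hs.2.trans_lt hb))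
    (fun s hs => by linarith [h.E_nonneg n s (hs.2.trans_lt hb)])

lemma exists_v_eq (h : EmdenSeq p μ v E q) (n : ℕ) {s₀ y : ℝ} (hs₀ : s₀ < 0) (hy : 0 < y)
    (hyv : y < v n s₀) : ∃ s, s₀ < s ∧ s < 0 ∧ v n s = y := by
  have h1 : ∀ᶠ s in 𝓝[<] (0:ℝ), v n s < y := (h.tendsto_v n).eventually_lt_const hy
  have h2 : ∀ᶠ s in 𝓝[<] (0:ℝ), s ∈ Ioo s₀ 0 := Ioo_mem_nhdsLT hs₀
  obtain ⟨s', hs', hs'0⟩ := (h1.and h2).exists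
  have hc : ContinuousOn (v n) (Icc s₀ s') := fun s hs =>
    (h.hasDerivAt_v n s (hs.2.trans_lt hs'0.2)).continuousAt.continuousWithinAt
  obtain ⟨s, hs, hsy⟩ := intermediate_value_Ioo' hs'0.1.le hc ⟨hs', hyv⟩
  exact ⟨s, hs.1, hs.2.trans hs'0.2, hsy⟩

lemma eventually_traj_Icc (h : EmdenSeq p μ v E q) {c η : ℝ} (hc : 0 < c) (hη : 0 < η) :
    ∀ᶠ n in atTop, ∀ s₀ s₁, s₁ < 0 → c * μ n ≤ v n s₁ →
      EmdenTraj p η (v n) (E n) (q n) (Icc s₀ s₁) := by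
  filter_upwards [h.traj c hc η hη] with n hn s₀ s₁ hs₁ hv
  refine hn.mono fun s hs => ⟨hs.2.trans_lt hs₁, hv.trans ?_⟩
  exact h.antitoneOn_v n (hs.2.trans_lt hs₁) hs₁ hs.2

lemma tendsto_height_rpow (h : EmdenSeq p μ v E q) {δ : ℝ} (hδ : 0 < δ) {s : ℕ → ℝ}
    (hs : Tendsto (fun n => v n (s n) / μ n) atTop (𝓝 δ)) :
    Tendsto (fun n => v n (s n) ^ p) atTop atTop := by
  have h1 := hs.pos_mul_atTop hδ h.tendsto_μ
  have h2 : Tendsto (fun n => v n (s n)) atTop atTop :=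
    h1.congr fun n => div_mul_cancel₀ _ (h.μ_pos n).ne'
  exact (tendsto_rpow_atTop (by linarith [h.one_lt])).comp h2

/-- Between two bubbles the slope `E` does not change to leading order. -/
lemma tendsto_E_before_bubble (h : EmdenSeq p μ v E q) {δ a x y : ℝ} {s s' : ℕ → ℝ}
    (hs : BubbleExit p μ v E q δ a s) (hδ : 0 < δ) (ha : 0 < a) (hx0 : 0 < x)
    (hx : 2 * p / (2 + a) * (1 - x) - 1 + x ^ p = 0) (hy : y ∈ Ioo x 1)
    (hss' : ∀ n, s n ≤ s' n) (hs' : ∀ n, s' n < 0) (hv : ∀ n, v n (s' n) = y * v n (s n)) :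
    Tendsto (fun n => E n (s' n) / E n (s n)) atTop (𝓝 1) ∧
      Tendsto (fun n => q n (s' n)) atTop (𝓝 0) := by
  have hp := h.one_lt
  have hp0 : 0 < p := by linarith
  have hy0 : 0 < y := hx0.trans hy.1
  have hψ : 2 * p / (2 + a) * (1 - y) - 1 + y ^ p < 0 := by
    have hx1 : x < 1 := hy.1.trans hy.2
    set θ := (y - x) / (1 - x) with hθ
    have hd : 0 < 1 - x := by linarith
    have hθ0 : 0 < θ := div_pos (by linarith [hy.1]) hd
    have hθ1 : θ < 1 := (div_lt_one hd).2 (by linarith [hy.2])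
    have hθe : y = (1 - θ) * x + θ * 1 := by
      rw [hθ]; field_simp; ring
    have hconv := (strictConvexOn_rpow hp).2 (mem_Ici.2 hx0.le)
      (mem_Ici.2 (zero_le_one' ℝ)) hx1.ne (sub_pos.2 hθ1) hθ0 (by ring)
    simp only [smul_eq_mul, Real.one_rpow] at hconv
    rw [← hθe] at hconv
    have h1 : 1 - y = (1 - θ) * (1 - x) := by rw [hθe]; ring
    rw [h1]
    have h2 : (1 - θ) * (2 * p / (2 + a) * (1 - x) - 1 + x ^ p) = 0 := by rw [hx, mul_zero]
    linarith
  set m := -(2 * p / (2 + a) * (1 - y) - 1 + y ^ p) with hm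
  have hm0 : 0 < m := by linarith
  have hy1 : 0 < 1 - y := by linarith [hy.2]
  have hyp : y ^ p < 1 := Real.rpow_lt_one hy0.le hy.2 hp0
  set η := min 1 (m / 4) with hη
  have hη0 : 0 < η := by positivity
  have hη1 : η ≤ 1 := min_le_left _ _
  have hηm : η ≤ m / 4 := min_le_right _ _
  set c := m / 2 / (1 - y) with hc
  have hc0 : 0 < c := by positivity
  have h2a : (2 + a) ≠ 0 := by linarith
  have hw : Tendsto (fun n => 2 * p / (p * v n (s n) ^ (p - 1) * E n (s n)) * (1 - y)) atTop
      (𝓝 (2 * p / (2 + a) * (1 - y))) :=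
    ((tendsto_const_nhds (x := 2 * p)).div hs.slope h2a).mul_const _
  have hgain : Tendsto (fun n => q n (s n) * (p / (y ^ (p - 1) * c *
      (p * v n (s n) ^ (p - 1) * E n (s n)) ^ 2))) atTop (𝓝 0) := by
    have : Tendsto (fun n => p / (y ^ (p - 1) * c *
      (p * v n (s n) ^ (p - 1) * E n (s n)) ^ 2)) atTop
        (𝓝 (p / (y ^ (p - 1) * c * (2 + a) ^ 2))) :=
      (tendsto_const_nhds (x := p)).div ((hs.slope.pow 2).const_mul _) (by positivity)
    simpa using hs.mass.mul this
  have hmain : ∀ᶠ n in atTop, (1 ≤ E n (s' n) / E n (s n) ∧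
      E n (s' n) / E n (s n) ≤ 1 + q n (s n) * (p / (y ^ (p - 1) * c *
      (p * v n (s n) ^ (p - 1) * E n (s n)) ^ 2))) ∧ 0 ≤ q n (s' n) ∧
      q n (s' n) ≤ q n (s n) := by
    filter_upwards [h.eventually_traj_Icc (c := y * (δ / 2)) (by positivity) hη0,
      hs.height.eventually_const_lt (half_lt_self hδ), hs.slope.eventually_const_lt
        (show 0 < 2 + a by linarith),
      hw.eventually_lt_const (show _ < 2 * p / (2 + a) * (1 - y) + m / 4 by linarith)]
      with n htraj hheight hslope hwn
    have hμ := h.μ_pos n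
    have hv0 : 0 < v n (s n) := h.v_pos n _ (hs.neg n)
    have hT := htraj (s n) (s' n) (hs' n) (by
      rw [hv n, mul_assoc]
      rw [lt_div_iff₀ hμ] at hheight
      gcongr)
    have hE0 : 0 < E n (s n) := by
      by_contra hcon
      have : p * v n (s n) ^ (p - 1) * E n (s n) ≤ 0 :=
        mul_nonpos_of_nonneg_of_nonpos (by positivity) (not_lt.1 hcon)
      linarith
    have hlt : v n (s' n) < v n (s n) := by rw [hv n]; nlinarith [hy.2]
    have hvp : v n (s n) ^ (p - 1) * v n (s n) = v n (s n) ^ p := by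
      rw [← Real.rpow_add_one hv0.ne', sub_add_cancel]
    have hvp1 : 0 < v n (s n) ^ (p - 1) := by positivity
    have hκ : 2 * (v n (s n) - v n (s' n)) / E n (s n) -
        (1 - η) * (v n (s n) ^ p - v n (s' n) ^ p) ≤
        -(c * v n (s n) ^ (p - 1)) * (v n (s n) - v n (s' n)) := by
      rw [hv n, Real.mul_rpow hy0.le hv0.le]
      have e1 : 2 * (v n (s n) - y * v n (s n)) / E n (s n) =
          v n (s n) ^ p * (2 * p / (p * v n (s n) ^ (p - 1) * E n (s n)) * (1 - y)) := by
        rw [← hvp]; field_simp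
      have e2 : -(c * v n (s n) ^ (p - 1)) * (v n (s n) - y * v n (s n)) =
          v n (s n) ^ p * (-(m / 2)) := by
        rw [← hvp, hc]; field_simp
      have e3 : (1 - η) * (v n (s n) ^ p - y ^ p * v n (s n) ^ p) =
          v n (s n) ^ p * ((1 - η) * (1 - y ^ p)) := by ring
      rw [e1, e2, e3, ← mul_sub]
      apply mul_le_mul_of_nonneg_left _ (by positivity)
      have : η * (1 - y ^ p) ≤ m / 4 := by
        have h0 : 0 < y ^ p := by positivity
        nlinarith
      linarith
    have hcv : 0 < c * v n (s n) ^ (p - 1) := by positivity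
    have g1 := hT.E_sub_le_of_secant hp hη1 hcv hE0 (hss' n) hlt hκ
    have g2 := hT.log_q_le_of_secant hp hη1 hE0 hlt hκ (right_mem_Icc.2 (hss' n))
    have hq0 := hT.q_pos _ (left_mem_Icc.2 (hss' n))
    have hq1 := hT.q_pos _ (right_mem_Icc.2 (hss' n))
    refine ⟨⟨(one_le_div hE0).2 (hT.monotone_E hp0 (hss' n)), ?_⟩, hq1.le, ?_⟩
    · rw [div_le_iff₀ hE0]
      rw [hv n, Real.mul_rpow hy0.le hv0.le] at g1
      have e4 : q n (s n) / (p * (y ^ (p - 1) * v n (s n) ^ (p - 1))) /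
          (c * v n (s n) ^ (p - 1) * E n (s n)) = q n (s n) * (p / (y ^ (p - 1) * c *
          (p * v n (s n) ^ (p - 1) * E n (s n)) ^ 2)) * E n (s n) := by
        have : 0 < y ^ (p - 1) := by positivity
        field_simp
      rw [e4] at g1
      linarith
    · rw [← Real.log_le_log_iff hq1 hq0]
      nlinarith
  constructor
  · refine tendsto_of_tendsto_of_tendsto_of_le_of_le' tendsto_const_nhds ?_
      (hmain.mono fun n hn => hn.1.1) (hmain.mono fun n hn => hn.1.2)
    simpa using hgain.const_add 1
  · exact tendsto_of_tendsto_of_tendsto_of_le_of_le' tendsto_const_nhds hs.mass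
      (hmain.mono fun n hn => hn.2.1) (hmain.mono fun n hn => hn.2.2)

end EmdenSeq

lemma rpow_tangent_le {p y z : ℝ} (hp : 1 ≤ p) (hy : 0 ≤ y) (hz : 0 < z) :
    z ^ p + p * z ^ (p - 1) * (y - z) ≤ y ^ p := by
  have h := one_add_mul_self_le_rpow_one_add (s := y / z - 1) (by
    have : 0 ≤ y / z := by positivity
    linarith) hp
  rw [add_sub_cancel, Real.div_rpow hy hz.le, le_div_iff₀ (by positivity)] at h
  rw [Real.rpow_sub_one hz.ne']
  have e : (1 + p * (y / z - 1)) * z ^ p = z ^ p + p * (z ^ p / z) * (y - z) := by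
    have : z ^ p / z * z = z ^ p := div_mul_cancel₀ _ hz.ne'
    have h2 : z ^ p / z * y = z ^ p * (y / z) := by ring
    linear_combination (-p) * h2 - (-p) * this
  rwa [e] at h

lemma rpow_tangent_lt {p y z : ℝ} (hp : 1 < p) (hy : 0 ≤ y) (hz : 0 < z) (hyz : y ≠ z) :
    z ^ p + p * z ^ (p - 1) * (y - z) < y ^ p := by
  have h := one_add_mul_self_lt_rpow_one_add (s := y / z - 1) (by
    have : 0 ≤ y / z := by positivity
    linarith) (by rw [sub_ne_zero]; intro h; exact hyz ((div_eq_one_iff_eq hz.ne').1 h)) hp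
  rw [add_sub_cancel, Real.div_rpow hy hz.le, lt_div_iff₀ (by positivity)] at h
  rw [Real.rpow_sub_one hz.ne']
  have e : (1 + p * (y / z - 1)) * z ^ p = z ^ p + p * (z ^ p / z) * (y - z) := by
    have : z ^ p / z * z = z ^ p := div_mul_cancel₀ _ hz.ne'
    have h2 : z ^ p / z * y = z ^ p * (y / z) := by ring
    linear_combination (-p) * h2 - (-p) * this
  rwa [e] at h

namespace EmdenSeq

variable {p : ℝ} {μ : ℕ → ℝ} {v E q : ℕ → ℝ → ℝ}

lemma lt_of_v_lt (h : EmdenSeq p μ v E q) {n : ℕ} {s s' : ℝ} (hs : s < 0)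
    (hv : v n s' < v n s) : s < s' := by
  by_contra hcon
  exact absurd (h.antitoneOn_v n ((not_lt.1 hcon).trans_lt hs) hs (not_lt.1 hcon)) (not_le.2 hv)

set_option maxHeartbeats 1000000 in
/-- The slope `E` has jumped by at least the factor `K` once `v` has dropped below `x v(s)`. -/
lemma eventually_lt_E_after_bubble (h : EmdenSeq p μ v E q) {δ a x y K : ℝ} {s s' : ℕ → ℝ}
    (hs : BubbleExit p μ v E q δ a s) (hδ : 0 < δ) (ha : 0 < a) (hx1 : x < 1)
    (hx : 2 * p / (2 + a) * (1 - x) - 1 + x ^ p = 0) (hK : K * ((2 + a) * x ^ (p - 1)) = 2)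
    (hK1 : 1 < K) (hy : y ∈ Ioo 0 x) (hs' : ∀ n, s' n < 0)
    (hv : ∀ n, v n (s' n) = y * v n (s n)) :
    ∀ᶠ n in atTop, K * E n (s n) < E n (s' n) := by
  have hp := h.one_lt
  have hp0 : 0 < p := by linarith
  have hx0 : 0 < x := hy.1.trans hy.2
  have hy0 := hy.1
  have hK0 : 0 < K := by linarith
  set z := (x + y) / 2 with hz
  have hzx : z < x := by rw [hz]; linarith [hy.2]
  have hyz : y < z := by rw [hz]; linarith [hy.2]
  have hz0 : 0 < z := hy0.trans hyz
  set c := z ^ p - (x ^ p + p * x ^ (p - 1) * (z - x)) with hc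
  have hc0 : 0 < c := sub_pos.2 (rpow_tangent_lt hp hz0.le hx0 hzx.ne)
  obtain ⟨y₂, hy₂x, hy₂1, hy₂c⟩ : ∃ y₂, x < y₂ ∧ y₂ < 1 ∧ 2 * p / (2 + a) * (y₂ - x) ≤ c / 4 := by
    have hm : x < min 1 (x + c / 4 / (2 * p / (2 + a))) :=
      lt_min hx1 (lt_add_of_pos_right _ (by positivity))
    obtain ⟨y₂, h1, h2⟩ := exists_between hm
    refine ⟨y₂, h1, h2.trans_le (min_le_left _ _), ?_⟩
    have h3 : y₂ - x ≤ c / 4 / (2 * p / (2 + a)) := by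
      linarith [min_le_right 1 (x + c / 4 / (2 * p / (2 + a)))]
    rw [le_div_iff₀ (by positivity)] at h3
    linarith
  have hy₂0 : 0 < y₂ := hx0.trans hy₂x
  have hex : ∀ n, ∃ t, s n < t ∧ t < 0 ∧ v n t = y₂ * v n (s n) := fun n => by
    have hv0 := h.v_pos n _ (hs.neg n)
    exact h.exists_v_eq n (hs.neg n) (by positivity) (by nlinarith)
  choose s₂ hs₂ hs₂0 hvs₂ using hex
  have hex5 : ∀ n, ∃ t, s n < t ∧ t < 0 ∧ v n t = z * v n (s n) := fun n => by
    have hv0 := h.v_pos n _ (hs.neg n)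
    exact h.exists_v_eq n (hs.neg n) (by positivity) (by nlinarith)
  choose s₅ hs₅ hs₅0 hvs₅ using hex5
  have hE₂ := (h.tendsto_E_before_bubble hs hδ ha hx0 hx ⟨hy₂x, hy₂1⟩ (fun n => (hs₂ n).le)
    hs₂0 hvs₂).1
  set w : ℕ → ℝ := fun n => p * v n (s n) ^ (p - 1) * E n (s n) with hw
  have hwlim : Tendsto w atTop (𝓝 (2 + a)) := hs.slope
  have h2a : 2 + a ≠ 0 := by linarith
  have hT1 : Tendsto (fun n => 2 * p * (1 - y₂) / (w n * (E n (s₂ n) / E n (s n)))) atTop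
      (𝓝 (2 * p * (1 - y₂) / ((2 + a) * 1))) :=
    tendsto_const_nhds.div (hwlim.mul hE₂) (by simpa using h2a)
  have hT2 : Tendsto (fun n => 2 * p / (K * w n)) atTop (𝓝 (p * x ^ (p - 1))) := by
    have h1 : Tendsto (fun n => 2 * p / (K * w n)) atTop (𝓝 (2 * p / (K * (2 + a)))) :=
      tendsto_const_nhds.div (hwlim.const_mul K) (by positivity)
    convert h1 using 2
    rw [eq_div_iff (by positivity)]
    linear_combination p * hK
  have hvp := h.tendsto_height_rpow hδ hs.height
  have hT3 : ∀ᶠ n in atTop, (K * (3 + a)) ^ 2 < (z - y) * p * v n (s n) ^ p :=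
    (hvp.const_mul_atTop (mul_pos (sub_pos.2 hyz) hp0)).eventually_gt_atTop _
  filter_upwards [h.eventually_traj_Icc (c := y * (δ / 2)) (η := c / 8) (by positivity)
      (by positivity), hs.height.eventually_const_lt (half_lt_self hδ),
    hwlim.eventually_const_lt (show 0 < 2 + a by linarith),
    hwlim.eventually_lt_const (show 2 + a < 3 + a by linarith),
    hT1.eventually_const_lt (show 2 * p / (2 + a) * (1 - y₂) - c / 16 <
      2 * p * (1 - y₂) / ((2 + a) * 1) by
        have : 2 * p * (1 - y₂) / ((2 + a) * 1) = 2 * p / (2 + a) * (1 - y₂) := by ring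
        linarith),
    hT2.eventually_const_lt (show p * x ^ (p - 1) - c / 16 < _ by linarith), hT3,
    hE₂.eventually_const_lt one_half_lt_one,
    hs.log_mass.eventually_const_lt (show -(c / 2 * (δ / 2) ^ p) < 0 by
      have : 0 < c / 2 * (δ / 2) ^ p := by positivity
      linarith)]
    with n htraj hheight hw0 hw3 e1 e2 e3 hE2n hlog
  by_contra hcon
  rw [not_lt] at hcon
  have hμ := h.μ_pos n
  have hv0 : 0 < v n (s n) := h.v_pos n _ (hs.neg n)
  have hvμ : δ / 2 * μ n ≤ v n (s n) := by
    rw [lt_div_iff₀ hμ] at hheight; exact hheight.le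
  have hT : EmdenTraj p (c / 8) (v n) (E n) (q n) (Icc (s n) (s' n)) :=
    htraj (s n) (s' n) (hs' n) (by rw [hv n, mul_assoc]; gcongr)
  have hvp1 : 0 < v n (s n) ^ (p - 1) := by positivity
  have hvpe : v n (s n) ^ (p - 1) * v n (s n) = v n (s n) ^ p := by
    rw [← Real.rpow_add_one hv0.ne', sub_add_cancel]
  have hE0 : 0 < E n (s n) := by
    by_contra hcon
    have : w n ≤ 0 := mul_nonpos_of_nonneg_of_nonpos (by positivity) (not_lt.1 hcon)
    linarith
  have h25 : s₂ n < s₅ n := h.lt_of_v_lt (hs₂0 n) (by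
    rw [hvs₂, hvs₅]; exact mul_lt_mul_of_pos_right (hzx.trans hy₂x) hv0)
  have h53 : s₅ n < s' n := h.lt_of_v_lt (hs₅0 n) (by
    rw [hvs₅, hv]; exact mul_lt_mul_of_pos_right hyz hv0)
  have hE₂0 : 0 < E n (s₂ n) := by
    have : 0 < E n (s₂ n) / E n (s n) := by linarith
    exact (div_pos_iff_of_pos_right hE0).1 this
  have hEle : ∀ r ∈ Icc (s n) (s' n), E n r ≤ K * E n (s n) := fun r hr =>
    ((hT.mono (Icc_subset_Icc_left hr.1)).monotone_E hp0 hr.2).trans hcon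
  -- lower bound for the source on the last part of the interval
  have hq : ∀ r ∈ Icc (s₅ n) (s' n), 1 ≤ q n r := by
    intro r hr
    have hr2 : s₂ n ≤ r := h25.le.trans hr.1
    have hr0 : s n ≤ r := (hs₂ n).le.trans hr2
    have hrI : r ∈ Icc (s n) (s' n) := ⟨hr0, hr.2⟩
    have hvr0 := hT.v_pos r hrI
    have t1 := (hT.mono (Icc_subset_Icc_right hr.2)).le_log_q_sub hr0
    have t2 := (hT.mono (Icc_subset_Icc_right (h25.le.trans h53.le))).le_mul_sub_of_E_le
      (hs₂ n).le (e := E n (s₂ n)) (fun x hx =>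
        (hT.mono (Icc_subset_Icc hx.1 (h25.le.trans h53.le))).monotone_E hp0 hx.2)
    have t3 := (hT.mono (Icc_subset_Icc (hs₂ n).le hr.2)).le_mul_sub_of_E_le hr2
      (e := K * E n (s n)) (fun x hx => hEle x ⟨(hs₂ n).le.trans hx.1, hx.2.trans hr.2⟩)
    rw [hvs₂] at t2 t3
    set Y := v n r / v n (s n) with hY
    have hYe : v n r = Y * v n (s n) := by rw [hY]; field_simp
    have hYz : Y ≤ z := by
      rw [hY, div_le_iff₀ hv0, ← hvs₅]
      exact h.antitoneOn_v n (hs₅0 n) (hr.2.trans_lt (hs' n)) hr.1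
    have hY0 : 0 < Y := by positivity
    rw [hYe] at t1 t3
    rw [Real.mul_rpow hY0.le hv0.le] at t1
    have u1 : (v n (s n) ^ p) * (2 * p * (1 - y₂) / (w n * (E n (s₂ n) / E n (s n)))) ≤
        2 * (s₂ n - s n) := by
      have : (v n (s n) ^ p) * (2 * p * (1 - y₂) / (w n * (E n (s₂ n) / E n (s n)))) =
          2 * ((v n (s n) - y₂ * v n (s n)) / E n (s₂ n)) := by
        have : w n * (E n (s₂ n) / E n (s n)) = p * v n (s n) ^ (p - 1) * E n (s₂ n) :=
          by rw [mul_assoc, mul_div_cancel₀ _ hE0.ne']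
        rw [this, ← hvpe]
        generalize v n (s n) ^ (p - 1) = X at hvp1 ⊢
        field_simp
      rw [this]
      have : (v n (s n) - y₂ * v n (s n)) / E n (s₂ n) ≤ s₂ n - s n := by
        rw [div_le_iff₀ hE₂0]; linarith
      linarith
    have u2 : (v n (s n) ^ p) * (2 * p / (K * w n) * (y₂ - Y)) ≤ 2 * (r - s₂ n) := by
      have : (v n (s n) ^ p) * (2 * p / (K * w n) * (y₂ - Y)) =
          2 * ((y₂ * v n (s n) - Y * v n (s n)) / (K * E n (s n))) := by
        have : w n = p * v n (s n) ^ (p - 1) * E n (s n) := rfl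
        rw [this, ← hvpe]
        generalize v n (s n) ^ (p - 1) = X at hvp1 ⊢
        field_simp
      rw [this]
      have : (y₂ * v n (s n) - Y * v n (s n)) / (K * E n (s n)) ≤ r - s₂ n := by
        rw [div_le_iff₀ (by positivity)]; linarith
      linarith
    have u3 := rpow_tangent_le hp.le hY0.le hz0
    have u4 : z ^ (p - 1) ≤ x ^ (p - 1) :=
      Real.rpow_le_rpow hz0.le hzx.le (by linarith)
    have u5 : p * z ^ (p - 1) * (z - Y) ≤ p * x ^ (p - 1) * (z - Y) := by
      have : 0 ≤ z - Y := by linarith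
      gcongr
    have u6 : (p * x ^ (p - 1) - c / 16) * (y₂ - Y) ≤ 2 * p / (K * w n) * (y₂ - Y) :=
      mul_le_mul_of_nonneg_right e2.le (by linarith)
    have u7 : c / 16 * (y₂ - Y) ≤ c / 16 * 1 := by gcongr; linarith
    have u8 : 0 < p * x ^ (p - 1) * (y₂ - x) := by
      have : 0 < y₂ - x := by linarith
      positivity
    have hYp : 0 < Y ^ p := by positivity
    have u9 : c / 2 ≤ 2 * p * (1 - y₂) / (w n * (E n (s₂ n) / E n (s n))) +
        2 * p / (K * w n) * (y₂ - Y) - (1 + c / 8) * (1 - Y ^ p) := by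
      have : 0 ≤ c / 8 * Y ^ p := by positivity
      linarith
    have u10 := mul_le_mul_of_nonneg_left u9 (show 0 ≤ v n (s n) ^ p by positivity)
    have u11 : -(c / 2 * v n (s n) ^ p) ≤ Real.log (q n (s n)) := by
      have hμp : 0 < μ n ^ p := by positivity
      rw [lt_div_iff₀ hμp, neg_mul, mul_assoc, ← Real.mul_rpow (by positivity) hμ.le] at hlog
      have : (δ / 2 * μ n) ^ p ≤ v n (s n) ^ p := by gcongr
      nlinarith
    have u12 : 0 ≤ Real.log (q n r) := by linarith
    by_contra hlt
    exact absurd (Real.log_neg (hT.q_pos r hrI) (not_le.1 hlt)) (not_lt.2 u12)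
  have f1 : E n (s₅ n) + 1 / (p * v n (s n) ^ (p - 1)) * (s' n - s₅ n) ≤ E n (s' n) := by
    have hsub := hT.mono (Icc_subset_Icc_left (hs₅ n).le)
    have := le_of_hasDerivAt_nonneg h53.le (fun r hr => (hsub.hasDerivAt_E r hr).sub
      ((hasDerivAt_id r).const_mul (1 / (p * v n (s n) ^ (p - 1))))) (by
        intro r hr
        have hvr := hsub.v_pos r hr
        have hvr' : v n r ≤ v n (s n) := h.antitoneOn_v n (hs.neg n) (hr.2.trans_lt (hs' n))
          ((hs₅ n).le.trans hr.1)
        have hp1 : 0 ≤ p - 1 := by linarith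
        have : 1 / (p * v n (s n) ^ (p - 1)) ≤ q n r / (p * v n r ^ (p - 1)) := by
          gcongr
          · exact zero_le_one.trans (hq r hr)
          · exact hq r hr
        linarith)
    simp only [Pi.sub_apply, id] at this
    linarith
  have f2 := (hT.mono (Icc_subset_Icc_left (hs₅ n).le)).le_mul_sub_of_E_le h53.le
    (fun r hr => hEle r ⟨(hs₅ n).le.trans hr.1, hr.2⟩)
  rw [hvs₅, hv] at f2
  have f3 : 0 ≤ E n (s₅ n) := h.E_nonneg n _ (hs₅0 n)
  have f4 : 1 / (p * v n (s n) ^ (p - 1)) * (s' n - s₅ n) ≤ K * E n (s n) := by linarith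
  rw [one_div_mul_eq_div, div_le_iff₀ (by positivity)] at f4
  have f5 : z * v n (s n) - y * v n (s n) ≤
      K * E n (s n) * (K * E n (s n) * (p * v n (s n) ^ (p - 1))) :=
    f2.trans (by gcongr)
  have f6 : (z - y) * p * v n (s n) ^ p ≤ (K * w n) ^ 2 := by
    have := mul_le_mul_of_nonneg_left f5 (show 0 ≤ p * v n (s n) ^ (p - 1) by positivity)
    rw [← hvpe]
    simp only [hw]
    nlinarith
  have f7 : (K * w n) ^ 2 ≤ (K * (3 + a)) ^ 2 := by gcongr
  linarith

end EmdenSeq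

namespace EmdenSeq

variable {p : ℝ} {μ : ℕ → ℝ} {v E q : ℕ → ℝ → ℝ}

lemma lt_of_lt_E (h : EmdenSeq p μ v E q) {n : ℕ} {s s' : ℝ} (hs : s < 0) (hs' : s' < 0)
    (hE : E n s < E n s') : s < s' := by
  by_contra hcon
  exact absurd (h.monotoneOn_E n hs' hs (not_lt.1 hcon)) (not_le.2 hE)

lemma BubbleExit.eventually_E_pos (h : EmdenSeq p μ v E q) {δ a : ℝ} {s : ℕ → ℝ}
    (hs : BubbleExit p μ v E q δ a s) (ha : 0 < a) : ∀ᶠ n in atTop, 0 < E n (s n) := by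
  filter_upwards [hs.slope.eventually_const_lt (show 0 < 2 + a by linarith)] with n hn
  by_contra hcon
  have hv := h.v_pos n _ (hs.neg n)
  have hp : 0 ≤ p := by linarith [h.one_lt]
  have := mul_nonpos_of_nonneg_of_nonpos (show 0 ≤ p * v n (s n) ^ (p - 1) by positivity)
    (not_lt.1 hcon)
  linarith

/-- The time at which `E` has grown by the factor `K` since the exit of the last bubble. -/
lemma exists_E_eq (h : EmdenSeq p μ v E q) {δ a x K : ℝ} {s : ℕ → ℝ}
    (hs : BubbleExit p μ v E q δ a s) (hδ : 0 < δ) (ha : 0 < a) (hx0 : 0 < x) (hx1 : x < 1)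
    (hx : 2 * p / (2 + a) * (1 - x) - 1 + x ^ p = 0) (hK : K * ((2 + a) * x ^ (p - 1)) = 2)
    (hK1 : 1 < K) :
    ∃ t : ℕ → ℝ, ∀ᶠ n in atTop, s n < t n ∧ t n < 0 ∧ E n (t n) = K * E n (s n) := by
  refine Filter.Eventually.choice (r := fun n t => s n < t ∧ t < 0 ∧ E n t = K * E n (s n)) ?_
  have hex : ∀ n, ∃ t, s n < t ∧ t < 0 ∧ v n t = x / 2 * v n (s n) := fun n => by
    have hv0 := h.v_pos n _ (hs.neg n)
    exact h.exists_v_eq n (hs.neg n) (by positivity) (by nlinarith)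
  choose s₃ hs₃ hs₃0 hvs₃ using hex
  filter_upwards [h.eventually_lt_E_after_bubble hs hδ ha hx1 hx hK hK1
    ⟨half_pos hx0, half_lt_self hx0⟩ hs₃0 hvs₃, BubbleExit.eventually_E_pos h hs ha,
    h.eventually_traj_Icc (c := x / 2 * (δ / 2)) (by positivity) one_pos,
    hs.height.eventually_const_lt (half_lt_self hδ)] with n h1 h2 h3 h4
  have hμ := h.μ_pos n
  rw [lt_div_iff₀ hμ] at h4
  have hT := h3 (s n) (s₃ n) (hs₃0 n) (by rw [hvs₃ n, mul_assoc]; gcongr)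
  have hc : ContinuousOn (E n) (Icc (s n) (s₃ n)) := fun r hr =>
    (hT.hasDerivAt_E r hr).continuousAt.continuousWithinAt
  obtain ⟨t, ht, hte⟩ := intermediate_value_Ioo (hs₃ n).le hc
    (show K * E n (s n) ∈ Ioo _ _ from ⟨by nlinarith, h1⟩)
  exact ⟨t, ht.1, ht.2.trans (hs₃0 n), hte⟩

lemma tendsto_v_ratio (h : EmdenSeq p μ v E q) {δ a x K : ℝ} {s t : ℕ → ℝ}
    (hs : BubbleExit p μ v E q δ a s) (hδ : 0 < δ) (ha : 0 < a) (hx0 : 0 < x) (hx1 : x < 1)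
    (hx : 2 * p / (2 + a) * (1 - x) - 1 + x ^ p = 0) (hK : K * ((2 + a) * x ^ (p - 1)) = 2)
    (hK1 : 1 < K)
    (ht : ∀ᶠ n in atTop, s n < t n ∧ t n < 0 ∧ E n (t n) = K * E n (s n)) :
    Tendsto (fun n => v n (t n) / v n (s n)) atTop (𝓝 x) := by
  have hex : ∀ y, 0 < y → y < 1 → ∃ s₂ : ℕ → ℝ, ∀ n, s n < s₂ n ∧ s₂ n < 0 ∧
      v n (s₂ n) = y * v n (s n) := fun y hy0 hy1 => by
    have : ∀ n, ∃ t, s n < t ∧ t < 0 ∧ v n t = y * v n (s n) := fun n => by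
      have hv0 := h.v_pos n _ (hs.neg n)
      exact h.exists_v_eq n (hs.neg n) (by positivity) (by nlinarith)
    choose s₂ hs₂ using this
    exact ⟨s₂, hs₂⟩
  refine tendsto_order.2 ⟨fun y hy => ?_, fun y hy => ?_⟩
  · obtain ⟨y', hy', hy'x⟩ := exists_between (max_lt hx0 hy)
    have hy'0 := (le_max_left 0 y).trans_lt hy'
    obtain ⟨s₂, hs₂⟩ := hex y' hy'0 (hy'x.trans hx1)
    filter_upwards [h.eventually_lt_E_after_bubble hs hδ ha hx1 hx hK hK1 ⟨hy'0, hy'x⟩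
      (fun n => (hs₂ n).2.1) (fun n => (hs₂ n).2.2), ht] with n h1 h2
    rw [← h2.2.2] at h1
    have h3 := h.lt_of_lt_E h2.2.1 (hs₂ n).2.1 h1
    have h4 := h.antitoneOn_v n h2.2.1 (hs₂ n).2.1 h3.le
    rw [(hs₂ n).2.2] at h4
    have hv0 := h.v_pos n _ (hs.neg n)
    rw [lt_div_iff₀ hv0]
    have := (le_max_right 0 y).trans_lt hy'
    nlinarith
  · obtain ⟨y', hxy', hy'⟩ := exists_between (lt_min hx1 hy)
    have hy'1 := hy'.trans_le (min_le_left 1 y)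
    obtain ⟨s₂, hs₂⟩ := hex y' (hx0.trans hxy') hy'1
    have hE := (h.tendsto_E_before_bubble hs hδ ha hx0 hx ⟨hxy', hy'1⟩ (fun n => (hs₂ n).1.le)
      (fun n => (hs₂ n).2.1) (fun n => (hs₂ n).2.2)).1
    filter_upwards [hE.eventually_lt_const hK1, BubbleExit.eventually_E_pos h hs ha, ht]
      with n h1 h2 h3
    rw [div_lt_iff₀ h2, ← h3.2.2] at h1
    have h4 := h.lt_of_lt_E (hs₂ n).2.1 h3.2.1 h1
    have h5 := h.antitoneOn_v n (hs₂ n).2.1 h3.2.1 h4.le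
    rw [(hs₂ n).2.2] at h5
    have hv0 := h.v_pos n _ (hs.neg n)
    rw [div_lt_iff₀ hv0]
    have := hy'.trans_le (min_le_right 1 y)
    nlinarith

/-- The energy just before the next bubble. -/
lemma tendsto_energy_center (h : EmdenSeq p μ v E q) {δ a x K : ℝ} {s t : ℕ → ℝ}
    (hs : BubbleExit p μ v E q δ a s) (hδ : 0 < δ) (ha : 0 < a) (hx0 : 0 < x) (hx1 : x < 1)
    (hx : 2 * p / (2 + a) * (1 - x) - 1 + x ^ p = 0) (hK1 : 1 < K)
    (ht : ∀ᶠ n in atTop, s n < t n ∧ t n < 0 ∧ E n (t n) = K * E n (s n))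
    (hv : Tendsto (fun n => v n (t n) / v n (s n)) atTop (𝓝 x)) :
    Tendsto (fun n => q n (t n) - 2 * (p * v n (t n) ^ (p - 1) * E n (t n)) +
      (p * v n (t n) ^ (p - 1) * E n (t n)) ^ 2 / 2) atTop
      (𝓝 (-2 * (x ^ (p - 1) * (2 + a)) + (x ^ (p - 1) * (2 + a)) ^ 2 / 2)) := by
  have hp := h.one_lt
  have hp0 : 0 < p := by linarith
  have hp1 : 0 < p - 1 := by linarith
  set L : ℝ → ℝ := fun y => -2 * (y ^ (p - 1) * (2 + a)) + (y ^ (p - 1) * (2 + a)) ^ 2 / 2 with hL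
  set C := K * (3 + a) with hC
  have hC0 : 0 < C := by positivity
  set B := (p - 1) * C * (2 + 2 * C) with hB
  have hB0 : 0 < B := by positivity
  refine Metric.tendsto_nhds.2 fun ε hε => ?_
  obtain ⟨y, hyx, hy1, hyL, hyB⟩ : ∃ y, x < y ∧ y < 1 ∧ dist (L y) (L x) < ε / 4 ∧
      B * (Real.log y - Real.log x) < ε / 4 := by
    have e1 : ∀ᶠ y in 𝓝 x, dist (L y) (L x) < ε / 4 := by
      have hcont : ContinuousAt L x := by
        have : ContinuousAt (fun y : ℝ => y ^ (p - 1)) x :=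
          Real.continuousAt_rpow_const _ _ (Or.inl hx0.ne')
        simp only [hL]
        fun_prop
      exact Metric.tendsto_nhds.1 hcont.tendsto _ (by positivity)
    have e2 : ∀ᶠ y in 𝓝 x, B * (Real.log y - Real.log x) < ε / 4 := by
      have hcont : ContinuousAt (fun y => B * (Real.log y - Real.log x)) x := by
        have := Real.continuousAt_log hx0.ne'
        fun_prop
      exact hcont.tendsto.eventually_lt_const (by simp; positivity)
    have e3 : ∀ᶠ y in 𝓝[>] x, y < 1 :=
      eventually_nhdsWithin_of_eventually_nhds (eventually_lt_nhds hx1)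
    obtain ⟨y, ⟨⟨h1, h2⟩, h3⟩, h4⟩ := ((((e1.and e2).filter_mono nhdsWithin_le_nhds).and e3).and
      self_mem_nhdsWithin).exists
    exact ⟨y, h4, h3, h1, h2⟩
  have hy0 := hx0.trans hyx
  have hex : ∀ n, ∃ t, s n < t ∧ t < 0 ∧ v n t = y * v n (s n) := fun n => by
    have hv0 := h.v_pos n _ (hs.neg n)
    exact h.exists_v_eq n (hs.neg n) (by positivity) (by nlinarith)
  choose s₂ hs₂ hs₂0 hvs₂ using hex
  obtain ⟨hE, hq⟩ := h.tendsto_E_before_bubble hs hδ ha hx0 hx ⟨hyx, hy1⟩ (fun n => (hs₂ n).le)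
    hs₂0 hvs₂
  have hw₂ : Tendsto (fun n => p * v n (s₂ n) ^ (p - 1) * E n (s₂ n)) atTop
      (𝓝 (y ^ (p - 1) * (2 + a))) := by
    have h1 := (hs.slope.mul hE).const_mul (y ^ (p - 1))
    rw [mul_one] at h1
    refine h1.congr' ?_
    filter_upwards [BubbleExit.eventually_E_pos h hs ha] with n hn
    rw [hvs₂, Real.mul_rpow hy0.le (h.v_pos n _ (hs.neg n)).le]
    field_simp
  have hH₂ := (hq.sub (hw₂.const_mul 2)).add ((hw₂.pow 2).div_const 2)
  rw [zero_sub, ← neg_mul] at hH₂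
  have hη : 0 < min 1 (ε / 8 / C ^ 2) := by positivity
  filter_upwards [h.eventually_traj_Icc (c := x / 2 * (δ / 2)) (by positivity) hη, ht,
    hs.height.eventually_const_lt (half_lt_self hδ), hv.eventually_const_lt (half_lt_self hx0),
    hv.eventually_lt_const hyx, hs.slope.eventually_lt_const (show 2 + a < 3 + a by linarith),
    Metric.tendsto_nhds.1 hH₂ (ε / 4) (by positivity),
    ((((hv.log hx0.ne').const_sub (Real.log x)).const_mul B).eventually_lt_const
      (show B * (Real.log x - Real.log x) < ε / 8 by simp; positivity))]
    with n hT ht h1 h2 h3 h4 h5 h6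
  have hμ := h.μ_pos n
  have hv0 := h.v_pos n _ (hs.neg n)
  have hvt := h.v_pos n _ ht.2.1
  rw [lt_div_iff₀ hμ] at h1
  rw [lt_div_iff₀ hv0] at h2
  rw [div_lt_iff₀ hv0, ← hvs₂] at h3
  have hst : s₂ n < t n := h.lt_of_v_lt (hs₂0 n) h3
  have key := (hT (s₂ n) (t n) ht.2.1 (by
      refine le_trans ?_ h2.le
      rw [mul_assoc]; gcongr)).abs_energy_sub_le hp hη.le (min_le_left _ _) (C := C) hst.le (by
    intro r hr
    have hr0 : r < 0 := hr.2.trans_lt ht.2.1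
    have hE1 := h.monotoneOn_E n hr0 ht.2.1 hr.2
    rw [ht.2.2] at hE1
    have hv1 := h.antitoneOn_v n (hs.neg n) hr0 ((hs₂ n).le.trans hr.1)
    have hvr := h.v_pos n r hr0
    calc p * v n r ^ (p - 1) * E n r ≤ p * v n (s n) ^ (p - 1) * (K * E n (s n)) := by
          have := h.E_nonneg n r hr0
          gcongr
      _ = K * (p * v n (s n) ^ (p - 1) * E n (s n)) := by ring
      _ ≤ C := by rw [hC]; gcongr)
  have hη2 : min 1 (ε / 8 / C ^ 2) * C ^ 2 ≤ ε / 8 := by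
    rw [← le_div_iff₀ (by positivity)]; exact min_le_right _ _
  rw [hvs₂, Real.log_mul hy0.ne' hv0.ne'] at key
  rw [Real.log_div hvt.ne' hv0.ne'] at h6
  rw [Real.dist_eq] at h5 hyL ⊢
  have h7 : B * (Real.log y + Real.log (v n (s n)) - Real.log (v n (t n))) =
      B * (Real.log y - Real.log x) +
        B * (Real.log x - (Real.log (v n (t n)) - Real.log (v n (s n)))) := by ring
  rw [hvs₂] at h5
  rw [h7] at key
  rw [abs_lt] at *
  rw [abs_le] at key
  simp only [hL] at hyL
  constructor <;> linarith [key.1, key.2, h5.1, h5.2, hyL.1, hyL.2]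

/-- The next bubble: existence and location of its center. -/
lemma exists_bubbleCenter (h : EmdenSeq p μ v E q) {δ a x K : ℝ} {s : ℕ → ℝ}
    (hs : BubbleExit p μ v E q δ a s) (hδ : 0 < δ) (ha : 0 < a) (hx0 : 0 < x) (hx1 : x < 1)
    (hx : 2 * p / (2 + a) * (1 - x) - 1 + x ^ p = 0) (hK : K * ((2 + a) * x ^ (p - 1)) = 2)
    (hK1 : 1 < K) :
    ∃ t : ℕ → ℝ, BubbleCenter p μ v E q (x * δ) (2 - x ^ (p - 1) * (2 + a)) t ∧
      (∀ᶠ n in atTop, s n < t n) ∧ Tendsto (fun n => t n - s n) atTop atTop := by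
  have hp := h.one_lt
  have hp0 : 0 < p := by linarith
  obtain ⟨t, ht⟩ := h.exists_E_eq hs hδ ha hx0 hx1 hx hK hK1
  have hv := h.tendsto_v_ratio hs hδ ha hx0 hx1 hx hK hK1 ht
  have hH := h.tendsto_energy_center hs hδ ha hx0 hx1 hx hK1 ht hv
  have hslope : Tendsto (fun n => p * v n (t n) ^ (p - 1) * E n (t n)) atTop (𝓝 2) := by
    have h1 := ((hv.rpow_const (p := p - 1) (Or.inl hx0.ne')).mul hs.slope).const_mul K
    rw [show K * (x ^ (p - 1) * (2 + a)) = 2 by linarith] at h1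
    refine h1.congr' ?_
    filter_upwards [ht] with n hn
    have hv0 := h.v_pos n _ (hs.neg n)
    rw [Real.div_rpow (h.v_pos n _ hn.2.1).le hv0.le, hn.2.2]
    field_simp
  refine ⟨t, ⟨ht.mono fun n hn => hn.2.1, ?_, hslope, ?_⟩, ht.mono fun n hn => hn.1, ?_⟩
  · refine (hv.mul hs.height).congr fun n => ?_
    have hv0 := h.v_pos n _ (hs.neg n)
    field_simp
  · have h1 := (hH.add (hslope.const_mul 2)).sub ((hslope.pow 2).div_const 2)
    convert h1 using 2
    · ring
    · ring
  · have h1 : Tendsto (fun n => (1 - v n (t n) / v n (s n)) * p /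
        (K * (p * v n (s n) ^ (p - 1) * E n (s n)))) atTop
        (𝓝 ((1 - x) * p / (K * (2 + a)))) :=
      ((hv.const_sub 1).mul_const p).div (hs.slope.const_mul K) (by positivity)
    have h2 := h1.pos_mul_atTop (by
      have : 0 < 1 - x := by linarith
      positivity) (h.tendsto_height_rpow hδ hs.height)
    refine tendsto_atTop_mono' _ ?_ h2
    filter_upwards [ht, BubbleExit.eventually_E_pos h hs ha] with n hn hE
    have hv0 := h.v_pos n _ (hs.neg n)
    have h3 := le_of_hasDerivAt_nonneg hn.1.le (fun r hr => (h.hasDerivAt_v n r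
      (hr.2.trans_lt hn.2.1)).add ((hasDerivAt_id r).const_mul (K * E n (s n)))) (by
        intro r hr
        have := h.monotoneOn_E n (hr.2.trans_lt hn.2.1) hn.2.1 hr.2
        linarith [hn.2.2])
    simp only [Pi.add_apply, id] at h3
    have h4 : (1 - v n (t n) / v n (s n)) * p / (K * (p * v n (s n) ^ (p - 1) * E n (s n))) *
        v n (s n) ^ p = (v n (s n) - v n (t n)) / (K * E n (s n)) := by
      have hvpe : v n (s n) ^ p = v n (s n) ^ (p - 1) * v n (s n) := by
        rw [← Real.rpow_add_one hv0.ne', sub_add_cancel]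
      have : 0 < v n (s n) ^ (p - 1) := by positivity
      rw [hvpe]
      generalize v n (s n) ^ (p - 1) = X at this ⊢
      field_simp
    rw [h4, div_le_iff₀ (by positivity)]
    linarith

end EmdenSeq

lemma abs_le_exp_of_abs_deriv_le {D D' : ℝ → ℝ} {K ε b : ℝ} (hK : 1 ≤ K) (hε : 0 ≤ ε) (hb : 0 ≤ b)
    (hD : ∀ x ∈ Icc 0 b, HasDerivAt D (D' x) x) (h0 : |D 0| ≤ ε)
    (hD' : ∀ x ∈ Icc 0 b, |D' x| ≤ K * |D x| + ε) : |D b| ≤ 2 * ε * Real.exp (K * b) := by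
  have h := norm_le_gronwallBound_of_norm_deriv_right_le
    (fun x hx => (hD x hx).continuousAt.continuousWithinAt)
    (fun x hx => (hD x (Ico_subset_Icc_self hx)).hasDerivWithinAt) h0
    (fun x hx => hD' x (Ico_subset_Icc_self hx)) b (right_mem_Icc.2 hb)
  rw [gronwallBound_of_K_ne_0 (by linarith), sub_zero, Real.norm_eq_abs] at h
  have h1 : ε / K ≤ ε := div_le_self hε hK
  have h2 : 0 ≤ Real.exp (K * b) - 1 := by
    have := Real.add_one_le_exp (K * b)
    have : 0 ≤ K * b := by positivity
    linarith
  nlinarith [mul_le_mul_of_nonneg_right h1 h2]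

lemma abs_le_exp_of_abs_deriv_le_of_abs_le {D D' : ℝ → ℝ} {K ε M : ℝ} (hK : 1 ≤ K) (hε : 0 ≤ ε)
    (hD : ∀ x, |x| ≤ M → HasDerivAt D (D' x) x) (h0 : |D 0| ≤ ε)
    (hD' : ∀ x, |x| ≤ M → |D' x| ≤ K * |D x| + ε) {b : ℝ} (hb : |b| ≤ M) :
    |D b| ≤ 2 * ε * Real.exp (K * M) := by
  have key : ∀ {D D' : ℝ → ℝ} {b : ℝ}, 0 ≤ b → b ≤ M →
      (∀ x, |x| ≤ M → HasDerivAt D (D' x) x) → |D 0| ≤ ε →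
      (∀ x, |x| ≤ M → |D' x| ≤ K * |D x| + ε) → |D b| ≤ 2 * ε * Real.exp (K * M) := by
    intro D D' b hb hbM hD h0 hD'
    have hmem : ∀ x ∈ Icc 0 b, |x| ≤ M := fun x hx => by
      rw [abs_of_nonneg hx.1]; exact hx.2.trans hbM
    refine (abs_le_exp_of_abs_deriv_le hK hε hb (fun x hx => hD x (hmem x hx)) h0
      (fun x hx => hD' x (hmem x hx))).trans ?_
    gcongr
  rcases le_total 0 b with h | h
  · exact key h ((le_abs_self b).trans hb) hD h0 hD'
  · have := key (D := fun x => D (-x)) (D' := fun x => -D' (-x)) (b := -b) (by linarith)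
      ((neg_le_abs b).trans hb) (fun x hx => by
        have h1 := (hD (-x) (by rwa [abs_neg])).comp x (hasDerivAt_neg x)
        exact h1.congr_deriv (by ring)) (by simpa using h0)
        (fun x hx => by simpa using hD' (-x) (by rwa [abs_neg]))
    simpa using this

lemma exists_abs_rpow_sub_one_le (p : ℝ) {η : ℝ} (hη : 0 < η) :
    ∃ ε, 0 < ε ∧ ε ≤ 1 / 2 ∧ ∀ ρ : ℝ, |ρ - 1| ≤ ε → |ρ ^ p - 1| ≤ η ∧ |Real.log ρ| ≤ η := by
  have h1 : ContinuousAt (fun ρ : ℝ => ρ ^ p) 1 :=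
    Real.continuousAt_rpow_const _ _ (Or.inl one_ne_zero)
  have h2 := Real.continuousAt_log (one_ne_zero' ℝ)
  obtain ⟨e1, he1, h1⟩ := Metric.continuousAt_iff.1 h1 η hη
  obtain ⟨e2, he2, h2⟩ := Metric.continuousAt_iff.1 h2 η hη
  refine ⟨min (1 / 2) (min (e1 / 2) (e2 / 2)), by positivity, min_le_left _ _, fun ρ hρ => ?_⟩
  have h3 := (le_min_iff.1 hρ).2
  have h4 := h1 (x := ρ) (by rw [Real.dist_eq]; linarith [(le_min_iff.1 h3).1])
  have h5 := h2 (x := ρ) (by rw [Real.dist_eq]; linarith [(le_min_iff.1 h3).2])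
  rw [Real.dist_eq] at h4 h5
  simp only [Real.one_rpow, Real.log_one, sub_zero] at h4 h5
  exact ⟨h4.le, h5.le⟩

lemma abs_mul_inv_sub_le {q w g α C ε : ℝ} (hq0 : 0 < q) (hw0 : 0 ≤ w) (hwC : w ≤ C) (hC : 0 < C)
    (hg1 : |g - 1| ≤ 1 / 2) (hgA : |g - 1| * ((α ^ 2 + 4) + 2 * C + C ^ 2 * 2) ≤ ε / 2)
    (h1 : |q - (α ^ 2 - (g * w - 2) ^ 2) / 2| ≤ 1)
    (hε : |q - (α ^ 2 - (g * w - 2) ^ 2) / 2| ≤ ε / 8) :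
    |q * g⁻¹ - (α ^ 2 - (w - 2) ^ 2) / 2| ≤ ε := by
  have hg := abs_le.1 hg1
  have hg0 : 0 < g := by linarith
  have hq1 : q ≤ α ^ 2 / 2 + 1 := by nlinarith [sq_nonneg (g * w - 2), (abs_le.1 h1).2]
  have hginv2 : g⁻¹ ≤ 2 := by
    rw [inv_le_comm₀ hg0 two_pos]; linarith
  have hsplit : q * g⁻¹ - (α ^ 2 - (w - 2) ^ 2) / 2 =
      (q - (α ^ 2 - (g * w - 2) ^ 2) / 2) - (g - 1) * (q * g⁻¹) -
        (g - 1) * (w ^ 2 * (g + 1) / 2 - 2 * w) := by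
    have : g * g⁻¹ = 1 := mul_inv_cancel₀ hg0.ne'
    linear_combination q * this
  rw [hsplit]
  have b2 : |(g - 1) * (q * g⁻¹)| ≤ |g - 1| * (α ^ 2 + 4) := by
    rw [abs_mul, abs_of_nonneg (show 0 ≤ q * g⁻¹ by positivity)]
    gcongr
    nlinarith
  have b3 : |(g - 1) * (w ^ 2 * (g + 1) / 2 - 2 * w)| ≤ |g - 1| * (2 * C + C ^ 2 * 2) := by
    rw [abs_mul]
    gcongr
    have : w ^ 2 ≤ C ^ 2 := by gcongr
    have h7 : w ^ 2 * (g + 1) ≤ C ^ 2 * 4 := by gcongr; linarith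
    have h8 : 0 ≤ w ^ 2 * (g + 1) := by positivity
    rw [abs_le]
    constructor <;> linarith
  rw [abs_le] at hε b2 b3 ⊢
  constructor <;> linarith [hε.1, hε.2, b2.1, b2.2, b3.1, b3.2]

namespace BubbleCenter

variable {p : ℝ} {μ : ℕ → ℝ} {v E q : ℕ → ℝ → ℝ} {δ α : ℝ} {t : ℕ → ℝ}

/-- On bounded windows around the center `v` is constant to leading order and `E` is bounded on the
scale of `v(t)^{1-p}`. -/
lemma eventually_v_near (ht : BubbleCenter p μ v E q δ α t) (h : EmdenSeq p μ v E q) (hδ : 0 < δ)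
    {M ε : ℝ} (hM : 0 < M) (hε : 0 < ε) (hε1 : ε ≤ 1 / 2) :
    ∀ᶠ n in atTop, 1 ≤ v n (t n) ∧ δ / 2 * μ n ≤ v n (t n) ∧
      ∀ s, |s - t n| ≤ M → s < 0 ∧ |v n s / v n (t n) - 1| ≤ ε ∧
        p * v n (t n) ^ (p - 1) * E n s ≤
          3 + M * ((α ^ 2 / 2 + 1) * Real.exp (2 * M) * 2 ^ (p - 1)) := by
  have hp := h.one_lt
  have hp0 : 0 < p := by linarith
  set Q := (α ^ 2 / 2 + 1) * Real.exp (2 * M) with hQ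
  set C := 3 + M * (Q * 2 ^ (p - 1)) with hC
  have hQ0 : 0 < Q := by positivity
  have hC3 : 3 ≤ C := by
    have : 0 < M * (Q * 2 ^ (p - 1)) := by positivity
    linarith
  have hvp := h.tendsto_height_rpow hδ ht.height
  have hvtop : Tendsto (fun n => v n (t n)) atTop atTop :=
    (ht.height.pos_mul_atTop hδ h.tendsto_μ).congr fun n => div_mul_cancel₀ _ (h.μ_pos n).ne'
  filter_upwards [ht.neg, ht.height.eventually_const_lt (half_lt_self hδ),
    ht.slope.eventually_lt_const (show (2:ℝ) < 3 by norm_num),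
    ht.mass.eventually_lt_const (show α ^ 2 / 2 < α ^ 2 / 2 + 1 by linarith),
    hvp.eventually_gt_atTop (M * C / (p * ε)), hvtop.eventually_ge_atTop 1,
    h.eventually_traj_Icc (c := 1 / 2 * (δ / 2)) (by positivity) one_pos]
    with n ht0 h1 hw hq hvp hv1 hT
  have hμ := h.μ_pos n
  rw [lt_div_iff₀ hμ] at h1
  set V := v n (t n) with hV
  have hV0 : 0 < V := by linarith
  have hVp : 0 < V ^ (p - 1) := by positivity
  have hVpe : V ^ (p - 1) * V = V ^ p := by rw [← Real.rpow_add_one hV0.ne', sub_add_cancel]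
  rw [div_lt_iff₀ (by positivity)] at hvp
  -- the slope bound to the right of the center
  have hE : ∀ s, t n ≤ s → s ≤ t n + M → s < 0 → (1 - ε) * V ≤ v n s →
      p * V ^ (p - 1) * E n s ≤ C := by
    intro s hts hsM hs0 hvs
    have hTs := hT (t n) s hs0 (by rw [mul_assoc]; nlinarith)
    have hqr : ∀ r ∈ Icc (t n) s, q n r ≤ Q := fun r hr => by
      have hl := (hTs.mono (Icc_subset_Icc_right hr.2)).log_q_sub_le hr.1
      have hqt := hTs.q_pos _ (left_mem_Icc.2 hts)
      rw [sub_self, zero_mul, sub_zero] at hl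
      have hl2 : Real.log (q n r) ≤ Real.log (q n (t n) * Real.exp (2 * M)) := by
        rw [Real.log_mul hqt.ne' (Real.exp_pos _).ne', Real.log_exp]
        linarith [hr.2]
      exact ((Real.log_le_log_iff (hTs.q_pos r hr) (by positivity)).1 hl2).trans
        (mul_le_mul_of_nonneg_right hq.le (Real.exp_pos _).le)
    have h2 := le_of_hasDerivAt_nonpos hts (fun r hr => (hTs.hasDerivAt_E r hr).sub
      ((hasDerivAt_id r).const_mul (Q * 2 ^ (p - 1) / (p * V ^ (p - 1))))) (by
        intro r hr
        have hvr : V / 2 ≤ v n r := by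
          have := h.antitoneOn_v n (hr.2.trans_lt hs0) hs0 hr.2
          nlinarith
        have hvr2 : (V / 2) ^ (p - 1) ≤ v n r ^ (p - 1) := by gcongr
        have : q n r / (p * v n r ^ (p - 1)) ≤ Q / (p * (V / 2) ^ (p - 1)) := by
          gcongr
          exact hqr r hr
        rw [Real.div_rpow hV0.le zero_le_two] at this
        have h3 : Q / (p * (V ^ (p - 1) / 2 ^ (p - 1))) = Q * 2 ^ (p - 1) / (p * V ^ (p - 1)) := by
          have : (0:ℝ) < 2 ^ (p - 1) := by positivity
          field_simp
        linarith)
    simp only [Pi.sub_apply, id] at h2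
    have h3 : p * V ^ (p - 1) * E n s ≤ p * V ^ (p - 1) *
        (E n (t n) + Q * 2 ^ (p - 1) / (p * V ^ (p - 1)) * (s - t n)) := by
      gcongr; linarith
    have h4 : p * V ^ (p - 1) * (E n (t n) + Q * 2 ^ (p - 1) / (p * V ^ (p - 1)) * (s - t n)) =
        p * V ^ (p - 1) * E n (t n) + (s - t n) * (Q * 2 ^ (p - 1)) := by
      field_simp
    have h5 : (s - t n) * (Q * 2 ^ (p - 1)) ≤ M * (Q * 2 ^ (p - 1)) := by gcongr; linarith
    linarith
  have hbound : ∀ s e, p * V ^ (p - 1) * e ≤ C → 0 ≤ s → s ≤ M → e * s < ε * V := by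
    intro s e he hs hsM
    have h2 : p * V ^ (p - 1) * (e * s) < p * V ^ (p - 1) * (ε * V) :=
      calc p * V ^ (p - 1) * (e * s) = (p * V ^ (p - 1) * e) * s := by ring
        _ ≤ C * s := by gcongr
        _ ≤ C * M := by gcongr
        _ < V ^ p * (p * ε) := by linarith
        _ = _ := by rw [← hVpe]; ring
    exact lt_of_mul_lt_mul_left h2 (by positivity)
  obtain ⟨s₁, hs₁, hs₁0, hvs₁⟩ := h.exists_v_eq n ht0 (y := (1 - ε) * V)
    (mul_pos (by linarith) hV0) (by nlinarith)
  have hs₁M : t n + M < s₁ := by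
    by_contra hcon
    rw [not_lt] at hcon
    have h2 := hE s₁ hs₁.le hcon hs₁0 hvs₁.ge
    have h3 := (hT (t n) s₁ hs₁0 (by rw [mul_assoc, hvs₁]; nlinarith)).le_mul_sub_of_E_le hs₁.le
      (e := E n s₁) (fun x hx => h.monotoneOn_E n (hx.2.trans_lt hs₁0) hs₁0 hx.2)
    have h4 := hbound (s₁ - t n) _ h2 (by linarith) (by linarith)
    rw [hvs₁] at h3
    linarith
  refine ⟨hv1, h1.le, fun s hs => ?_⟩
  rw [abs_le] at hs
  have hs0 : s < 0 := by linarith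
  refine ⟨hs0, ?_⟩
  rcases le_total (t n) s with hts | hts
  · have h2 : (1 - ε) * V ≤ v n s := by
      rw [← hvs₁]
      exact h.antitoneOn_v n hs0 hs₁0 (by linarith)
    have h3 := h.antitoneOn_v n ht0 hs0 hts
    refine ⟨?_, hE s hts (by linarith) hs0 h2⟩
    rw [abs_le]
    constructor
    · rw [neg_le_sub_iff_le_add, ← sub_le_iff_le_add, le_div_iff₀ hV0]
      exact h2
    · have : v n s / V ≤ 1 := (div_le_one hV0).2 h3
      linarith
  · have h2 := h.antitoneOn_v n hs0 ht0 hts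
    have h3 : E n s ≤ E n (t n) := h.monotoneOn_E n hs0 ht0 hts
    have h4 := le_of_hasDerivAt_nonneg hts (fun r hr => (h.hasDerivAt_v n r
      (hr.2.trans_lt ht0)).add ((hasDerivAt_id r).const_mul (E n (t n)))) (by
        intro r hr
        have := h.monotoneOn_E n (hr.2.trans_lt ht0) ht0 hr.2
        linarith)
    simp only [Pi.add_apply, id] at h4
    have h5 := hbound (t n - s) (E n (t n)) (hw.le.trans hC3) (by linarith) (by linarith)
    refine ⟨?_, ?_⟩
    · rw [abs_le]
      constructor
      · have : 1 ≤ v n s / V := (one_le_div hV0).2 h2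
        linarith
      · rw [sub_le_iff_le_add, div_le_iff₀ hV0]
        linarith
    · calc p * V ^ (p - 1) * E n s ≤ p * V ^ (p - 1) * E n (t n) := by gcongr
        _ ≤ C := hw.le.trans hC3

set_option maxHeartbeats 1000000 in
lemma eventually_energy_near (ht : BubbleCenter p μ v E q δ α t) (h : EmdenSeq p μ v E q)
    (hδ : 0 < δ) {M ε : ℝ} (hM : 0 < M) (hε : 0 < ε) :
    ∀ᶠ n in atTop, ∀ s, |s - t n| ≤ M →
      |q n s * (v n (t n) / v n s) ^ (p - 1) -
        (α ^ 2 - (p * v n (t n) ^ (p - 1) * E n s - 2) ^ 2) / 2| ≤ ε := by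
  have hp := h.one_lt
  have hp0 : 0 < p := by linarith
  have hp1 : 0 < p - 1 := by linarith
  set C := 3 + M * ((α ^ 2 / 2 + 1) * Real.exp (2 * M) * 2 ^ (p - 1)) with hC
  have hC3 : 3 ≤ C := by
    have : 0 < M * ((α ^ 2 / 2 + 1) * Real.exp (2 * M) * 2 ^ (p - 1)) := by positivity
    linarith
  set B := (p - 1) * (2 * C) * (2 + 2 * (2 * C)) with hB
  have hB0 : 0 < B := by positivity
  set A := (α ^ 2 + 4) + 2 * C + C ^ 2 * 2 with hA
  have hA0 : 0 < A := by positivity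
  set ε₁ := min 1 (ε / 8) with hε₁
  have hε₁0 : 0 < ε₁ := by positivity
  obtain ⟨ε₂, hε₂0, hε₂, hρ⟩ := exists_abs_rpow_sub_one_le (p - 1)
    (η := min (1 / 2) (min (ε₁ / (4 * B)) (ε / (2 * A)))) (by positivity)
  have hη : 0 < min 1 (ε₁ / 4 / (2 * C) ^ 2) := by positivity
  have hH := (ht.mass.sub (ht.slope.const_mul 2)).add ((ht.slope.pow 2).div_const 2)
  filter_upwards [ht.eventually_v_near h hδ hM hε₂0 hε₂, h.eventually_traj_Icc
    (c := 1 / 2 * (δ / 2)) (by positivity) hη, ht.neg,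
    Metric.tendsto_nhds.1 hH (ε₁ / 4) (by positivity)] with n hn hT ht0 hHn s hs
  obtain ⟨hv1, hvμ, hn⟩ := hn
  have hμ := h.μ_pos n
  set V := v n (t n) with hV
  have hV0 : 0 < V := by linarith
  obtain ⟨hs0, hρs, hEs⟩ := hn s hs
  have hvs := h.v_pos n s hs0
  have hbd := hρ _ hρs
  set g := (v n s / V) ^ (p - 1) with hg
  have hg0 : 0 < g := by positivity
  have hg1 := hbd.1.trans (min_le_left _ _)
  have hg2 := hbd.1.trans ((min_le_right _ _).trans (min_le_right _ _))
  have hl := hbd.2.trans ((min_le_right _ _).trans (min_le_left _ _))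
  rw [Real.log_div hvs.ne' hV0.ne'] at hl
  have hgV : v n s ^ (p - 1) = g * V ^ (p - 1) := by
    rw [hg, ← Real.mul_rpow (by positivity) hV0.le, div_mul_cancel₀ _ hV0.ne']
  have hginv : (V / v n s) ^ (p - 1) = g⁻¹ := by
    rw [hg, ← Real.inv_rpow (by positivity), inv_div]
  have hvhalf : ∀ r, |r - t n| ≤ M → 1 / 2 * V ≤ v n r ∧ p * v n r ^ (p - 1) * E n r ≤ 2 * C := by
    intro r hr
    obtain ⟨hr0, hρr, hEr⟩ := hn r hr
    have hvr := h.v_pos n r hr0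
    have h2 := (abs_le.1 hρr).1
    have h3 : 1 / 2 ≤ v n r / V := by linarith
    rw [le_div_iff₀ hV0] at h3
    refine ⟨h3, ?_⟩
    have h4 := (hρ _ hρr).1.trans (min_le_left _ _)
    have h5 : (v n r / V) ^ (p - 1) ≤ 2 := by linarith [(abs_le.1 h4).2]
    have h6 : v n r ^ (p - 1) = (v n r / V) ^ (p - 1) * V ^ (p - 1) := by
      rw [← Real.mul_rpow (by positivity) hV0.le, div_mul_cancel₀ _ hV0.ne']
    have hEr0 := h.E_nonneg n r hr0
    calc p * v n r ^ (p - 1) * E n r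
        = (v n r / V) ^ (p - 1) * (p * V ^ (p - 1) * E n r) := by rw [h6]; ring
      _ ≤ 2 * (p * V ^ (p - 1) * E n r) := by gcongr
      _ ≤ 2 * C := by gcongr
  have htraj : ∀ r, |r - t n| ≤ M → ∀ r₀,
      EmdenTraj p (min 1 (ε₁ / 4 / (2 * C) ^ 2)) (v n) (E n) (q n) (Icc r₀ r) :=
    fun r hr r₀ => hT r₀ r (hn r hr).1 (by
      refine le_trans ?_ (hvhalf r hr).1
      rw [mul_assoc]; gcongr)
  have hηC : min 1 (ε₁ / 4 / (2 * C) ^ 2) * (2 * C) ^ 2 ≤ ε₁ / 4 := by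
    rw [← le_div_iff₀ (by positivity)]; exact min_le_right _ _
  have hBl : ∀ x, x ≤ ε₁ / (4 * B) → B * x ≤ ε₁ / 4 := fun x hx => by
    rw [le_div_iff₀ (by positivity)] at hx; linarith
  have henergy : |(q n s - 2 * (p * v n s ^ (p - 1) * E n s) +
      (p * v n s ^ (p - 1) * E n s) ^ 2 / 2) - (q n (t n) - 2 * (p * V ^ (p - 1) * E n (t n)) +
      (p * V ^ (p - 1) * E n (t n)) ^ 2 / 2)| ≤ ε₁ / 2 := by
    have hs' := abs_le.1 hs
    rcases le_total (t n) s with hts | hts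
    · refine ((htraj s hs (t n)).abs_energy_sub_le hp hη.le (min_le_left _ _)
        hts
        (C := 2 * C) (fun r hr =>
          (hvhalf r (abs_le.2 ⟨by linarith [hr.1], by linarith [hr.2]⟩)).2)).trans ?_
      have := hBl (Real.log V - Real.log (v n s)) (by linarith [(abs_le.1 hl).1])
      linarith
    · rw [abs_sub_comm]
      refine ((htraj (t n) (by simpa using hM.le) s).abs_energy_sub_le hp hη.le (min_le_left _ _)
        hts
        (C := 2 * C) (fun r hr =>
          (hvhalf r (abs_le.2 ⟨by linarith [hr.1], by linarith [hr.2]⟩)).2)).trans ?_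
      have := hBl (Real.log (v n s) - Real.log V) (by linarith [(abs_le.1 hl).2])
      linarith
  rw [Real.dist_eq] at hHn
  rw [hginv]
  rw [hgV] at henergy
  set w := p * V ^ (p - 1) * E n s with hw
  have hw0 : 0 ≤ w := mul_nonneg (by positivity) (h.E_nonneg n s hs0)
  have hq0 : 0 < q n s := (htraj s hs s).q_pos s ⟨le_rfl, le_rfl⟩
  rw [show p * (g * V ^ (p - 1)) * E n s = g * w by rw [hw]; ring] at henergy
  have hε₁1 : ε₁ ≤ 1 := min_le_left _ _
  have hε₁ε : ε₁ ≤ ε / 8 := min_le_right _ _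
  have hqF : |q n s - (α ^ 2 - (g * w - 2) ^ 2) / 2| ≤ ε₁ := by
    clear_value w g ε₁
    rw [abs_le] at henergy ⊢
    rw [abs_lt] at hHn
    constructor <;> linarith [henergy.1, henergy.2, hHn.1, hHn.2]
  rw [le_div_iff₀ (by positivity)] at hg2
  have hgA : |g - 1| * A ≤ ε / 2 := by linarith
  exact abs_mul_inv_sub_le hq0 hw0 (hEs.trans hC.ge) (by linarith) hg1 hgA (hqF.trans hε₁1)
    (hqF.trans hε₁ε)

/-- Convergence to the Liouville trajectory on bounded windows around the center. -/
lemma eventually_near (ht : BubbleCenter p μ v E q δ α t) (h : EmdenSeq p μ v E q) (hδ : 0 < δ)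
    (hα : 0 < α) (hα2 : α < 2) {M ε : ℝ} (hM : 0 < M) (hε : 0 < ε) :
    ∀ᶠ n in atTop, ∀ s, |s - t n| ≤ M → s < 0 ∧ |v n s / v n (t n) - 1| ≤ ε ∧
      |p * v n (t n) ^ (p - 1) * E n s - liouvilleSlope α (s - t n)| ≤ ε ∧
      |q n s * (v n (t n) / v n s) ^ (p - 1) - liouvilleMass α (s - t n)| ≤ ε := by
  have hp := h.one_lt
  have hp0 : 0 < p := by linarith
  set C := 3 + M * ((α ^ 2 / 2 + 1) * Real.exp (2 * M) * 2 ^ (p - 1)) with hC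
  have hC3 : 3 ≤ C := by
    have : 0 < M * ((α ^ 2 / 2 + 1) * Real.exp (2 * M) * 2 ^ (p - 1)) := by positivity
    linarith
  set K := C + 4 with hK
  set ε₀ := ε / (1 + 2 * (K + 1) * Real.exp (K * M)) with hε₀
  have hX := Real.exp_pos (K * M)
  have hε₀0 : 0 < ε₀ := by positivity
  have hε₀e : ε₀ * (1 + 2 * (K + 1) * Real.exp (K * M)) = ε := div_mul_cancel₀ _ (by positivity)
  have hεX : 0 < ε₀ * Real.exp (K * M) := by positivity
  filter_upwards [ht.eventually_v_near h hδ hM (show 0 < min ε (1 / 2) by positivity)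
    (min_le_right _ _), ht.eventually_energy_near h hδ hM hε₀0, ht.neg,
    Metric.tendsto_nhds.1 ht.slope ε₀ hε₀0, h.eventually_traj_Icc (c := 1 / 2 * (δ / 2))
      (by positivity) one_pos] with n hn hm ht0 hw hT s hs
  obtain ⟨hv1, hvμ, hn⟩ := hn
  have hμ := h.μ_pos n
  set V := v n (t n) with hV
  have hV0 : 0 < V := by linarith
  set y : ℝ → ℝ := fun r => p * V ^ (p - 1) * E n r with hy
  set m : ℝ → ℝ := fun r => q n r * (V / v n r) ^ (p - 1) with hm'
  have hyd : ∀ r, |r - t n| ≤ M → HasDerivAt y (m r) r := by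
    intro r hr
    obtain ⟨hr0, hρr, hEr⟩ := hn r hr
    have hvr := h.v_pos n r hr0
    have h2 := (abs_le.1 (hρr.trans (min_le_right _ _))).1
    have h3 : 1 / 2 ≤ v n r / V := by linarith
    rw [le_div_iff₀ hV0] at h3
    have hTr := hT r r hr0 (by
      refine le_trans ?_ h3
      rw [mul_assoc]; gcongr)
    refine ((hTr.hasDerivAt_E r ⟨le_rfl, le_rfl⟩).const_mul (p * V ^ (p - 1))).congr_deriv ?_
    simp only [hm']
    rw [Real.div_rpow hV0.le hvr.le]
    have : 0 < v n r ^ (p - 1) := by positivity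
    field_simp
  have hcomp : ∀ τ, |τ| ≤ M → |m (t n + τ) - liouvilleMass α τ| ≤
      K * |y (t n + τ) - liouvilleSlope α τ| + ε₀ := by
    intro τ hτ
    have hr : |t n + τ - t n| ≤ M := by rwa [add_sub_cancel_left]
    have h1 := hm (t n + τ) hr
    have h2 := (hn (t n + τ) hr).2.2
    have h3 : 0 ≤ y (t n + τ) :=
      mul_nonneg (by positivity) (h.E_nonneg n _ (hn (t n + τ) hr).1)
    have h4 := liouvilleSlope_mem hα.le τ
    have h5 : (α ^ 2 - (y (t n + τ) - 2) ^ 2) / 2 - liouvilleMass α τ =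
        -((y (t n + τ) + liouvilleSlope α τ - 4) / 2) *
          (y (t n + τ) - liouvilleSlope α τ) := by
      unfold liouvilleMass; ring
    have h6 : |(α ^ 2 - (y (t n + τ) - 2) ^ 2) / 2 - liouvilleMass α τ| ≤
        K * |y (t n + τ) - liouvilleSlope α τ| := by
      rw [h5, abs_mul]
      gcongr
      have h7 : y (t n + τ) ≤ C := h2
      rw [abs_le]
      constructor <;> linarith [h4.1, h4.2]
    have h8 := abs_add_le (m (t n + τ) - (α ^ 2 - (y (t n + τ) - 2) ^ 2) / 2)
      ((α ^ 2 - (y (t n + τ) - 2) ^ 2) / 2 - liouvilleMass α τ)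
    rw [sub_add_sub_cancel] at h8
    have h9 : |m (t n + τ) - (α ^ 2 - (y (t n + τ) - 2) ^ 2) / 2| ≤ ε₀ := h1
    linarith
  have hD := abs_le_exp_of_abs_deriv_le_of_abs_le (D := fun τ => y (t n + τ) - liouvilleSlope α τ)
    (D' := fun τ => m (t n + τ) - liouvilleMass α τ) (K := K) (ε := ε₀) (M := M) (by linarith)
    hε₀0.le (fun τ hτ => ((hyd (t n + τ) (by rwa [add_sub_cancel_left])).comp_const_add (t n) τ).sub
      (hasDerivAt_liouvilleSlope α τ)) (by
        simp only [add_zero, liouvilleSlope_zero]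
        rw [Real.dist_eq] at hw
        exact hw.le) hcomp (b := s - t n) hs
  have hms := hcomp (s - t n) hs
  simp only [add_sub_cancel] at hD hms
  have hKX := mul_le_mul_of_nonneg_left hD (show 0 ≤ K by linarith)
  refine ⟨(hn s hs).1, (hn s hs).2.1.trans (min_le_left _ _), ?_, ?_⟩
  · refine hD.trans ?_
    nlinarith
  · refine hms.trans ?_
    nlinarith

end BubbleCenter

lemma abs_sub_le_of_hasDerivAt {F F' : ℝ → ℝ} {C : ℝ} (hF : ∀ x, HasDerivAt F (F' x) x)
    (hC : ∀ x, |F' x| ≤ C) (x y : ℝ) : |F x - F y| ≤ C * |x - y| :=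
  Convex.norm_image_sub_le_of_norm_hasDerivWithin_le (fun x _ => (hF x).hasDerivWithinAt)
    (fun x _ => hC x) convex_univ (mem_univ y) (mem_univ x)

lemma abs_liouvilleSlope_sub_le {α : ℝ} (hα : 0 < α) (hα2 : α < 2) (x y : ℝ) :
    |liouvilleSlope α x - liouvilleSlope α y| ≤ 4 * |x - y| := by
  refine abs_sub_le_of_hasDerivAt (hasDerivAt_liouvilleSlope α) (fun x => ?_) x y
  rw [abs_of_pos (liouvilleMass_pos hα x)]
  nlinarith [liouvilleMass_le α x]

lemma abs_liouvilleMass_sub_le {α : ℝ} (hα : 0 < α) (hα2 : α < 2) (x y : ℝ) :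
    |liouvilleMass α x - liouvilleMass α y| ≤ 4 * |x - y| := by
  refine abs_sub_le_of_hasDerivAt (F' := fun x => -((liouvilleSlope α x - 2) * liouvilleMass α x))
    (fun x => ?_) (fun x => ?_) x y
  · have h := ((((hasDerivAt_liouvilleSlope α x).sub_const 2).pow 2).const_sub (α ^ 2)).div_const 2
    refine h.congr_deriv ?_
    simp only [Nat.cast_ofNat]
    ring
  · have h1 := liouvilleSlope_mem hα.le x
    have h2 : |liouvilleSlope α x - 2| ≤ 2 := abs_le.2 ⟨by linarith [h1.1], by linarith [h1.2]⟩
    have h3 := liouvilleMass_pos hα x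
    have h4 : liouvilleMass α x ≤ 2 := by nlinarith [liouvilleMass_le α x]
    rw [abs_neg, abs_mul, abs_of_pos h3]
    nlinarith [abs_nonneg (liouvilleSlope α x - 2)]

lemma exists_tendsto_atTop_of_eventually {P : ℕ → ℕ → Prop} (hP : ∀ M, ∀ᶠ n in atTop, P M n) :
    ∃ M : ℕ → ℕ, Tendsto M atTop atTop ∧ ∀ᶠ n in atTop, P (M n) n := by
  choose N hN using fun M => eventually_atTop.1 (hP M)
  refine ⟨fun n => Nat.findGreatest (fun M => N M ≤ n) n, tendsto_atTop.2 fun M => ?_, ?_⟩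
  · filter_upwards [eventually_ge_atTop (max M (N M))] with n hn
    exact Nat.le_findGreatest ((le_max_left _ _).trans hn) ((le_max_right _ _).trans hn)
  · filter_upwards [eventually_ge_atTop (N 0)] with n hn
    exact hN _ n (Nat.findGreatest_spec (P := fun M => N M ≤ n) (Nat.zero_le n) hn)

section BubbleExit

variable {p : ℝ} {μ : ℕ → ℝ} {v E q : ℕ → ℝ → ℝ}

/-- The exit of the first bubble, from its total energy. -/
lemma EmdenSeq.bubbleExit_first (h : EmdenSeq p μ v E q) {s : ℕ → ℝ} (hs : ∀ n, s n < 0)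
    (hv : Tendsto (fun n => v n (s n) / μ n) atTop (𝓝 1))
    (hE : Tendsto (fun n => p * μ n ^ (p - 1) * E n (s n)) atTop (𝓝 4))
    (hE0 : ∀ n, Tendsto (E n) atBot (𝓝 0)) (hq0 : ∀ n, Tendsto (q n) atBot (𝓝 0)) :
    BubbleExit p μ v E q 1 2 s := by
  have hp := h.one_lt
  have hp0 : 0 < p := by linarith
  have hp1 : 0 < p - 1 := by linarith
  have hslope : Tendsto (fun n => p * v n (s n) ^ (p - 1) * E n (s n)) atTop (𝓝 4) := by
    have h1 := (hv.rpow_const (p := p - 1) (Or.inl one_ne_zero)).mul hE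
    rw [Real.one_rpow, one_mul] at h1
    refine h1.congr fun n => ?_
    have := h.μ_pos n
    rw [Real.div_rpow (h.v_pos n _ (hs n)).le this.le]
    have : 0 < μ n ^ (p - 1) := by positivity
    field_simp
  set B := (p - 1) * 5 * (2 + 2 * 5) with hB
  have hB0 : 0 < B := by positivity
  have hlog : Tendsto (fun n => B * (Real.log (μ n) - Real.log (v n (s n)))) atTop (𝓝 0) := by
    have h1 := ((hv.log one_ne_zero).neg).const_mul B
    rw [Real.log_one, neg_zero, mul_zero] at h1
    refine h1.congr fun n => ?_
    rw [Real.log_div (h.v_pos n _ (hs n)).ne' (h.μ_pos n).ne', neg_sub]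
  -- smallness of the energy up to the exit
  have henergy : ∀ ε > 0, ∀ᶠ n in atTop, ∀ r ≤ s n,
      |q n r - 2 * (p * v n r ^ (p - 1) * E n r) + (p * v n r ^ (p - 1) * E n r) ^ 2 / 2| ≤ ε := by
    intro ε hε
    have hη : 0 < min 1 (ε / 2 / 5 ^ 2) := by positivity
    filter_upwards [h.eventually_traj_Icc (c := 1 / 2) (by norm_num) hη,
      hv.eventually_const_lt (show (1 / 2 : ℝ) < 1 by norm_num),
      hE.eventually_lt_const (show (4:ℝ) < 5 by norm_num),
      hlog.eventually_lt_const (half_pos hε)] with n hT h1 h2 h3 r hr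
    have hμ := h.μ_pos n
    rw [lt_div_iff₀ hμ] at h1
    have hr0 : r < 0 := hr.trans_lt (hs n)
    have hwle : ∀ x ≤ s n, p * v n x ^ (p - 1) * E n x ≤ p * μ n ^ (p - 1) * E n x := fun x hx => by
      have hx0 := hx.trans_lt (hs n)
      have := h.v_le n x hx0
      have := (h.v_pos n x hx0).le
      have := h.E_nonneg n x hx0
      gcongr
    have hw0 : ∀ x ≤ s n, 0 ≤ p * v n x ^ (p - 1) * E n x := fun x hx => by
      have hx0 := hx.trans_lt (hs n)
      have := (h.v_pos n x hx0).le
      have := h.E_nonneg n x hx0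
      positivity
    have key : ∀ x ≤ r, |(q n r - 2 * (p * v n r ^ (p - 1) * E n r) +
        (p * v n r ^ (p - 1) * E n r) ^ 2 / 2) - (q n x - 2 * (p * v n x ^ (p - 1) * E n x) +
        (p * v n x ^ (p - 1) * E n x) ^ 2 / 2)| ≤ ε := by
      intro x hx
      have hvr := h.antitoneOn_v n hr0 (hs n) hr
      refine ((hT x r hr0 (h1.le.trans hvr)).abs_energy_sub_le hp hη.le (min_le_left _ _) hx
        (C := 5) fun y hy => ?_).trans ?_
      · have hys := hy.2.trans hr
        refine (hwle y hys).trans (le_trans ?_ h2.le)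
        have := h.monotoneOn_E n (hys.trans_lt (hs n)) (hs n) hys
        gcongr
      · have hx0 := hx.trans_lt hr0
        have g1 : Real.log (v n x) ≤ Real.log (μ n) :=
          Real.log_le_log (h.v_pos n x hx0) (h.v_le n x hx0)
        have g2 : Real.log (v n (s n)) ≤ Real.log (v n r) :=
          Real.log_le_log (h.v_pos n _ (hs n)) hvr
        have g3 : min 1 (ε / 2 / 5 ^ 2) * 5 ^ 2 ≤ ε / 2 := by
          rw [← le_div_iff₀ (by positivity)]; exact min_le_right _ _
        have g4 : B * (Real.log (v n x) - Real.log (v n r)) ≤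
          B * (Real.log (μ n) - Real.log (v n (s n))) := by gcongr
        linarith
    have hwlim : Tendsto (fun x => p * v n x ^ (p - 1) * E n x) atBot (𝓝 0) := by
      have h4 := (hE0 n).const_mul (p * μ n ^ (p - 1))
      rw [mul_zero] at h4
      exact squeeze_zero' ((eventually_le_atBot (s n)).mono hw0)
        ((eventually_le_atBot (s n)).mono hwle) h4
    have hlim := (((((hq0 n).sub (hwlim.const_mul 2)).add ((hwlim.pow 2).div_const 2)).const_sub
      (q n r - 2 * (p * v n r ^ (p - 1) * E n r) + (p * v n r ^ (p - 1) * E n r) ^ 2 / 2)).abs)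
    have := le_of_tendsto hlim ((eventually_le_atBot r).mono key)
    simpa using this
  have hmass : Tendsto (fun n => q n (s n)) atTop (𝓝 0) := by
    have h1 : Tendsto (fun n => q n (s n) - 2 * (p * v n (s n) ^ (p - 1) * E n (s n)) +
        (p * v n (s n) ^ (p - 1) * E n (s n)) ^ 2 / 2) atTop (𝓝 0) := by
      refine Metric.tendsto_nhds.2 fun ε hε => ?_
      filter_upwards [henergy (ε / 2) (half_pos hε)] with n hn
      rw [dist_zero_right]
      exact (hn _ le_rfl).trans_lt (half_lt_self hε)
    have h2 := (h1.add (hslope.const_mul 2)).sub ((hslope.pow 2).div_const 2)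
    convert h2 using 2
    · ring
    · norm_num
  refine ⟨hs, hv, by norm_num; exact hslope, hmass, ?_⟩
  have hlow : Tendsto (fun n => -(2 * (1 - (v n (s n) / μ n) ^ p))) atTop (𝓝 0) := by
    have h1 := (((hv.rpow_const (p := p) (Or.inl one_ne_zero)).const_sub 1).const_mul 2).neg
    simpa using h1
  have hboth : ∀ᶠ n in atTop, -(2 * (1 - (v n (s n) / μ n) ^ p)) ≤
      Real.log (q n (s n)) / μ n ^ p ∧ Real.log (q n (s n)) / μ n ^ p ≤ 0 := by
    filter_upwards [h.eventually_traj_Icc (c := 1 / 2) (by norm_num) one_pos,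
      hv.eventually_const_lt (show (1 / 2 : ℝ) < 1 by norm_num), henergy 1 one_pos,
      hmass.eventually_lt_const one_pos, hslope.eventually_const_lt (show (2:ℝ) < 4 by norm_num)]
      with n hT h1 h2 h3 h4
    have hμ := h.μ_pos n
    rw [lt_div_iff₀ hμ] at h1
    have hTs := fun x => hT x (s n) (hs n) h1.le
    have hqs := (hTs (s n)).q_pos _ ⟨le_rfl, le_rfl⟩
    have hμp : 0 < μ n ^ p := by positivity
    refine ⟨?_, div_nonpos_of_nonpos_of_nonneg (Real.log_nonpos hqs.le h3.le) hμp.le⟩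
    obtain ⟨r, hr, hwr⟩ : ∃ r ≤ s n, p * v n r ^ (p - 1) * E n r = 2 := by
      have h5 := ((hE0 n).const_mul (p * μ n ^ (p - 1))).eventually_lt_const
        (show p * μ n ^ (p - 1) * 0 < 2 by simp)
      obtain ⟨x, hx, hxs⟩ := (h5.and (eventually_le_atBot (s n))).exists
      have hx0 := hxs.trans_lt (hs n)
      have hwx : p * v n x ^ (p - 1) * E n x ≤ 2 := by
        refine le_trans ?_ hx.le
        have := h.v_le n x hx0
        have := (h.v_pos n x hx0).le
        have := h.E_nonneg n x hx0
        gcongr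
      have hc : ContinuousOn (fun x => p * v n x ^ (p - 1) * E n x) (Icc x (s n)) := fun r hr =>
        ((hTs x).hasDerivAt_slope hp0 hr).continuousAt.continuousWithinAt
      obtain ⟨r, hr, hr2⟩ := intermediate_value_Icc hxs hc ⟨hwx, h4.le⟩
      exact ⟨r, hr.2, hr2⟩
    have h5 := h2 r hr
    rw [hwr] at h5
    have h6 : 1 ≤ q n r := by linarith [(abs_le.1 h5).1]
    have h7 := (hTs r).le_log_q_sub hr
    have h8 := Real.log_nonneg h6
    have hr0 := hr.trans_lt (hs n)
    have h9 : v n r ^ p ≤ μ n ^ p := by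
      have := h.v_le n r hr0
      have := (h.v_pos n r hr0).le
      gcongr
    rw [Real.div_rpow (h.v_pos n _ (hs n)).le hμ.le, le_div_iff₀ hμp]
    have h10 : -(2 * (1 - v n (s n) ^ p / μ n ^ p)) * μ n ^ p =
        -(2 * (μ n ^ p - v n (s n) ^ p)) := by
      field_simp
    linarith
  exact tendsto_of_tendsto_of_tendsto_of_le_of_le' hlow tendsto_const_nhds
    (hboth.mono fun n hn => hn.1) (hboth.mono fun n hn => hn.2)

end BubbleExit

/-- A bubble of height `δ` and exponent `α` centered at `t`, followed on windows of half-width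
`M → ∞` in the logarithmic variable. -/
structure BubbleWindow (p : ℝ) (μ : ℕ → ℝ) (v E q : ℕ → ℝ → ℝ) (δ α : ℝ) (t M : ℕ → ℝ) :
    Prop where
  pos : ∀ n, 0 < M n
  neg : ∀ n, t n + M n < 0
  q_pos : ∀ n, 0 < q n (t n)
  center : BubbleCenter p μ v E q δ α t
  tendsto_M : Tendsto M atTop atTop
  near : ∀ᶠ n in atTop, ∀ s, |s - t n| ≤ M n →
    |v n s / v n (t n) - 1| ≤ Real.exp (-(4 * M n)) ∧
    |p * v n (t n) ^ (p - 1) * E n s -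
      liouvilleSlope α (s - t n + bubbleTime α (Real.sqrt (q n (t n))))| ≤ Real.exp (-(4 * M n)) ∧
    |q n s * (v n (t n) / v n s) ^ (p - 1) -
      liouvilleMass α (s - t n + bubbleTime α (Real.sqrt (q n (t n))))| ≤ Real.exp (-(4 * M n))
  log_mass : Tendsto (fun n => Real.log (q n (t n + M n)) / μ n ^ p) atTop (𝓝 0)

section BubbleWindow

variable {p : ℝ} {μ : ℕ → ℝ} {v E q : ℕ → ℝ → ℝ} {δ α : ℝ} {t M : ℕ → ℝ}

lemma BubbleCenter.congr (ht : BubbleCenter p μ v E q δ α t) {t' : ℕ → ℝ} (htt' : t =ᶠ[atTop] t') :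
    BubbleCenter p μ v E q δ α t' where
  neg := by filter_upwards [ht.neg, htt'] with n h1 h2; rwa [← h2]
  height := ht.height.congr' (htt'.mono fun n h => by simp only [h])
  slope := ht.slope.congr' (htt'.mono fun n h => by simp only [h])
  mass := ht.mass.congr' (htt'.mono fun n h => by simp only [h])

lemma BubbleCenter.tendsto_shift (ht : BubbleCenter p μ v E q δ α t) (hα : 0 < α) :
    Tendsto (fun n => bubbleTime α (Real.sqrt (q n (t n)))) atTop (𝓝 0) := by
  have h1 : Tendsto (fun n => Real.sqrt 2 / α * Real.sqrt (q n (t n))) atTop (𝓝 1) := by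
    have := ht.mass.sqrt.const_mul (Real.sqrt 2 / α)
    rwa [Real.sqrt_div (by positivity), Real.sqrt_sq hα.le, div_mul_div_cancel₀ hα.ne',
      div_self (by positivity)] at this
  have := h1.log one_ne_zero
  rwa [Real.log_one] at this

lemma BubbleCenter.tendsto_log_mass (ht : BubbleCenter p μ v E q δ α t) (h : EmdenSeq p μ v E q)
    (hδ : 0 < δ) (hα : 0 < α) (hα2 : α < 2) {c : ℝ} (hc : 0 < c) :
    Tendsto (fun n => Real.log (q n (t n + c)) / μ n ^ p) atTop (𝓝 0) := by
  have hp := h.one_lt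
  have hmem : ∀ n, |t n + c - t n| ≤ c := fun n => by rw [add_sub_cancel_left, abs_of_pos hc]
  have hnear := fun ε hε => ht.eventually_near h hδ hα hα2 hc (ε := ε) hε
  have h1 : Tendsto (fun n => v n (t n + c) / v n (t n)) atTop (𝓝 1) := by
    refine Metric.tendsto_nhds.2 fun ε hε => ?_
    filter_upwards [hnear (ε / 2) (half_pos hε)] with n hn
    exact (hn _ (hmem n)).2.1.trans_lt (half_lt_self hε)
  have h2 : Tendsto (fun n => q n (t n + c) * (v n (t n) / v n (t n + c)) ^ (p - 1)) atTop
      (𝓝 (liouvilleMass α c)) := by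
    refine Metric.tendsto_nhds.2 fun ε hε => ?_
    filter_upwards [hnear (ε / 2) (half_pos hε)] with n hn
    have := (hn _ (hmem n)).2.2.2
    rw [add_sub_cancel_left] at this
    exact this.trans_lt (half_lt_self hε)
  have h3 := h2.mul (h1.rpow_const (p := p - 1) (Or.inl one_ne_zero))
  rw [Real.one_rpow, mul_one] at h3
  have h4 : Tendsto (fun n => q n (t n + c)) atTop (𝓝 (liouvilleMass α c)) := by
    refine h3.congr' ?_
    filter_upwards [hnear 1 one_pos, ht.neg] with n hn ht0
    have hv1 := h.v_pos n _ (hn _ (hmem n)).1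
    have hv2 := h.v_pos n _ ht0
    rw [mul_assoc, ← Real.mul_rpow (by positivity) (by positivity), div_mul_div_cancel₀ hv1.ne',
      div_self hv2.ne', Real.one_rpow, mul_one]
  exact (h4.log (liouvilleMass_pos hα c).ne').div_atTop
    ((tendsto_rpow_atTop (by linarith)).comp h.tendsto_μ)

lemma BubbleCenter.exists_bubbleWindow (ht : BubbleCenter p μ v E q δ α t) (h : EmdenSeq p μ v E q)
    (hδ : 0 < δ) (hα : 0 < α) (hα2 : α < 2) (hq : ∀ n, ∃ s < 0, 0 < q n s) {s : ℕ → ℝ}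
    (hts : Tendsto (fun n => t n - s n) atTop atTop) :
    ∃ t' M : ℕ → ℝ, BubbleWindow p μ v E q δ α t' M ∧
      Tendsto (fun n => t' n - M n - s n) atTop atTop := by
  choose t₀ ht₀ hqt₀ using hq
  have hmem : ∀ n (c : ℝ), 0 < c → |t n + c - t n| ≤ c := fun n c hc => by
    rw [add_sub_cancel_left, abs_of_pos hc]
  obtain ⟨m, hm, hmP⟩ := exists_tendsto_atTop_of_eventually (P := fun m n =>
      (t n + (m + 1 : ℝ) < 0 ∧ 0 < q n (t n) ∧ 2 * (m + 1 : ℝ) < t n - s n ∧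
        |Real.log (q n (t n + (m + 1 : ℝ))) / μ n ^ p| < 1 / ((m : ℝ) + 1)) ∧
      ∀ σ, |σ - t n| ≤ m + 1 →
    |v n σ / v n (t n) - 1| ≤ Real.exp (-(4 * (m + 1))) ∧
    |p * v n (t n) ^ (p - 1) * E n σ -
      liouvilleSlope α (σ - t n + bubbleTime α (Real.sqrt (q n (t n))))| ≤
        Real.exp (-(4 * (m + 1))) ∧
    |q n σ * (v n (t n) / v n σ) ^ (p - 1) -
      liouvilleMass α (σ - t n + bubbleTime α (Real.sqrt (q n (t n))))| ≤
        Real.exp (-(4 * (m + 1)))) (by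
    intro m
    have hm0 : (0:ℝ) < m + 1 := by positivity
    have hX : 0 < Real.exp (-(4 * (m + 1 : ℝ))) := Real.exp_pos _
    filter_upwards [ht.eventually_near h hδ hα hα2 hm0 (half_pos hX),
      ht.mass.eventually_const_lt (show 0 < α ^ 2 / 2 by positivity),
      hts.eventually_gt_atTop (2 * (m + 1 : ℝ)),
      Metric.tendsto_nhds.1 (ht.tendsto_log_mass h hδ hα hα2 hm0) (1 / ((m : ℝ) + 1))
        (by positivity),
      Metric.tendsto_nhds.1 (ht.tendsto_shift hα) (Real.exp (-(4 * (m + 1 : ℝ))) / 8)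
        (by positivity)] with n h1 h2 h3 h4 h5
    rw [dist_zero_right, Real.norm_eq_abs] at h4 h5
    refine ⟨⟨(h1 _ (hmem n _ hm0)).1, h2, h3, h4⟩, fun σ hσ => ?_⟩
    obtain ⟨-, g1, g2, g3⟩ := h1 σ hσ
    set θ := bubbleTime α (Real.sqrt (q n (t n))) with hθ
    have e1 := abs_liouvilleSlope_sub_le hα hα2 (σ - t n) (σ - t n + θ)
    have e2 := abs_liouvilleMass_sub_le hα hα2 (σ - t n) (σ - t n + θ)
    rw [sub_add_cancel_left, abs_neg] at e1 e2
    refine ⟨g1.trans (half_le_self hX.le), ?_, ?_⟩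
    · refine (abs_sub_le _ (liouvilleSlope α (σ - t n)) _).trans ?_
      linarith
    · refine (abs_sub_le _ (liouvilleMass α (σ - t n)) _).trans ?_
      linarith)
  classical
  set good : ℕ → Prop := fun n => t n + (m n + 1 : ℝ) < 0 ∧ 0 < q n (t n) with hgood
  have hgood_ev : ∀ᶠ n in atTop, good n := hmP.mono fun n hn => ⟨hn.1.1, hn.1.2.1⟩
  set t' : ℕ → ℝ := fun n => if good n then t n else t₀ n with ht'
  set M : ℕ → ℝ := fun n => if good n then (m n : ℝ) + 1 else -t₀ n / 2 with hM
  have ht't : ∀ n, good n → t' n = t n := fun n hn => if_pos hn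
  have hMm : ∀ n, good n → M n = m n + 1 := fun n hn => if_pos hn
  have hmtop : Tendsto (fun n => (m n : ℝ) + 1) atTop atTop :=
    tendsto_atTop_add_const_right _ _ (tendsto_natCast_atTop_atTop.comp hm)
  refine ⟨t', M, ⟨fun n => ?_, fun n => ?_, fun n => ?_, ?_, ?_, ?_, ?_⟩, ?_⟩
  · by_cases hn : good n
    · rw [hMm n hn]; positivity
    · simp only [hM, if_neg hn]; linarith [ht₀ n]
  · by_cases hn : good n
    · rw [hMm n hn, ht't n hn]; exact hn.1
    · simp only [hM, ht', if_neg hn]; linarith [ht₀ n]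
  · by_cases hn : good n
    · rw [ht't n hn]; exact hn.2
    · simp only [ht', if_neg hn]; exact hqt₀ n
  · exact ht.congr (hgood_ev.mono fun n hn => (ht't n hn).symm)
  · exact hmtop.congr' (hgood_ev.mono fun n hn => (hMm n hn).symm)
  · filter_upwards [hmP, hgood_ev] with n h1 h2
    rw [hMm n h2, ht't n h2]
    exact h1.2
  · have h1 : Tendsto (fun n => 1 / ((m n : ℝ) + 1)) atTop (𝓝 0) := hmtop.const_div_atTop 1
    refine squeeze_zero_norm' ?_ h1
    filter_upwards [hmP, hgood_ev] with n h1 h2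
    rw [hMm n h2, ht't n h2]
    exact h1.1.2.2.2.le
  · refine tendsto_atTop_mono' _ ?_ hmtop
    filter_upwards [hmP, hgood_ev] with n h1 h2
    rw [hMm n h2, ht't n h2]
    linarith [h1.1.2.2.1]

namespace BubbleWindow

lemma tendsto_exp_neg (hw : BubbleWindow p μ v E q δ α t M) :
    Tendsto (fun n => Real.exp (-(4 * M n))) atTop (𝓝 0) :=
  Real.tendsto_exp_neg_atTop_nhds_zero.comp (hw.tendsto_M.const_mul_atTop four_pos)

lemma tendsto_v_ratio (hw : BubbleWindow p μ v E q δ α t M) {s : ℕ → ℝ}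
    (hs : ∀ n, |s n - t n| ≤ M n) : Tendsto (fun n => v n (s n) / v n (t n)) atTop (𝓝 1) := by
  have h1 : Tendsto (fun n => v n (s n) / v n (t n) - 1) atTop (𝓝 0) :=
    squeeze_zero_norm' (hw.near.mono fun n hn => (hn _ (hs n)).1) hw.tendsto_exp_neg
  simpa using h1.add_const 1

lemma tendsto_height (hw : BubbleWindow p μ v E q δ α t M) (h : EmdenSeq p μ v E q) {s : ℕ → ℝ}
    (hs : ∀ n, |s n - t n| ≤ M n) : Tendsto (fun n => v n (s n) / μ n) atTop (𝓝 δ) := by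
  have h1 := (hw.tendsto_v_ratio hs).mul hw.center.height
  rw [one_mul] at h1
  refine h1.congr fun n => ?_
  have := h.v_pos n (t n) (by linarith [hw.neg n, hw.pos n])
  field_simp

lemma tendsto_slope (hw : BubbleWindow p μ v E q δ α t M) {s : ℕ → ℝ} {W : ℝ}
    (hs : ∀ n, |s n - t n| ≤ M n) (hW : Tendsto (fun n => liouvilleSlope α
      (s n - t n + bubbleTime α (Real.sqrt (q n (t n))))) atTop (𝓝 W)) :
    Tendsto (fun n => p * v n (t n) ^ (p - 1) * E n (s n)) atTop (𝓝 W) := by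
  have h1 : Tendsto (fun n => p * v n (t n) ^ (p - 1) * E n (s n) - liouvilleSlope α
      (s n - t n + bubbleTime α (Real.sqrt (q n (t n))))) atTop (𝓝 0) :=
    squeeze_zero_norm' (hw.near.mono fun n hn => (hn _ (hs n)).2.1) hw.tendsto_exp_neg
  simpa using h1.add hW

lemma tendsto_slope_right (hw : BubbleWindow p μ v E q δ α t M) (hα : 0 < α) :
    Tendsto (fun n => p * v n (t n) ^ (p - 1) * E n (t n + M n)) atTop (𝓝 (2 + α)) := by
  refine hw.tendsto_slope (fun n => by rw [add_sub_cancel_left, abs_of_pos (hw.pos n)]) ?_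
  refine (tendsto_liouvilleSlope_atTop hα).comp ?_
  simp only [add_sub_cancel_left]
  exact hw.tendsto_M.atTop_add (hw.center.tendsto_shift hα)

lemma tendsto_slope_left (hw : BubbleWindow p μ v E q δ α t M) (hα : 0 < α) :
    Tendsto (fun n => p * v n (t n) ^ (p - 1) * E n (t n - M n)) atTop (𝓝 (2 - α)) := by
  refine hw.tendsto_slope (fun n => by
    rw [sub_sub_cancel_left, abs_neg, abs_of_pos (hw.pos n)]) ?_
  refine (tendsto_liouvilleSlope_atBot hα).comp ?_
  simp only [sub_sub_cancel_left]
  exact (tendsto_neg_atTop_atBot.comp hw.tendsto_M).atBot_add (hw.center.tendsto_shift hα)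

/-- The end of the window is the exit of the bubble. -/
lemma bubbleExit (hw : BubbleWindow p μ v E q δ α t M) (h : EmdenSeq p μ v E q) (hα : 0 < α) :
    BubbleExit p μ v E q δ α (fun n => t n + M n) := by
  have hs : ∀ n, |t n + M n - t n| ≤ M n := fun n => by
    rw [add_sub_cancel_left, abs_of_pos (hw.pos n)]
  have hvt : ∀ n, 0 < v n (t n) := fun n => h.v_pos n _ (by linarith [hw.neg n, hw.pos n])
  have hvs : ∀ n, 0 < v n (t n + M n) := fun n => h.v_pos n _ (hw.neg n)
  have hr := (hw.tendsto_v_ratio hs).rpow_const (p := p - 1) (Or.inl one_ne_zero)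
  rw [Real.one_rpow] at hr
  refine ⟨hw.neg, hw.tendsto_height h hs, ?_, ?_, hw.log_mass⟩
  · have h1 := hr.mul (hw.tendsto_slope_right hα)
    rw [one_mul] at h1
    refine h1.congr fun n => ?_
    rw [Real.div_rpow (hvs n).le (hvt n).le]
    have := Real.rpow_pos_of_pos (hvt n) (p - 1)
    field_simp
  · have h1 : Tendsto (fun n => liouvilleMass α
        (t n + M n - t n + bubbleTime α (Real.sqrt (q n (t n))))) atTop (𝓝 0) := by
      refine (tendsto_liouvilleMass_atTop hα).comp ?_
      simp only [add_sub_cancel_left]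
      exact hw.tendsto_M.atTop_add (hw.center.tendsto_shift hα)
    have h2 : Tendsto (fun n => q n (t n + M n) * (v n (t n) / v n (t n + M n)) ^ (p - 1) -
        liouvilleMass α (t n + M n - t n + bubbleTime α (Real.sqrt (q n (t n))))) atTop (𝓝 0) :=
      squeeze_zero_norm' (hw.near.mono fun n hn => (hn _ (hs n)).2.2) hw.tendsto_exp_neg
    have h3 := (h2.add h1).mul hr
    rw [add_zero, zero_mul] at h3
    refine h3.congr fun n => ?_
    rw [sub_add_cancel, mul_assoc, ← Real.mul_rpow (div_nonneg (hvt n).le (hvs n).le)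
      (div_nonneg (hvs n).le (hvt n).le), div_mul_div_cancel₀ (hvs n).ne', div_self (hvt n).ne',
      Real.one_rpow, mul_one]

end BubbleWindow

/-- One step of the induction: after the exit of a bubble comes a window around the next one. -/
lemma BubbleExit.exists_bubbleWindow {a x : ℝ} {s : ℕ → ℝ} (hs : BubbleExit p μ v E q δ a s)
    (h : EmdenSeq p μ v E q) (hδ : 0 < δ) (ha : 0 < a) (hx0 : 0 < x) (hx1 : x < 1)
    (hx : 2 * p / (2 + a) * (1 - x) - 1 + x ^ p = 0) (hα : α = 2 - x ^ (p - 1) * (2 + a))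
    (hα0 : 0 < α) (hq : ∀ n, ∃ s < 0, 0 < q n s) :
    ∃ t M : ℕ → ℝ, BubbleWindow p μ v E q (x * δ) α t M ∧
      Tendsto (fun n => t n - M n - s n) atTop atTop := by
  have hxp : 0 < x ^ (p - 1) := by positivity
  have hprod : 0 < (2 + a) * x ^ (p - 1) := by positivity
  obtain ⟨t, ht, -, hts⟩ := h.exists_bubbleCenter hs hδ ha hx0 hx1 hx
    (K := 2 / ((2 + a) * x ^ (p - 1))) (div_mul_cancel₀ _ hprod.ne')
    ((one_lt_div hprod).2 (by linarith))
  rw [← hα] at ht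
  exact ht.exists_bubbleWindow h (by positivity) hα0 (by linarith) hq hts

end BubbleWindow

/-- `u` is a positive radial solution of `-Δ u = lam f(u)` in the unit disc with zero boundary
data. -/
structure IsRadialSolution (lam : ℝ) (f u : ℝ → ℝ) : Prop where
  lam_pos : 0 < lam
  f_cont : ContinuousOn f (Ici 0)
  f_nonneg : ∀ t, 0 ≤ t → 0 ≤ f t
  contDiffOn : ContDiffOn ℝ 2 u (Icc 0 1)
  pos : ∀ r ∈ Ico (0:ℝ) 1, 0 < u r
  eq_zero : u 1 = 0
  ode : ∀ r ∈ Ioo (0:ℝ) 1, -(deriv (deriv u) r) - deriv u r / r = lam * f (u r)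

namespace IsRadialSolution

variable {lam : ℝ} {f u : ℝ → ℝ}

lemma hasDerivAt (hu : IsRadialSolution lam f u) {r : ℝ} (hr : r ∈ Ioo (0:ℝ) 1) :
    HasDerivAt u (deriv u r) r :=
  ((hu.contDiffOn.contDiffAt (Icc_mem_nhds hr.1 hr.2)).differentiableAt two_ne_zero).hasDerivAt

lemma hasDerivAt_deriv (hu : IsRadialSolution lam f u) {r : ℝ} (hr : r ∈ Ioo (0:ℝ) 1) :
    HasDerivAt (deriv u) (-(lam * f (u r)) - deriv u r / r) r := by
  have h1 : ContDiffOn ℝ 1 (deriv u) (Ioo 0 1) :=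
    (hu.contDiffOn.mono Ioo_subset_Icc_self).deriv_of_isOpen isOpen_Ioo (by norm_num)
  have h2 := ((h1.contDiffAt (isOpen_Ioo.mem_nhds hr)).differentiableAt one_ne_zero).hasDerivAt
  refine h2.congr_deriv ?_
  linarith [hu.ode r hr]

lemma hasDerivAt_flux (hu : IsRadialSolution lam f u) {r : ℝ} (hr : r ∈ Ioo (0:ℝ) 1) :
    HasDerivAt (fun r => -r * deriv u r) (lam * f (u r) * r) r := by
  refine ((hasDerivAt_neg r).mul (hu.hasDerivAt_deriv hr)).congr_deriv ?_
  have := hr.1.ne'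
  field_simp
  ring

lemma tendsto_flux (hu : IsRadialSolution lam f u) :
    Tendsto (fun r => -r * deriv u r) (𝓝[>] 0) (𝓝 0) := by
  have h1 : ContinuousOn (derivWithin u (Icc 0 1)) (Icc 0 1) :=
    hu.contDiffOn.continuousOn_derivWithin (uniqueDiffOn_Icc one_pos) (by norm_num)
  have h2 : Tendsto (derivWithin u (Icc 0 1)) (𝓝[>] 0) (𝓝 (derivWithin u (Icc 0 1) 0)) :=
    (h1 0 (left_mem_Icc.2 zero_le_one)).mono_left
      (nhdsWithin_le_of_mem (Icc_mem_nhdsGT one_pos))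
  have h3 : Tendsto (fun r : ℝ => -r) (𝓝[>] 0) (𝓝 0) := by
    have := (continuous_neg.tendsto (0:ℝ)).mono_left (nhdsWithin_le_nhds (s := Ioi 0))
    rwa [neg_zero] at this
  have h4 := h3.mul h2
  rw [zero_mul] at h4
  refine h4.congr' ?_
  filter_upwards [Ioo_mem_nhdsGT (one_pos : (0:ℝ) < 1)] with r hr
  rw [derivWithin_of_mem_nhds (Icc_mem_nhds hr.1 hr.2)]

lemma continuousOn (hu : IsRadialSolution lam f u) : ContinuousOn u (Icc 0 1) :=
  hu.contDiffOn.continuousOn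

lemma nonneg (hu : IsRadialSolution lam f u) {r : ℝ} (hr : r ∈ Icc (0:ℝ) 1) : 0 ≤ u r := by
  rcases hr.2.eq_or_lt with rfl | h
  · exact hu.eq_zero.ge
  · exact (hu.pos r ⟨hr.1, h⟩).le

lemma continuousOn_comp (hu : IsRadialSolution lam f u) :
    ContinuousOn (fun r => f (u r)) (Icc 0 1) :=
  hu.f_cont.comp hu.continuousOn fun _ hr => hu.nonneg hr

lemma integral_eq (hu : IsRadialSolution lam f u) {r₁ r₂ : ℝ} (h1 : 0 < r₁) (h12 : r₁ ≤ r₂)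
    (h2 : r₂ < 1) :
    ∫ x in r₁..r₂, lam * f (u x) * x = -r₂ * deriv u r₂ - -r₁ * deriv u r₁ := by
  have hsub : uIcc r₁ r₂ ⊆ Icc 0 1 := by
    rw [uIcc_of_le h12]; exact Icc_subset_Icc h1.le h2.le
  refine intervalIntegral.integral_eq_sub_of_hasDerivAt (f := fun r => -r * deriv u r) (fun x hx =>
    hu.hasDerivAt_flux ?_) (ContinuousOn.intervalIntegrable ?_)
  · rw [uIcc_of_le h12] at hx
    exact ⟨h1.trans_le hx.1, hx.2.trans_lt h2⟩
  · exact ((hu.continuousOn_comp.mono hsub).const_mul _).mul continuousOn_id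

lemma integral_zero_eq (hu : IsRadialSolution lam f u) {r : ℝ} (hr : r ∈ Ioo (0:ℝ) 1) :
    ∫ x in (0:ℝ)..r, lam * f (u x) * x = -r * deriv u r := by
  have hsub : uIcc 0 r ⊆ Icc 0 1 := by
    rw [uIcc_of_le hr.1.le]; exact Icc_subset_Icc le_rfl hr.2.le
  have := intervalIntegral.integral_eq_sub_of_hasDerivAt_of_tendsto (f := fun r => -r * deriv u r)
    hr.1 (fun x hx => hu.hasDerivAt_flux ⟨hx.1, hx.2.trans hr.2⟩)
    (ContinuousOn.intervalIntegrable
      (((hu.continuousOn_comp.mono hsub).const_mul lam).mul continuousOn_id)) hu.tendsto_flux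
    ((hu.hasDerivAt_flux hr).continuousAt.tendsto.mono_left nhdsWithin_le_nhds)
  rwa [sub_zero] at this

lemma exp_mem {s : ℝ} (hs : s < 0) : Real.exp s ∈ Ioo (0:ℝ) 1 :=
  ⟨Real.exp_pos s, Real.exp_lt_one_iff.mpr hs⟩

lemma hasDerivAt_comp_exp (hu : IsRadialSolution lam f u) {s : ℝ} (hs : s < 0) :
    HasDerivAt (fun s => u (Real.exp s)) (-(-Real.exp s * deriv u (Real.exp s))) s := by
  refine ((hu.hasDerivAt (exp_mem hs)).comp s (Real.hasDerivAt_exp s)).congr_deriv ?_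
  ring

lemma hasDerivAt_flux_exp (hu : IsRadialSolution lam f u) {s : ℝ} (hs : s < 0) :
    HasDerivAt (fun s => -Real.exp s * deriv u (Real.exp s))
      (lam * f (u (Real.exp s)) * Real.exp s ^ 2) s := by
  refine ((hu.hasDerivAt_flux (exp_mem hs)).comp s (Real.hasDerivAt_exp s)).congr_deriv ?_
  ring

lemma monotoneOn_flux_exp (hu : IsRadialSolution lam f u) :
    MonotoneOn (fun s => -Real.exp s * deriv u (Real.exp s)) (Iio 0) := by
  intro a _ b hb hab
  refine le_of_hasDerivAt_nonneg hab (fun s hs => hu.hasDerivAt_flux_exp (hs.2.trans_lt hb))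
    fun s hs => ?_
  have := hu.f_nonneg _ (hu.nonneg (Ioo_subset_Icc_self (exp_mem (hs.2.trans_lt hb))))
  have := hu.lam_pos
  positivity

lemma tendsto_flux_exp (hu : IsRadialSolution lam f u) :
    Tendsto (fun s => -Real.exp s * deriv u (Real.exp s)) atBot (𝓝 0) :=
  hu.tendsto_flux.comp Real.tendsto_exp_atBot_nhdsGT

lemma flux_exp_nonneg (hu : IsRadialSolution lam f u) {s : ℝ} (hs : s < 0) :
    0 ≤ -Real.exp s * deriv u (Real.exp s) := by
  refine le_of_tendsto hu.tendsto_flux_exp ?_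
  filter_upwards [eventually_le_atBot s] with x hx
  exact hu.monotoneOn_flux_exp (hx.trans_lt hs) hs hx

lemma antitoneOn_comp_exp (hu : IsRadialSolution lam f u) :
    AntitoneOn (fun s => u (Real.exp s)) (Iio 0) := by
  intro a _ b hb hab
  exact le_of_hasDerivAt_nonpos (F := fun s => u (Real.exp s)) hab
    (fun y hy => hu.hasDerivAt_comp_exp (hy.2.trans_lt hb))
    fun y hy => neg_nonpos.2 (hu.flux_exp_nonneg (hy.2.trans_lt hb))

lemma tendsto_comp_exp_atBot (hu : IsRadialSolution lam f u) :
    Tendsto (fun s => u (Real.exp s)) atBot (𝓝 (u 0)) := by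
  have h : Tendsto u (𝓝[>] 0) (𝓝 (u 0)) :=
    (hu.continuousOn 0 (left_mem_Icc.2 zero_le_one)).mono_left
      (nhdsWithin_le_of_mem (Icc_mem_nhdsGT one_pos))
  exact h.comp Real.tendsto_exp_atBot_nhdsGT

lemma comp_exp_le (hu : IsRadialSolution lam f u) {s : ℝ} (hs : s < 0) : u (Real.exp s) ≤ u 0 := by
  refine ge_of_tendsto hu.tendsto_comp_exp_atBot ?_
  filter_upwards [eventually_le_atBot s] with x hx
  exact hu.antitoneOn_comp_exp (hx.trans_lt hs) hs hx

lemma tendsto_comp_exp (hu : IsRadialSolution lam f u) :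
    Tendsto (fun s => u (Real.exp s)) (𝓝[<] 0) (𝓝 0) := by
  have h1 : Tendsto u (𝓝[Icc 0 1] 1) (𝓝 0) := by
    have := hu.continuousOn 1 (right_mem_Icc.2 zero_le_one)
    rwa [ContinuousWithinAt, hu.eq_zero] at this
  refine h1.comp (tendsto_nhdsWithin_iff.2 ⟨?_, ?_⟩)
  · have := (Real.continuous_exp.tendsto 0).mono_left (nhdsWithin_le_nhds (s := Iio 0))
    rwa [Real.exp_zero] at this
  · filter_upwards [self_mem_nhdsWithin] with s hs
    exact Ioo_subset_Icc_self (exp_mem hs)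

lemma antitoneOn (hu : IsRadialSolution lam f u) : AntitoneOn u (Ioo 0 1) := by
  intro a ha b hb hab
  have h := hu.antitoneOn_comp_exp (Real.log_neg ha.1 ha.2) (Real.log_neg hb.1 hb.2)
    (Real.log_le_log ha.1 hab)
  simpa only [Real.exp_log ha.1, Real.exp_log hb.1] using h

end IsRadialSolution

/-- The height of `u n` in the variable `s = log r`. -/
noncomputable def emdenHeight (u : ℕ → ℝ → ℝ) (n : ℕ) (s : ℝ) : ℝ := u n (Real.exp s)

/-- The flux `-r u'` of `u n` in the variable `s = log r`. -/
noncomputable def emdenFlux (u : ℕ → ℝ → ℝ) (n : ℕ) (s : ℝ) : ℝ :=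
  -Real.exp s * deriv (u n) (Real.exp s)

/-- The rescaled mass density `p λ r² u^{p-1} f(u)` of `u n` in the variable `s = log r`. -/
noncomputable def emdenMass (p : ℝ) (lam : ℕ → ℝ) (f : ℝ → ℝ) (u : ℕ → ℝ → ℝ) (n : ℕ)
    (s : ℝ) : ℝ :=
  p * lam n * Real.exp s ^ 2 * u n (Real.exp s) ^ (p - 1) * f (u n (Real.exp s))

section EmdenVariables

variable {p t₀ : ℝ} {h f : ℝ → ℝ}

lemma hasDerivAt_mul_exp_rpow (hh : ContDiffOn ℝ 1 h (Ici 0))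
    (hf : ∀ t, f t = h t * Real.exp (t ^ p)) {t : ℝ} (ht : 0 < t) (hht : 0 < h t) :
    HasDerivAt f (f t * (deriv h t / h t + p * t ^ (p - 1))) t := by
  have h1 : HasDerivAt h (deriv h t) t :=
    ((hh.contDiffAt (Ici_mem_nhds ht)).differentiableAt one_ne_zero).hasDerivAt
  have h2 := h1.mul ((Real.hasDerivAt_rpow_const (p := p) (Or.inl ht.ne')).exp)
  rw [show f = h * fun t => Real.exp (t ^ p) from funext hf]
  refine h2.congr_deriv ?_
  simp only [Pi.mul_apply]
  field_simp

lemma eventually_abs_le_mul_rpow (hp : 1 < p)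
    (H1 : Tendsto (fun t => deriv h t / (t ^ (p - 1) * h t)) atTop (𝓝 0)) {η : ℝ} (hη : 0 < η) :
    ∀ᶠ t in atTop, |(p - 1) / t + deriv h t / h t| ≤ η * (p * t ^ (p - 1)) := by
  have h1 : Tendsto (fun t : ℝ => (p - 1) / t ^ p) atTop (𝓝 0) :=
    (tendsto_rpow_atTop (by linarith)).const_div_atTop _
  have h2 := (h1.add H1).abs
  rw [add_zero, abs_zero] at h2
  filter_upwards [h2.eventually_le_const (show 0 < η * p by nlinarith), eventually_gt_atTop 0]
    with t ht ht0
  have hpos : 0 < t ^ (p - 1) := by positivity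
  have : (p - 1) / t + deriv h t / h t =
      ((p - 1) / t ^ p + deriv h t / (t ^ (p - 1) * h t)) * t ^ (p - 1) := by
    rw [← div_div, Real.rpow_sub_one ht0.ne']
    field_simp
  rw [this, abs_mul, abs_of_pos hpos, ← mul_assoc]
  gcongr

lemma IsRadialSolution.hasDerivAt_mass {lam : ℝ} {u : ℝ → ℝ} (hu : IsRadialSolution lam f u)
    (hh : ContDiffOn ℝ 1 h (Ici 0)) (hf : ∀ t, f t = h t * Real.exp (t ^ p)) {s : ℝ} (hs : s < 0)
    (hhs : 0 < h (u (Real.exp s))) :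
    HasDerivAt (fun s => p * lam * Real.exp s ^ 2 * u (Real.exp s) ^ (p - 1) * f (u (Real.exp s)))
      (p * lam * Real.exp s ^ 2 * u (Real.exp s) ^ (p - 1) * f (u (Real.exp s)) *
        (2 - (p * u (Real.exp s) ^ (p - 1) + ((p - 1) / u (Real.exp s) +
          deriv h (u (Real.exp s)) / h (u (Real.exp s)))) *
            (-Real.exp s * deriv u (Real.exp s)))) s := by
  have hr := IsRadialSolution.exp_mem hs
  have hv : 0 < u (Real.exp s) := hu.pos _ (Ioo_subset_Ico_self hr)
  have h1 := hu.hasDerivAt_comp_exp hs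
  have h2 := (hasDerivAt_mul_exp_rpow hh hf hv hhs).comp s h1
  refine ((((((Real.hasDerivAt_exp s).pow 2).const_mul (p * lam)).mul
    (h1.rpow_const (p := p - 1) (Or.inl hv.ne'))).mul h2)).congr_deriv ?_
  simp only [Function.comp_def, Pi.mul_apply, Pi.pow_apply]
  rw [Real.rpow_sub_one hv.ne' (p - 1)]
  field_simp
  ring

lemma emdenSeq_of_isRadialSolution (hp : 1 < p) (hh : ContDiffOn ℝ 1 h (Ici 0))
    (hpos : ∀ t, t₀ ≤ t → 0 < h t) (hf : ∀ t, f t = h t * Real.exp (t ^ p))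
    (H1 : Tendsto (fun t => deriv h t / (t ^ (p - 1) * h t)) atTop (𝓝 0))
    {lam μ : ℕ → ℝ} {u : ℕ → ℝ → ℝ} (hu : ∀ n, IsRadialSolution (lam n) f (u n))
    (hu0 : ∀ n, u n 0 = μ n) (hμ : ∀ n, 0 < μ n) (hμ' : Tendsto μ atTop atTop) :
    EmdenSeq p μ (emdenHeight u) (emdenFlux u) (emdenMass p lam f u) where
  one_lt := hp
  μ_pos := hμ
  tendsto_μ := hμ'
  hasDerivAt_v n s hs := (hu n).hasDerivAt_comp_exp hs
  v_pos n s hs := (hu n).pos _ (Ioo_subset_Ico_self (IsRadialSolution.exp_mem hs))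
  v_le n s hs := ((hu n).comp_exp_le hs).trans_eq (hu0 n)
  tendsto_v n := (hu n).tendsto_comp_exp
  E_nonneg n s hs := (hu n).flux_exp_nonneg hs
  monotoneOn_E n := (hu n).monotoneOn_flux_exp
  traj c hc η hη := by
    obtain ⟨V, hV⟩ := (eventually_atTop.1 (eventually_abs_le_mul_rpow hp H1 hη))
    filter_upwards [(hμ'.const_mul_atTop hc).eventually_ge_atTop (max V t₀)] with n hn
    have hv : ∀ s ∈ {s | s < 0 ∧ c * μ n ≤ u n (Real.exp s)}, 0 < u n (Real.exp s) := fun s hs =>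
      (hu n).pos _ (Ioo_subset_Ico_self (IsRadialSolution.exp_mem hs.1))
    have hhv : ∀ s ∈ {s | s < 0 ∧ c * μ n ≤ u n (Real.exp s)}, 0 < h (u n (Real.exp s)) :=
      fun s hs => hpos _ (((le_max_right _ _).trans hn).trans hs.2)
    refine ⟨hv, fun s hs => (hu n).flux_exp_nonneg hs.1, fun s hs => ?_,
      fun s hs => (hu n).hasDerivAt_comp_exp hs.1, fun s hs => ?_, _, fun s hs =>
      ⟨(hu n).hasDerivAt_mass hh hf hs.1 (hhv s hs), ?_⟩⟩
    · have h1 := hv s hs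
      have h2 := hhv s hs
      have h3 := (hu n).lam_pos
      rw [emdenMass, hf]
      positivity
    · refine ((hu n).hasDerivAt_flux_exp hs.1).congr_deriv ?_
      simp only [emdenMass, emdenHeight]
      have h1 : 0 < u n (Real.exp s) ^ (p - 1) := Real.rpow_pos_of_pos (hv s hs) _
      have h2 : p ≠ 0 := by positivity
      field_simp
    · have h1 := (hu n).flux_exp_nonneg hs.1
      have h2 := hV _ (((le_max_left _ _).trans hn).trans hs.2)
      simp only [emdenHeight, emdenFlux] at h2 ⊢
      rw [← sub_mul, add_sub_cancel_left, abs_mul, abs_of_nonneg h1]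
      exact (mul_le_mul_of_nonneg_right h2 h1).trans_eq (mul_assoc _ _ _)

end EmdenVariables

namespace IsRadialSolution

variable {lam p y α Γ r : ℝ} {f u : ℝ → ℝ}

lemma hasDerivAt_rescale (hu : IsRadialSolution lam f u) (hΓ : 0 < Γ) (hr : 0 < r) (hr1 : Γ * r < 1)
    (c : ℝ) :
    HasDerivAt (fun x => y * (u (Γ * x) - c)) (-(y * (-(Γ * r) * deriv u (Γ * r))) / r) r := by
  have h1 : HasDerivAt (fun x => Γ * x) Γ r := by simpa using (hasDerivAt_id r).const_mul Γ
  have h2 := (((hu.hasDerivAt ⟨mul_pos hΓ hr, hr1⟩).comp r h1).sub_const c).const_mul y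
  refine h2.congr_deriv ?_
  field_simp

lemma hasDerivAt_deriv_rescale (hu : IsRadialSolution lam f u) (hΓ : 0 < Γ) (hr : 0 < r)
    (hr1 : Γ * r < 1) (c : ℝ) :
    HasDerivAt (deriv fun x => y * (u (Γ * x) - c))
      (y * (-(Γ * r) * deriv u (Γ * r)) / r ^ 2 - y * (lam * f (u (Γ * r)) * (Γ * r) ^ 2) / r ^ 2)
      r := by
  have h1 : HasDerivAt (fun x => Γ * x) Γ r := by simpa using (hasDerivAt_id r).const_mul Γ
  have h2 := (((hu.hasDerivAt_deriv ⟨mul_pos hΓ hr, hr1⟩).comp r h1).const_mul (y * Γ))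
  have h3 : (deriv fun x => y * (u (Γ * x) - c)) =ᶠ[𝓝 r]
      fun x => y * Γ * (deriv u ∘ fun x => Γ * x) x := by
    have e1 : ∀ᶠ x in 𝓝 r, Γ * x < 1 := h1.continuousAt.eventually_lt_const hr1
    filter_upwards [e1, eventually_gt_nhds hr] with x hx1 hx0
    rw [(hu.hasDerivAt_rescale hΓ hx0 hx1 c).deriv, Function.comp_apply]
    field_simp
  refine (h2.congr_of_eventuallyEq h3).congr_deriv ?_
  field_simp
  ring

/-- Estimates for a solution rescaled around `exp t`, in terms of estimates for the Emden
variables. -/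
lemma abs_rescale_sub_le (hu : IsRadialSolution lam f u) (hα : 0 < α) {t M Q ε : ℝ} (hM : 0 < M)
    (htM : t + M < 0) (hQ : 0 < Q) (hε : 0 ≤ ε)
    (h1 : ∀ s, |s - t| ≤ M → |y * (-Real.exp s * deriv u (Real.exp s)) -
      liouvilleSlope α (s - t + bubbleTime α (Real.sqrt Q))| ≤ ε)
    (h2 : ∀ s, |s - t| ≤ M → |y * (lam * f (u (Real.exp s)) * Real.exp s ^ 2) -
      liouvilleMass α (s - t + bubbleTime α (Real.sqrt Q))| ≤ ε)
    (hΓ : Γ = Real.exp t / Real.sqrt Q)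
    (hr : r ∈ Icc (Real.exp (t - M) / Γ) (Real.exp (t + M) / Γ)) :
    |y * (u (Γ * r) - u (Real.exp t)) - bubbleProfile α r| ≤
      |bubbleProfile α (Real.sqrt Q)| + ε * M ∧
    |deriv (fun x => y * (u (Γ * x) - u (Real.exp t))) r - deriv (bubbleProfile α) r| ≤ ε / r ∧
    |deriv (deriv fun x => y * (u (Γ * x) - u (Real.exp t))) r -
      deriv (deriv (bubbleProfile α)) r| ≤ 2 * ε / r ^ 2 := by
  have hΓ0 : 0 < Γ := by rw [hΓ]; positivity
  have hr0 : 0 < r := (by positivity : 0 < Real.exp (t - M) / Γ).trans_le hr.1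
  obtain ⟨σ, hσ⟩ : ∃ σ, Real.exp σ = Γ * r := ⟨_, Real.exp_log (mul_pos hΓ0 hr0)⟩
  have hσ1 : t - M ≤ σ := by
    rw [← Real.exp_le_exp, hσ, mul_comm]; exact (div_le_iff₀ hΓ0).1 hr.1
  have hσ2 : σ ≤ t + M := by
    rw [← Real.exp_le_exp, hσ, mul_comm]; exact (le_div_iff₀ hΓ0).1 hr.2
  have hσM : |σ - t| ≤ M := abs_le.2 ⟨by linarith, by linarith⟩
  have hr1 : Γ * r < 1 := by rw [← hσ]; exact Real.exp_lt_one_iff.2 (by linarith)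
  have hsQ : 0 < Real.sqrt Q := Real.sqrt_pos.2 hQ
  have hexp : ∀ s, Real.exp s / Γ = Real.exp (s - t) * Real.sqrt Q := fun s => by
    rw [hΓ, Real.exp_sub]; field_simp
  have htime : ∀ s, bubbleTime α (Real.exp s / Γ) = s - t + bubbleTime α (Real.sqrt Q) := by
    intro s
    rw [hexp, bubbleTime, bubbleTime, mul_left_comm, Real.log_mul (Real.exp_pos _).ne'
      (by positivity), Real.log_exp]
  have hrσ : r = Real.exp σ / Γ := by rw [hσ, mul_div_cancel_left₀ _ hΓ0.ne']
  have hrt : bubbleTime α r = σ - t + bubbleTime α (Real.sqrt Q) := by rw [hrσ, htime]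
  have g1 := h1 σ hσM
  have g2 := h2 σ hσM
  rw [← hrt, hσ] at g1 g2
  refine ⟨?_, ?_, ?_⟩
  · have hD : ∀ s ∈ Icc (t - M) (t + M), HasDerivWithinAt
        (fun s => y * (u (Real.exp s) - u (Real.exp t)) - bubbleProfile α (Real.exp s / Γ))
        (-(y * (-Real.exp s * deriv u (Real.exp s)) -
          liouvilleSlope α (s - t + bubbleTime α (Real.sqrt Q)))) (Icc (t - M) (t + M)) s := by
      intro s hs
      have hs0 : s < 0 := hs.2.trans_lt htM
      have e1 := ((hu.hasDerivAt_comp_exp hs0).sub_const (u (Real.exp t))).const_mul y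
      have e2 := (hasDerivAt_bubbleProfile hα (r := Real.exp s / Γ) (by positivity)).comp s
        ((Real.hasDerivAt_exp s).div_const Γ)
      refine ((e1.sub e2).congr_deriv ?_).hasDerivWithinAt
      rw [htime]
      field_simp
      ring
    have hle := (convex_Icc (t - M) (t + M)).norm_image_sub_le_of_norm_hasDerivWithin_le
      (C := ε) hD (fun s hs => by
        rw [norm_neg]
        exact h1 s (abs_le.2 ⟨by linarith [hs.1], by linarith [hs.2]⟩))
      (show t ∈ _ from ⟨by linarith, by linarith⟩) ⟨hσ1, hσ2⟩
    simp only [Real.norm_eq_abs, sub_self, mul_zero, zero_sub] at hle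
    rw [hσ, mul_div_cancel_left₀ _ hΓ0.ne', hexp t, sub_self, Real.exp_zero, one_mul] at hle
    have := abs_sub_abs_le_abs_sub (y * (u (Γ * r) - u (Real.exp t)) - bubbleProfile α r)
      (-bubbleProfile α (Real.sqrt Q))
    rw [abs_neg] at this
    have : ε * |σ - t| ≤ ε * M := by gcongr
    linarith
  · rw [(hu.hasDerivAt_rescale hΓ0 hr0 hr1 _).deriv, (hasDerivAt_bubbleProfile hα hr0).deriv,
      ← sub_div, abs_div, abs_of_pos hr0, neg_sub_neg, abs_sub_comm]
    gcongr
  · rw [(hu.hasDerivAt_deriv_rescale hΓ0 hr0 hr1 _).deriv,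
      (hasDerivAt_deriv_bubbleProfile hα hr0).deriv, sub_sub_sub_comm, ← sub_div, ← sub_div,
      ← sub_div, abs_div, abs_of_pos (by positivity : 0 < r ^ 2)]
    gcongr
    exact (abs_sub _ _).trans (by linarith)

end IsRadialSolution

lemma IsRadialSolution.integral_weighted_mem {lam p : ℝ} {f u : ℝ → ℝ}
    (hu : IsRadialSolution lam f u) (hp : 1 < p) {r₁ r₂ : ℝ} (h1 : 0 < r₁) (h12 : r₁ ≤ r₂)
    (h2 : r₂ < 1) :
    ∫ x in r₁..r₂, lam * u x ^ (p - 1) * f (u x) * x ∈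
      Icc (u r₂ ^ (p - 1) * ∫ x in r₁..r₂, lam * f (u x) * x)
        (u r₁ ^ (p - 1) * ∫ x in r₁..r₂, lam * f (u x) * x) := by
  have hsub : uIcc r₁ r₂ ⊆ Icc 0 1 := by
    rw [uIcc_of_le h12]; exact Icc_subset_Icc h1.le h2.le
  have hp1 : 0 ≤ p - 1 := by linarith
  have hmem : ∀ {x}, x ∈ Icc r₁ r₂ → x ∈ Ioo (0:ℝ) 1 := fun hx =>
    ⟨h1.trans_le hx.1, hx.2.trans_lt h2⟩
  have c1 : ContinuousOn (fun x => lam * f (u x) * x) (uIcc r₁ r₂) :=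
    ((hu.continuousOn_comp.mono hsub).const_mul _).mul continuousOn_id
  have c2 : ContinuousOn (fun x => lam * u x ^ (p - 1) * f (u x) * x) (uIcc r₁ r₂) :=
    (((((hu.continuousOn.mono hsub).rpow_const fun _ _ => Or.inr hp1).const_mul _).mul
      (hu.continuousOn_comp.mono hsub))).mul continuousOn_id
  have hnn : ∀ x ∈ Icc r₁ r₂, 0 ≤ lam * f (u x) * x := fun x hx =>
    mul_nonneg (mul_nonneg hu.lam_pos.le (hu.f_nonneg _
      (hu.nonneg (Ioo_subset_Icc_self (hmem hx))))) (hmem hx).1.le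
  rw [← intervalIntegral.integral_const_mul, ← intervalIntegral.integral_const_mul]
  constructor <;> refine intervalIntegral.integral_mono_on h12 (ContinuousOn.intervalIntegrable ?_)
    (ContinuousOn.intervalIntegrable ?_) fun x hx => ?_
  · exact c1.const_mul _
  · exact c2
  · have := Real.rpow_le_rpow (hu.nonneg (Ioo_subset_Icc_self (hmem (right_mem_Icc.2 h12))))
      (hu.antitoneOn (hmem hx) (hmem (right_mem_Icc.2 h12)) hx.2) hp1
    exact (mul_le_mul_of_nonneg_right this (hnn x hx)).trans_eq (by ring)
  · exact c2
  · exact c1.const_mul _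
  · have := Real.rpow_le_rpow (hu.nonneg (Ioo_subset_Icc_self (hmem hx)))
      (hu.antitoneOn (hmem (left_mem_Icc.2 h12)) (hmem hx) hx.1) hp1
    exact (by ring : _ = u x ^ (p - 1) * (lam * f (u x) * x)).trans_le
      (mul_le_mul_of_nonneg_right this (hnn x hx))

lemma EmdenSeq.tendsto_rpow_mul {p : ℝ} {μ : ℕ → ℝ} {v E q : ℕ → ℝ → ℝ} (h : EmdenSeq p μ v E q)
    {δ w : ℝ} (hδ : 0 < δ) {τ : ℕ → ℝ} (hτ : ∀ n, τ n < 0)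
    (hv : Tendsto (fun n => v n (τ n) / μ n) atTop (𝓝 δ)) {e : ℕ → ℝ}
    (he : Tendsto (fun n => p * v n (τ n) ^ (p - 1) * e n) atTop (𝓝 w)) :
    Tendsto (fun n => p * μ n ^ (p - 1) * e n) atTop (𝓝 (w / δ ^ (p - 1))) := by
  refine (he.div (hv.rpow_const (p := p - 1) (Or.inl hδ.ne')) (by positivity)).congr fun n => ?_
  have h1 := h.v_pos n _ (hτ n)
  have h2 := h.μ_pos n
  rw [Pi.div_apply, Real.div_rpow h1.le h2.le]
  have := Real.rpow_pos_of_pos h1 (p - 1)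
  have := Real.rpow_pos_of_pos h2 (p - 1)
  field_simp

namespace BubbleWindow

variable {p δ α : ℝ} {f : ℝ → ℝ} {lam μ t M : ℕ → ℝ} {u : ℕ → ℝ → ℝ}

lemma tendsto_scale {v E q : ℕ → ℝ → ℝ} (hw : BubbleWindow p μ v E q δ α t M) (hα : 0 < α) :
    Tendsto (fun n => Real.exp (t n) / Real.sqrt (q n (t n))) atTop (𝓝 0) := by
  have h1 : Tendsto (fun n => Real.exp (t n)) atTop (𝓝 0) := by
    refine Real.tendsto_exp_atBot.comp (tendsto_atBot_mono (fun n => ?_)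
      (tendsto_neg_atTop_atBot.comp hw.tendsto_M))
    simp only [Function.comp_apply]
    linarith [hw.neg n]
  have := h1.div hw.center.mass.sqrt (Real.sqrt_pos.2 (by positivity)).ne'
  rwa [zero_div] at this

lemma tendsto_profile (hu : ∀ n, IsRadialSolution (lam n) f (u n)) (hα : 0 < α)
    (hw : BubbleWindow p μ (emdenHeight u) (emdenFlux u) (emdenMass p lam f u) δ α t M)
    {ε : ℝ} (hε : 0 < ε) :
    ∀ᶠ n in atTop, ∀ r ∈ Icc
      (Real.exp (t n - M n) / (Real.exp (t n) / Real.sqrt (emdenMass p lam f u n (t n))))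
      (Real.exp (t n + M n) / (Real.exp (t n) / Real.sqrt (emdenMass p lam f u n (t n)))),
      |p * u n (Real.exp (t n)) ^ (p - 1) *
        (u n (Real.exp (t n) / Real.sqrt (emdenMass p lam f u n (t n)) * r) -
          u n (Real.exp (t n))) -
          bubbleProfile α r| ≤ ε ∧
      |deriv (fun x => p * u n (Real.exp (t n)) ^ (p - 1) *
        (u n (Real.exp (t n) / Real.sqrt (emdenMass p lam f u n (t n)) * x) -
          u n (Real.exp (t n)))) r - deriv (bubbleProfile α) r| ≤ ε ∧
      |deriv (deriv fun x => p * u n (Real.exp (t n)) ^ (p - 1) *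
        (u n (Real.exp (t n) / Real.sqrt (emdenMass p lam f u n (t n)) * x) -
          u n (Real.exp (t n)))) r - deriv (deriv (bubbleProfile α)) r| ≤ ε := by
  set Q : ℕ → ℝ := fun n => emdenMass p lam f u n (t n) with hQ
  have hexp : ∀ c : ℝ, 0 < c → Tendsto (fun n => Real.exp (-(c * M n))) atTop (𝓝 0) :=
    fun c hc => Real.tendsto_exp_neg_atTop_nhds_zero.comp (hw.tendsto_M.const_mul_atTop hc)
  have hQlim : Tendsto Q atTop (𝓝 (α ^ 2 / 2)) := hw.center.mass
  have hQ2 : 0 < α ^ 2 / 2 := by positivity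
  have hsqrt : Tendsto (fun n => Real.sqrt (Q n)) atTop (𝓝 (α / Real.sqrt 2)) := by
    have := hQlim.sqrt
    rwa [Real.sqrt_div (by positivity), Real.sqrt_sq hα.le] at this
  have hs0 : α / Real.sqrt 2 ≠ 0 := by positivity
  have L1 : Tendsto (fun n => |bubbleProfile α (Real.sqrt (Q n))| + Real.exp (-(4 * M n)) * M n)
      atTop (𝓝 0) := by
    have h1 : Tendsto (fun n => bubbleProfile α (Real.sqrt (Q n))) atTop
        (𝓝 (bubbleProfile α (α / Real.sqrt 2))) :=
      ((hasDerivAt_bubbleProfile hα (by positivity)).continuousAt.tendsto).comp hsqrt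
    rw [bubbleProfile_center hα] at h1
    have h2 : Tendsto (fun n => Real.exp (-(4 * M n)) * M n) atTop (𝓝 0) := by
      refine squeeze_zero (fun n => by have := hw.pos n; positivity) (fun n => ?_)
        (hexp 3 three_pos)
      have h3 : M n ≤ Real.exp (M n) := by linarith [Real.add_one_le_exp (M n)]
      calc Real.exp (-(4 * M n)) * M n ≤ Real.exp (-(4 * M n)) * Real.exp (M n) := by gcongr
        _ = Real.exp (-(3 * M n)) := by rw [← Real.exp_add]; ring_nf
    simpa using h1.abs.add h2
  have L2 : Tendsto (fun n => Real.exp (-(3 * M n)) / Real.sqrt (Q n)) atTop (𝓝 0) := by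
    have := (hexp 3 three_pos).div hsqrt hs0
    rwa [zero_div] at this
  have L3 : Tendsto (fun n => 2 * Real.exp (-(2 * M n)) / Q n) atTop (𝓝 0) := by
    have := ((hexp 2 two_pos).const_mul 2).div hQlim hQ2.ne'
    rwa [mul_zero, zero_div] at this
  filter_upwards [hw.near, L1.eventually_le_const hε, L2.eventually_le_const hε,
    L3.eventually_le_const hε] with n hn h1 h2 h3 r hr
  have hQn : 0 < Q n := hw.q_pos n
  have hneg := hw.neg n
  obtain ⟨g1, g2, g3⟩ := (hu n).abs_rescale_sub_le (y := p * u n (Real.exp (t n)) ^ (p - 1))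
    (ε := Real.exp (-(4 * M n))) hα (hw.pos n) hneg hQn (Real.exp_pos _).le
    (fun s hs => (hn s hs).2.1) (fun s hs => by
      convert (hn s hs).2.2 using 3
      have hs0 : s < 0 := by linarith [(abs_le.1 hs).2]
      have e1 := (hu n).pos _ (Ioo_subset_Ico_self (IsRadialSolution.exp_mem hs0))
      have e2 := (hu n).pos _ (Ioo_subset_Ico_self (IsRadialSolution.exp_mem
        (show t n < 0 by linarith [hw.pos n])))
      simp only [emdenMass, emdenHeight]
      rw [Real.div_rpow e2.le e1.le]
      have := Real.rpow_pos_of_pos e1 (p - 1)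
      field_simp) rfl hr
  have hlow : Real.sqrt (Q n) * Real.exp (-M n) ≤ r := by
    refine le_trans (le_of_eq ?_) hr.1
    have : 0 < Real.sqrt (Q n) := Real.sqrt_pos.2 hQn
    change _ = Real.exp (t n - M n) / (Real.exp (t n) / Real.sqrt (Q n))
    rw [sub_eq_add_neg, Real.exp_add]
    field_simp
  have hlow0 : 0 < Real.sqrt (Q n) * Real.exp (-M n) :=
    mul_pos (Real.sqrt_pos.2 hQn) (Real.exp_pos _)
  refine ⟨g1.trans h1, g2.trans ?_, g3.trans ?_⟩
  · calc Real.exp (-(4 * M n)) / r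
        ≤ Real.exp (-(4 * M n)) / (Real.sqrt (Q n) * Real.exp (-M n)) := by gcongr
      _ = Real.exp (-(3 * M n)) / Real.sqrt (Q n) := by
        rw [show -(4 * M n) = -(3 * M n) + -M n by ring, Real.exp_add,
          mul_div_mul_right _ _ (Real.exp_pos _).ne']
      _ ≤ ε := h2
  · calc 2 * Real.exp (-(4 * M n)) / r ^ 2
        ≤ 2 * Real.exp (-(4 * M n)) / (Real.sqrt (Q n) * Real.exp (-M n)) ^ 2 := by gcongr
      _ = 2 * Real.exp (-(2 * M n)) / Q n := by
        rw [show -(4 * M n) = -(2 * M n) + -M n + -M n by ring, Real.exp_add, Real.exp_add,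
          mul_pow, Real.sq_sqrt hQn.le]
        have := Real.exp_pos (-M n)
        field_simp
      _ ≤ ε := h3

lemma integral_eq_flux (hu : ∀ n, IsRadialSolution (lam n) f (u n)) {s₁ s₂ : ℝ} (h12 : s₁ ≤ s₂)
    (h2 : s₂ < 0) (n : ℕ) :
    ∫ x in Real.exp s₁..Real.exp s₂, lam n * f (u n x) * x =
      emdenFlux u n s₂ - emdenFlux u n s₁ :=
  (hu n).integral_eq (Real.exp_pos _) (Real.exp_le_exp.2 h12) (Real.exp_lt_one_iff.2 h2)

variable {E q : ℕ → ℝ → ℝ}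

/-- The energy of a bubble. -/
lemma tendsto_energy (hu : ∀ n, IsRadialSolution (lam n) f (u n))
    (hw : BubbleWindow p μ (emdenHeight u) (emdenFlux u) q δ α t M)
    (h : EmdenSeq p μ (emdenHeight u) (emdenFlux u) q) (hδ : 0 < δ) (hα : 0 < α) :
    Tendsto (fun n => p * μ n ^ (p - 1) *
      ∫ x in Real.exp (t n - M n)..Real.exp (t n + M n), lam n * f (u n x) * x) atTop
      (𝓝 (2 * α / δ ^ (p - 1))) := by
  refine h.tendsto_rpow_mul hδ (fun n => by linarith [hw.neg n, hw.pos n]) hw.center.height ?_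
  have h1 := (hw.tendsto_slope_right hα).sub (hw.tendsto_slope_left hα)
  rw [show 2 + α - (2 - α) = 2 * α by ring] at h1
  refine h1.congr fun n => ?_
  rw [integral_eq_flux hu (by linarith [hw.pos n]) (hw.neg n), mul_sub]

/-- The weighted energy of a bubble. -/
lemma tendsto_weighted_energy (hu : ∀ n, IsRadialSolution (lam n) f (u n))
    (hw : BubbleWindow p μ (emdenHeight u) (emdenFlux u) q δ α t M)
    (h : EmdenSeq p μ (emdenHeight u) (emdenFlux u) q) (hα : 0 < α) :
    Tendsto (fun n => p * ∫ x in Real.exp (t n - M n)..Real.exp (t n + M n),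
      lam n * u n x ^ (p - 1) * f (u n x) * x) atTop (𝓝 (2 * α)) := by
  have hp := h.one_lt
  have h1 := (hw.tendsto_slope_right hα).sub (hw.tendsto_slope_left hα)
  rw [show 2 + α - (2 - α) = 2 * α by ring] at h1
  have key : ∀ τ : ℕ → ℝ, (∀ n, |τ n - t n| ≤ M n) → Tendsto (fun n => p * (emdenHeight u n (τ n)
      ^ (p - 1) * ∫ x in Real.exp (t n - M n)..Real.exp (t n + M n), lam n * f (u n x) * x)) atTop
      (𝓝 (2 * α)) := by
    intro τ hτ
    have h2 := ((hw.tendsto_v_ratio hτ).rpow_const (p := p - 1) (Or.inl one_ne_zero)).mul h1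
    rw [Real.one_rpow, one_mul] at h2
    refine h2.congr fun n => ?_
    have e1 := h.v_pos n (t n) (by linarith [hw.neg n, hw.pos n])
    have e2 := h.v_pos n (τ n) (by linarith [hw.neg n, (abs_le.1 (hτ n)).2])
    rw [integral_eq_flux hu (by linarith [hw.pos n]) (hw.neg n), Real.div_rpow e2.le e1.le]
    have := Real.rpow_pos_of_pos e1 (p - 1)
    field_simp
  have hmem := fun n => (hu n).integral_weighted_mem hp (Real.exp_pos (t n - M n))
    (Real.exp_le_exp.2 (show t n - M n ≤ t n + M n by linarith [hw.pos n]))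
    (Real.exp_lt_one_iff.2 (hw.neg n))
  refine tendsto_of_tendsto_of_tendsto_of_le_of_le
    (key (fun n => t n + M n) fun n => by rw [add_sub_cancel_left, abs_of_pos (hw.pos n)])
    (key (fun n => t n - M n) fun n => by
      rw [sub_sub_cancel_left, abs_neg, abs_of_pos (hw.pos n)]) (fun n => ?_) fun n => ?_
  · exact mul_le_mul_of_nonneg_left (hmem n).1 (by linarith)
  · exact mul_le_mul_of_nonneg_left (hmem n).2 (by linarith)

/-- No energy is left between two consecutive bubbles. -/
lemma tendsto_neck_energy (hu : ∀ n, IsRadialSolution (lam n) f (u n))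
    (hw : BubbleWindow p μ (emdenHeight u) (emdenFlux u) q δ α t M)
    (h : EmdenSeq p μ (emdenHeight u) (emdenFlux u) q) (hδ : 0 < δ) (hα : 0 < α)
    {δ' a : ℝ} {s : ℕ → ℝ} (hδ' : 0 < δ')
    (hs : BubbleExit p μ (emdenHeight u) (emdenFlux u) q δ' a s)
    (hts : Tendsto (fun n => t n - M n - s n) atTop atTop)
    (ha : 2 - α = (δ / δ') ^ (p - 1) * (2 + a)) :
    Tendsto (fun n => p * μ n ^ (p - 1) *
      ∫ x in Real.exp (s n)..Real.exp (t n - M n), lam n * f (u n x) * x) atTop (𝓝 0) := by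
  have h1 := (h.tendsto_rpow_mul hδ (fun n => by linarith [hw.neg n, hw.pos n]) hw.center.height
    (hw.tendsto_slope_left hα)).sub (h.tendsto_rpow_mul hδ' hs.neg hs.height hs.slope)
  have h0 : (2 - α) / δ ^ (p - 1) - (2 + a) / δ' ^ (p - 1) = 0 := by
    have := Real.rpow_pos_of_pos hδ (p - 1)
    have := Real.rpow_pos_of_pos hδ' (p - 1)
    rw [ha, Real.div_rpow hδ.le hδ'.le]
    field_simp
    ring
  rw [h0] at h1
  refine h1.congr' ?_
  filter_upwards [hts.eventually_ge_atTop 0] with n hn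
  rw [integral_eq_flux hu (by linarith) (by linarith [hw.neg n, hw.pos n]), mul_sub]

lemma tendsto_weighted_neck_energy (hu : ∀ n, IsRadialSolution (lam n) f (u n))
    (hw : BubbleWindow p μ (emdenHeight u) (emdenFlux u) q δ α t M)
    (h : EmdenSeq p μ (emdenHeight u) (emdenFlux u) q) (hδ : 0 < δ) (hα : 0 < α)
    {δ' a : ℝ} {s : ℕ → ℝ} (hδ' : 0 < δ')
    (hs : BubbleExit p μ (emdenHeight u) (emdenFlux u) q δ' a s)
    (hts : Tendsto (fun n => t n - M n - s n) atTop atTop)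
    (ha : 2 - α = (δ / δ') ^ (p - 1) * (2 + a)) :
    Tendsto (fun n => p * ∫ x in Real.exp (s n)..Real.exp (t n - M n),
      lam n * u n x ^ (p - 1) * f (u n x) * x) atTop (𝓝 0) := by
  have hp := h.one_lt
  refine tendsto_of_tendsto_of_tendsto_of_le_of_le' tendsto_const_nhds
    (hw.tendsto_neck_energy hu h hδ hα hδ' hs hts ha) ?_ ?_ <;>
  filter_upwards [hts.eventually_ge_atTop 0] with n hn
  all_goals
    have hneg : t n - M n < 0 := by linarith [hw.neg n, hw.pos n]
    have hle : s n ≤ t n - M n := by linarith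
    have hmem := (hu n).integral_weighted_mem hp (Real.exp_pos (s n)) (Real.exp_le_exp.2 hle)
      (Real.exp_lt_one_iff.2 hneg)
    have h1 := h.v_pos n _ (hs.neg n)
    have h2 := h.v_pos n _ hneg
    have h3 := h.v_le n _ (hs.neg n)
    have h4 : 0 ≤ ∫ x in Real.exp (s n)..Real.exp (t n - M n), lam n * f (u n x) * x := by
      rw [integral_eq_flux hu hle hneg]
      exact sub_nonneg.2 (h.monotoneOn_E n (hs.neg n) hneg hle)
    simp only [emdenHeight] at h1 h2 h3
  · exact mul_nonneg (by linarith) ((mul_nonneg (by positivity) h4).trans hmem.1)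
  · rw [mul_assoc]
    refine mul_le_mul_of_nonneg_left (hmem.2.trans (mul_le_mul_of_nonneg_right ?_ h4)) (by linarith)
    exact Real.rpow_le_rpow h1.le h3 (by linarith)

end BubbleWindow

lemma exists_seq_of_forall_exists {X : Type*} {P : ℕ → X → Prop} {S : ℕ → X → X → Prop}
    (hS : ∀ k x, P k x → ∃ y, P (k + 1) y ∧ S k x y) {x₀ : X} (hx₀ : P 0 x₀) :
    ∃ x : ℕ → X, x 0 = x₀ ∧ ∀ k, P k (x k) ∧ S k (x k) (x (k + 1)) := by
  choose g hg using hS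
  let y : ∀ k, {x // P k x} := fun k =>
    Nat.rec ⟨x₀, hx₀⟩ (fun k x => ⟨g k x.1 x.2, (hg k x.1 x.2).1⟩) k
  exact ⟨fun k => (y k).1, rfl, fun k => ⟨(y k).2, (hg k (y k).1 (y k).2).2⟩⟩

lemma IsRadialSolution.tendsto_mass_atBot {lam p : ℝ} {f u : ℝ → ℝ}
    (hu : IsRadialSolution lam f u) :
    Tendsto (fun s => p * lam * Real.exp s ^ 2 * u (Real.exp s) ^ (p - 1) * f (u (Real.exp s)))
      atBot (𝓝 0) := by
  have h0 : 0 < u 0 := hu.pos 0 ⟨le_rfl, one_pos⟩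
  have h1 := hu.tendsto_comp_exp_atBot
  have h2 := ((hu.f_cont.continuousAt (Ici_mem_nhds h0)).tendsto).comp h1
  simpa using (((Real.tendsto_exp_atBot.pow 2).const_mul (p * lam)).mul
    (h1.rpow_const (p := p - 1) (Or.inl h0.ne'))).mul h2

lemma IsBubbleSeq.pos {p : ℝ} {a δ : ℕ → ℝ} (hb : IsBubbleSeq p a δ) (k : ℕ) :
    0 < a k ∧ 0 < δ k := by
  cases k with
  | zero => rw [hb.1, hb.2.1]; exact ⟨two_pos, one_pos⟩
  | succ k => exact ⟨(hb.2.2 k).2.2.2.1, (hb.2.2 k).1.1⟩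

/-- The whole chain of bubbles, in the logarithmic variable. -/
lemma EmdenSeq.exists_bubbleWindows {p : ℝ} {μ : ℕ → ℝ} {v E q : ℕ → ℝ → ℝ}
    (h : EmdenSeq p μ v E q) (hq : ∀ n, ∃ s < 0, 0 < q n s) {a δ : ℕ → ℝ} (hb : IsBubbleSeq p a δ)
    {s₀ : ℕ → ℝ} (hs₀ : BubbleExit p μ v E q (δ 0) (a 0) s₀) :
    ∃ s t M : ℕ → ℕ → ℝ, s 0 = s₀ ∧ ∀ k, BubbleExit p μ v E q (δ k) (a k) (s k) ∧
      BubbleWindow p μ v E q (δ (k + 1)) (a (k + 1)) (t k) (M k) ∧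
      Tendsto (fun n => t k n - M k n - s k n) atTop atTop ∧
      s (k + 1) = fun n => t k n + M k n := by
  obtain ⟨s, hs0, hs⟩ := exists_seq_of_forall_exists
    (P := fun k s => BubbleExit p μ v E q (δ k) (a k) s)
    (S := fun k s s' => ∃ t M, BubbleWindow p μ v E q (δ (k + 1)) (a (k + 1)) t M ∧
      Tendsto (fun n => t n - M n - s n) atTop atTop ∧ s' = fun n => t n + M n) (by
    intro k s hs
    obtain ⟨h1, h2, h3, h4⟩ := hb.2.2 k
    obtain ⟨hak, hδk⟩ := hb.pos k
    obtain ⟨t, M, hw, ht⟩ := hs.exists_bubbleWindow h hδk hak (div_pos h1.1 hδk)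
      ((div_lt_one hδk).2 h1.2) h2 h3 h4.1 hq
    rw [div_mul_cancel₀ _ hδk.ne'] at hw
    exact ⟨_, hw.bubbleExit h h4.1, t, M, hw, ht, rfl⟩) hs₀
  choose hP t M hS using hs
  exact ⟨s, t, M, hs0, fun k => ⟨hP k, hS k⟩⟩

/-- Theorem 1.4 of the paper, the infinite sequence of bubbles for
`p > 2`. Here `R (k+1)`, `Ρ (k+1)`, `Ρb (k+1)` play the roles of `r_{k,n}`, `ρ_{k,n}`,
`ρ̄_{k,n}` (`k ≥ 1`) and `Ρ 0` is the given first-bubble sequence `ρ_{0,n}`. -/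
theorem statement12
    (p : ℝ) (hp : 2 < p)
    (h : ℝ → ℝ)
    (hhC1 : ContDiffOn ℝ 1 h (Set.Ici 0))
    (hhnonneg : ∀ t : ℝ, 0 ≤ t → 0 ≤ h t)
    (t₀ : ℝ) (ht₀ : 0 < t₀) (hhpos : ∀ t : ℝ, t₀ ≤ t → 0 < h t)
    (f : ℝ → ℝ) (hf : ∀ t : ℝ, f t = h t * Real.exp (t ^ p))
    (H1 : Tendsto (fun t : ℝ => deriv h t / (t ^ (p - 1) * h t)) atTop (nhds 0))
    (lam μ : ℕ → ℝ) (u : ℕ → ℝ → ℝ)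
    (hlam : ∀ n, 0 < lam n) (hμ : ∀ n, 0 < μ n)
    (huC2 : ∀ n, ContDiffOn ℝ 2 (u n) (Set.Icc 0 1))
    (hupos : ∀ n, ∀ r ∈ Set.Ico (0:ℝ) 1, 0 < u n r)
    (hu0 : ∀ n, u n 0 = μ n)
    (hu'0 : ∀ n, deriv (u n) 0 = 0)
    (hu1 : ∀ n, u n 1 = 0)
    (heq : ∀ n, ∀ r ∈ Set.Ioo (0:ℝ) 1,
      -(deriv (deriv (u n)) r) - deriv (u n) r / r = lam n * f (u n r))
    (hmuInf : Tendsto μ atTop atTop)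
    (a δ : ℕ → ℝ) (hb : IsBubbleSeq p a δ)
    -- the first-concentration sequence (ρ_{0,n}) from Theorem 1.1
    (ρ₀ : ℕ → ℝ) (hρ₀mem : ∀ n, ρ₀ n ∈ Set.Ioo (0:ℝ) 1)
    (hρ₀lim : Tendsto ρ₀ atTop (nhds 0))
    (hρ₀u : Tendsto (fun n => u n (ρ₀ n) / μ n) atTop (nhds 1))
    (hρ₀E : Tendsto (fun n =>
        p * μ n ^ (p - 1) * ∫ x in (0:ℝ)..(ρ₀ n), lam n * f (u n x) * x)
      atTop (nhds 4)) :
    ∃ φ : ℕ → ℕ, StrictMono φ ∧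
      ∃ R Ρ Ρb Γ : ℕ → ℕ → ℝ,
        (∀ n, Ρ 0 n = ρ₀ (φ n)) ∧
        ∀ k : ℕ,
          (∀ n, R (k + 1) n ∈ Set.Ioo (0:ℝ) 1) ∧
          (∀ n, Ρ (k + 1) n ∈ Set.Ioo (0:ℝ) 1) ∧
          (∀ n, Ρb (k + 1) n ∈ Set.Ioo (0:ℝ) 1) ∧
          -- location and scale of the (k+1)-th bubble
          Tendsto (fun n => u (φ n) (R (k + 1) n) / μ (φ n))
            atTop (nhds (δ (k + 1))) ∧
          Tendsto (fun n =>
              p * lam (φ n) * (R (k + 1) n) ^ 2 *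
                (u (φ n) (R (k + 1) n)) ^ (p - 1) * f (u (φ n) (R (k + 1) n)))
            atTop (nhds ((a (k + 1)) ^ 2 / 2)) ∧
          Tendsto (fun n => u (φ n) (Ρ (k + 1) n) / μ (φ n))
            atTop (nhds (δ (k + 1))) ∧
          Tendsto (fun n => u (φ n) (Ρb (k + 1) n) / μ (φ n))
            atTop (nhds (δ (k + 1))) ∧
          Tendsto (fun n => Ρ k n / Ρb (k + 1) n) atTop (nhds 0) ∧
          Tendsto (fun n => Ρb (k + 1) n / R (k + 1) n) atTop (nhds 0) ∧
          Tendsto (fun n => R (k + 1) n / Ρ (k + 1) n) atTop (nhds 0) ∧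
          -- the scaling parameters γ_{k,n}
          (∀ n, 0 < Γ (k + 1) n) ∧
          (∀ n, (Γ (k + 1) n) ^ 2 *
            (p * lam (φ n) * (u (φ n) (R (k + 1) n)) ^ (p - 1) *
              f (u (φ n) (R (k + 1) n))) = 1) ∧
          Tendsto (fun n => Γ (k + 1) n) atTop (nhds 0) ∧
          -- C² convergence of the rescaled solutions to the singular profile z_{k+1}
          (∀ ε : ℝ, 0 < ε → ∀ᶠ n in atTop,
            ∀ s ∈ Set.Icc (Ρb (k + 1) n / Γ (k + 1) n) (Ρ (k + 1) n / Γ (k + 1) n),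
              |p * (u (φ n) (R (k + 1) n)) ^ (p - 1) *
                  (u (φ n) (Γ (k + 1) n * s) - u (φ n) (R (k + 1) n)) -
                bubbleProfile (a (k + 1)) s| ≤ ε ∧
              |deriv (fun x => p * (u (φ n) (R (k + 1) n)) ^ (p - 1) *
                  (u (φ n) (Γ (k + 1) n * x) - u (φ n) (R (k + 1) n))) s -
                deriv (bubbleProfile (a (k + 1))) s| ≤ ε ∧
              |deriv (deriv (fun x => p * (u (φ n) (R (k + 1) n)) ^ (p - 1) *
                  (u (φ n) (Γ (k + 1) n * x) - u (φ n) (R (k + 1) n)))) s -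
                deriv (deriv (bubbleProfile (a (k + 1)))) s| ≤ ε) ∧
          -- properties of the limit profile z_{k+1}
          (∀ s ∈ Set.Ioi (0:ℝ),
            -(deriv (deriv (bubbleProfile (a (k + 1)))) s) -
              deriv (bubbleProfile (a (k + 1))) s / s =
              Real.exp (bubbleProfile (a (k + 1)) s)) ∧
          bubbleProfile (a (k + 1)) (a (k + 1) / Real.sqrt 2) = 0 ∧
          -(a (k + 1) / Real.sqrt 2) *
            deriv (bubbleProfile (a (k + 1))) (a (k + 1) / Real.sqrt 2) = 2 ∧
          (∫ s in Set.Ioi (0:ℝ), Real.exp (bubbleProfile (a (k + 1)) s) * s)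
            = 2 * a (k + 1) ∧
          -- energy estimates
          Tendsto (fun n =>
              p * μ (φ n) ^ (p - 1) *
                ∫ x in (Ρ k n)..(Ρb (k + 1) n), lam (φ n) * f (u (φ n) x) * x)
            atTop (nhds 0) ∧
          Tendsto (fun n =>
              p * μ (φ n) ^ (p - 1) *
                ∫ x in (Ρb (k + 1) n)..(Ρ (k + 1) n), lam (φ n) * f (u (φ n) x) * x)
            atTop (nhds (2 * a (k + 1) / δ (k + 1) ^ (p - 1))) ∧
          Tendsto (fun n =>
              p * ∫ x in (Ρ k n)..(Ρb (k + 1) n),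
                lam (φ n) * (u (φ n) x) ^ (p - 1) * f (u (φ n) x) * x)
            atTop (nhds 0) ∧
          Tendsto (fun n =>
              p * ∫ x in (Ρb (k + 1) n)..(Ρ (k + 1) n),
                lam (φ n) * (u (φ n) x) ^ (p - 1) * f (u (φ n) x) * x)
            atTop (nhds (2 * a (k + 1))) := by
  have hp1 : 1 < p := by linarith
  have hfc : ContinuousOn f (Set.Ici 0) := by
    rw [show f = fun t => h t * Real.exp (t ^ p) from funext hf]
    exact hhC1.continuousOn.mul (Real.continuous_exp.comp_continuousOn
      (continuousOn_id.rpow_const fun _ _ => Or.inr (by linarith)))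
  have hf0 : ∀ t, 0 ≤ t → 0 ≤ f t := fun t ht => by
    rw [hf]
    exact mul_nonneg (hhnonneg t ht) (Real.exp_pos _).le
  have hu : ∀ n, IsRadialSolution (lam n) f (u n) := fun n =>
    ⟨hlam n, hfc, hf0, huC2 n, hupos n, hu1 n, heq n⟩
  obtain ⟨N, hN⟩ := eventually_atTop.1 (hmuInf.eventually_gt_atTop t₀)
  set φ : ℕ → ℕ := fun n => n + N with hφ
  have hφ' : StrictMono φ := fun a b hab => Nat.add_lt_add_right hab N
  have hE := emdenSeq_of_isRadialSolution hp1 hhC1 hhpos hf H1 (fun n => hu (φ n))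
    (fun n => hu0 (φ n)) (fun n => hμ (φ n)) (hmuInf.comp hφ'.tendsto_atTop)
  have hq : ∀ n, ∃ s < 0, 0 < emdenMass p (fun n => lam (φ n)) f (fun n => u (φ n)) n s := by
    intro n
    have h1 := (hu (φ n)).tendsto_comp_exp_atBot
    rw [hu0] at h1
    obtain ⟨s, hs1, hs2⟩ := ((h1.eventually_const_lt (hN (φ n) (Nat.le_add_left N n))).and
      (eventually_lt_atBot 0)).exists
    refine ⟨s, hs2, ?_⟩
    have := hhpos _ hs1.le
    have := hlam (φ n)
    have := ht₀.trans hs1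
    rw [emdenMass, hf]
    positivity
  have hlog : ∀ n, Real.exp (Real.log (ρ₀ (φ n))) = ρ₀ (φ n) := fun n =>
    Real.exp_log (hρ₀mem _).1
  have hexit := hE.bubbleExit_first (s := fun n => Real.log (ρ₀ (φ n)))
    (fun n => Real.log_neg (hρ₀mem _).1 (hρ₀mem _).2)
    (by
      simp only [emdenHeight, hlog]
      exact hρ₀u.comp hφ'.tendsto_atTop)
    (by
      simp only [emdenFlux, hlog]
      refine (hρ₀E.comp hφ'.tendsto_atTop).congr fun n => ?_
      rw [Function.comp_apply, (hu (φ n)).integral_zero_eq (hρ₀mem _)])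
    (fun n => (hu (φ n)).tendsto_flux_exp) (fun n => (hu (φ n)).tendsto_mass_atBot)
  rw [← hb.1, ← hb.2.1] at hexit
  obtain ⟨s, t, M, hs0, hstep⟩ := hE.exists_bubbleWindows hq hb hexit
  refine ⟨φ, hφ', fun k n => Real.exp (t (k - 1) n), fun k n => Real.exp (s k n),
    fun k n => Real.exp (t (k - 1) n - M (k - 1) n), fun k n => Real.exp (t (k - 1) n) /
      Real.sqrt (emdenMass p (fun n => lam (φ n)) f (fun n => u (φ n)) n (t (k - 1) n)),
    fun n => by simp only [hs0, hlog], fun k => ?_⟩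
  simp only [Nat.add_sub_cancel]
  obtain ⟨hex, hw, hts, hsucc⟩ := hstep k
  obtain ⟨hδ, -, ha, hα, -⟩ := hb.2.2 k
  have hα2 : 2 - a (k + 1) = (δ (k + 1) / δ k) ^ (p - 1) * (2 + a k) := by rw [ha]; ring
  have hδk := (hb.pos k).2
  simp only [hsucc]
  have hM := hw.pos
  have hneg := hw.neg
  have hneg1 : ∀ n, t k n < 0 := fun n => by linarith [hM n, hneg n]
  have hneg2 : ∀ n, t k n - M k n < 0 := fun n => by linarith [hM n, hneg n]
  have hexpM : Tendsto (fun n => Real.exp (-M k n)) atTop (nhds 0) :=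
    Real.tendsto_exp_neg_atTop_nhds_zero.comp hw.tendsto_M
  refine ⟨fun n => IsRadialSolution.exp_mem (hneg1 n), fun n => IsRadialSolution.exp_mem (hneg n),
    fun n => IsRadialSolution.exp_mem (hneg2 n), hw.center.height, hw.center.mass,
    hw.tendsto_height hE fun n => ?_, hw.tendsto_height hE fun n => ?_, ?_, ?_, ?_, fun n => ?_,
    fun n => ?_, hw.tendsto_scale hα, fun ε hε => hw.tendsto_profile (fun n => hu (φ n)) hα hε,
    fun r hr => bubbleProfile_ode hα hr, bubbleProfile_center hα, deriv_bubbleProfile_center hα,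
    integral_exp_bubbleProfile hα,
    hw.tendsto_neck_energy (fun n => hu (φ n)) hE hδ.1 hα hδk hex hts hα2,
    hw.tendsto_energy (fun n => hu (φ n)) hE hδ.1 hα,
    hw.tendsto_weighted_neck_energy (fun n => hu (φ n)) hE hδ.1 hα hδk hex hts hα2,
    hw.tendsto_weighted_energy (fun n => hu (φ n)) hE hα⟩
  · rw [add_sub_cancel_left, abs_of_pos (hM n)]
  · rw [sub_sub_cancel_left, abs_neg, abs_of_pos (hM n)]
  · refine (Real.tendsto_exp_neg_atTop_nhds_zero.comp hts).congr fun n => ?_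
    rw [Function.comp_apply, ← Real.exp_sub, neg_sub]
  · refine hexpM.congr fun n => ?_
    rw [← Real.exp_sub, sub_sub_cancel_left]
  · refine hexpM.congr fun n => ?_
    rw [← Real.exp_sub, sub_add_cancel_left]
  · exact div_pos (Real.exp_pos _) (Real.sqrt_pos.2 (hw.q_pos n))
  · have h1 := hw.q_pos n
    rw [div_pow, Real.sq_sqrt h1.le, div_mul_eq_mul_div, div_eq_one_iff_eq h1.ne']
    simp only [emdenMass]
    ring
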